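/- arXiv:2403.02492 — 2 statements merged into one kernel-verified Lean document; each statement's English description precedes it below -/
import Mathlib

section
/- The isomorphism problem for finitely generated recursively presented groups is a Σ⁰₃-complete equivalence relation: the equivalence relation on ℕ given by ⟨k,e⟩ ~ ⟨k',e'⟩ iff the group presented by the e-th c.e. presentation on k generators is isomorphic to the group presented by the e'-th c.e. presentation on k' generators is Σ⁰₃ (as a subset of ℕ² under a computable pairing), and every Σ⁰₃ equivalence relation on ℕ computably reduces to it. -/
/-- The `e`-th computably enumerable subset of `ℕ`: the domain of the `e`-th partial
computable function. -/
def W (e : ℕ) : Set ℕ := {n | ((Denumerable.ofNat Nat.Partrec.Code e).eval n).Dom}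

/-- A set `S ⊆ ℕ` is Σ⁰₃ if there is a computable predicate `R ⊆ ℕ⁴` with
`n ∈ S ↔ ∃x ∀y ∃z, R n x y z`. -/
def IsSigma03 (S : Set ℕ) : Prop :=
  ∃ R : ℕ → ℕ → ℕ → ℕ → Bool,
    (Computable fun p : ℕ × ℕ × ℕ × ℕ => R p.1 p.2.1 p.2.2.1 p.2.2.2) ∧
    ∀ n, n ∈ S ↔ ∃ x, ∀ y, ∃ z, R n x y z = true

/-- A binary relation on `ℕ` is Σ⁰₃ if the corresponding set of codes of pairs
(under the standard computable pairing) is Σ⁰₃. -/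
def Sigma03Rel (E : ℕ → ℕ → Prop) : Prop :=
  IsSigma03 {p : ℕ | E p.unpair.1 p.unpair.2}

/-- `E` computably reduces to `F`: there is a total computable `Φ` with
`m E n ↔ Φ(m) F Φ(n)`. -/
def ComputableReduction (E F : ℕ → ℕ → Prop) : Prop :=
  ∃ Φ : ℕ → ℕ, Computable Φ ∧ ∀ m n, E m n ↔ F (Φ m) (Φ n)

/-- Code of an element of the free group on `Fin k`, via its reduced word. -/
def encodeFG {k : ℕ} (g : FreeGroup (Fin k)) : ℕ := Encodable.encode g.toWord

/-- The relator set of the `e`-th c.e. presentation on `k` generators: the set of elements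
of the free group on `k` generators whose codes lie in `W e`.  The presented group
`⟨x₁,…,x_k ∣ relSet k e⟩` is `PresentedGroup (relSet k e)`, the quotient of the free group
by the normal closure of this set. -/
def relSet (k e : ℕ) : Set (FreeGroup (Fin k)) := {g | encodeFG g ∈ W e}

/-- The isomorphism problem for finitely generated recursively presented groups:
`⟨k,e⟩ ~ ⟨k',e'⟩` iff the group presented by the `e`-th c.e. presentation on `k`
generators is isomorphic to the group presented by the `e'`-th c.e. presentation on
`k'` generators. -/
def GroupIsoFG (n n' : ℕ) : Prop :=
  Nonempty (PresentedGroup (relSet n.unpair.1 n.unpair.2) ≃*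
    PresentedGroup (relSet n'.unpair.1 n'.unpair.2))

namespace FGIso

/-- The free group of rank two. -/
abbrev Q := FreeGroup (Fin 2)

/-- An iterated wreath-like product over the free group `Q`: an element has a position `g`,
a lamp `k s` in `K` at each `s`, and a label `w i q s j` for `i < 3`, `q s : Q`, `j : K`. -/
@[ext]
structure Big (K : Type) where
  w : Fin 3 → Q → Q → K → ZMod 30
  k : Q → K
  g : Q

namespace Big

lemma ext' {K : Type} {x y : Big K} (hw : ∀ i q s j, x.w i q s j = y.w i q s j)
    (hk : ∀ s, x.k s = y.k s) (hg : x.g = y.g) : x = y :=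
  Big.ext (by funext i q s j; exact hw i q s j) (funext hk) hg

variable {K : Type} [Group K]

instance : Mul (Big K) := ⟨fun x y =>
  { w := fun i q s j => x.w i q s j + y.w i (x.g⁻¹ * q) (x.g⁻¹ * s) ((x.k s)⁻¹ * j)
    k := fun s => x.k s * y.k (x.g⁻¹ * s)
    g := x.g * y.g }⟩

instance : One (Big K) := ⟨⟨fun _ _ _ _ => 0, fun _ => 1, 1⟩⟩

instance : Inv (Big K) := ⟨fun x =>
  { w := fun i q s j => -x.w i (x.g * q) (x.g * s) (x.k (x.g * s) * j)
    k := fun s => (x.k (x.g * s))⁻¹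
    g := x.g⁻¹ }⟩

lemma mul_w (x y : Big K) (i q s j) : (x * y).w i q s j =
    x.w i q s j + y.w i (x.g⁻¹ * q) (x.g⁻¹ * s) ((x.k s)⁻¹ * j) := rfl
lemma mul_k (x y : Big K) (s) : (x * y).k s = x.k s * y.k (x.g⁻¹ * s) := rfl
@[simp] lemma mul_g (x y : Big K) : (x * y).g = x.g * y.g := rfl
@[simp] lemma one_w (i q s j) : (1 : Big K).w i q s j = 0 := rfl
@[simp] lemma one_k (s) : (1 : Big K).k s = 1 := rfl
@[simp] lemma one_g : (1 : Big K).g = 1 := rfl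
lemma inv_w (x : Big K) (i q s j) :
    (x⁻¹).w i q s j = -x.w i (x.g * q) (x.g * s) (x.k (x.g * s) * j) := rfl
lemma inv_k (x : Big K) (s) : (x⁻¹).k s = (x.k (x.g * s))⁻¹ := rfl
@[simp] lemma inv_g (x : Big K) : (x⁻¹).g = x.g⁻¹ := rfl

instance : Group (Big K) := Group.ofLeftAxioms
  (fun x y z => ext' (fun i q s j => by simp [mul_w, mul_k, mul_assoc, add_assoc])
    (fun s => by simp [mul_k, mul_assoc]) (by simp [mul_assoc]))
  (fun x => ext' (fun i q s j => by simp [mul_w]) (fun s => by simp [mul_k]) (by simp))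
  (fun x => ext' (fun i q s j => by simp [mul_w, inv_w, inv_k])
    (fun s => by simp [mul_k, inv_k]) (by simp))

/-- The position of an element. -/
def gHom : Big K →* Q where
  toFun := Big.g
  map_one' := rfl
  map_mul' _ _ := rfl

@[simp] lemma pow_g (x : Big K) (n : ℕ) : (x ^ n).g = x.g ^ n := map_pow gHom x n

lemma pow_k {x : Big K} (hx : x.g = 1) (n : ℕ) (s) : (x ^ n).k s = x.k s ^ n := by
  induction n with
  | zero => simp
  | succ n ih => simp [pow_succ, mul_k, ih, hx]

lemma pow_w {x : Big K} (hx : x.g = 1) (hk : ∀ s, x.k s = 1) (n : ℕ) (i q s j) :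
    (x ^ n).w i q s j = n * x.w i q s j := by
  induction n with
  | zero => simp
  | succ n ih => simp [pow_succ, mul_w, ih, hx, pow_k, hk]; ring

lemma conj_k (y : Big K) {u : Big K} (hu : u.g = 1) (s) :
    (y * u * y⁻¹).k s = y.k s * u.k (y.g⁻¹ * s) * (y.k s)⁻¹ := by
  simp [mul_k, inv_k, hu]

lemma conj_g (y : Big K) {u : Big K} (hu : u.g = 1) : (y * u * y⁻¹).g = 1 := by simp [hu]

/-- Erase the labels `w i q s` with `q⁻¹ * s ∈ S i`. -/
def mask (S : Fin 3 → Set Q) [∀ i, DecidablePred (· ∈ S i)] : Big K →* Big K where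
  toFun x := ⟨fun i q s j => if q⁻¹ * s ∈ S i then 0 else x.w i q s j, x.k, x.g⟩
  map_one' := ext' (fun _ _ _ _ => by simp) (fun _ => rfl) rfl
  map_mul' x y := ext' (fun i q s j => by simp only [mul_w]; split_ifs with h <;> simp_all [mul_assoc])
    (fun _ => rfl) rfl

/-- The generating position letter. -/
def lift (q : Q) : Big K := ⟨fun _ _ _ _ => 0, fun _ => 1, q⟩

open Classical in
/-- The lamp `κ` at position `x`. -/
noncomputable def lamp (x : Q) (κ : K) : Big K :=
  ⟨fun _ _ _ _ => 0, fun s => if s = x then κ else 1, 1⟩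

/-- Elements of prime order `2, 3, 5` in `ZMod 30`. -/
def elt : Fin 3 → ZMod 30 := ![15, 10, 6]

/-- The primes `2, 3, 5`. -/
def prm : Fin 3 → ℕ := ![2, 3, 5]

lemma prm_elt : ∀ i, (prm i : ZMod 30) * elt i = 0 := by decide
lemma elt_ne : ∀ i, elt i ≠ 0 := by decide
lemma prm_coprime : ∀ i j, i ≠ j → ∀ a : ZMod 30, (prm i : ZMod 30) * a = 0 →
    (prm j : ZMod 30) * a = 0 → a = 0 := by decide

open Classical in
/-- The unmasked label generator of colour `i`. -/
noncomputable def label (i : Fin 3) : Big K :=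
  ⟨fun i' q _ j => if i' = i ∧ q = 1 ∧ j = 1 then elt i else 0, fun _ => 1, 1⟩

lemma lift_mul (x y : Q) : (lift (x * y) : Big K) = lift x * lift y :=
  ext' (fun _ _ _ _ => by simp [mul_w, lift]) (fun _ => by simp [mul_k, lift]) rfl

/-- `lift` as a homomorphism. -/
def liftHom : Q →* Big K where
  toFun := lift
  map_one' := rfl
  map_mul' := lift_mul

@[simp] lemma lift_g (x : Q) : (lift x : Big K).g = x := rfl
@[simp] lemma lift_k (x s : Q) : (lift x : Big K).k s = 1 := rfl
@[simp] lemma lift_w (x : Q) (i q s j) : (lift x : Big K).w i q s j = 0 := rfl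
@[simp] lemma lamp_g (x : Q) (κ : K) : (lamp x κ).g = 1 := rfl
@[simp] lemma lamp_w (x : Q) (κ : K) (i q s j) : (lamp x κ).w i q s j = 0 := rfl
open Classical in
lemma lamp_k (x : Q) (κ : K) (s) : (lamp x κ).k s = if s = x then κ else 1 := by
  simp [lamp]
@[simp] lemma lamp_k_self (x : Q) (κ : K) : (lamp x κ).k x = κ := by simp [lamp]
lemma lamp_k_of_ne {x s : Q} (h : s ≠ x) (κ : K) : (lamp x κ).k s = 1 := by simp [lamp, h]

lemma lift_conj_lamp (g x : Q) (κ : K) :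
    lift g * lamp x κ * (lift g)⁻¹ = lamp (g * x) κ :=
  ext' (fun _ _ _ _ => by simp [mul_w, inv_w])
    (fun s => by simp [mul_k, inv_k, lamp_k, inv_mul_eq_iff_eq_mul]) (by simp)

@[simp] lemma label_g (i : Fin 3) : (label i : Big K).g = 1 := rfl
@[simp] lemma label_k (i : Fin 3) (s) : (label i : Big K).k s = 1 := rfl

open Classical in
lemma label_w (i : Fin 3) (i' q s j) : (label i : Big K).w i' q s j =
    if i' = i ∧ q = 1 ∧ j = 1 then elt i else 0 := by simp [label]

lemma mask_w (S : Fin 3 → Set Q) [∀ i, DecidablePred (· ∈ S i)] (x : Big K) (i q s j) :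
    (mask S x).w i q s j = if q⁻¹ * s ∈ S i then 0 else x.w i q s j := rfl
@[simp] lemma mask_k (S : Fin 3 → Set Q) [∀ i, DecidablePred (· ∈ S i)] (x : Big K) (s) :
    (mask S x).k s = x.k s := rfl
@[simp] lemma mask_g (S : Fin 3 → Set Q) [∀ i, DecidablePred (· ∈ S i)] (x : Big K) :
    (mask S x).g = x.g := rfl

@[simp] lemma mask_lift (S : Fin 3 → Set Q) [∀ i, DecidablePred (· ∈ S i)] (x : Q) :
    mask S (lift x : Big K) = lift x :=
  ext' (fun _ _ _ _ => by simp [mask_w]) (fun _ => rfl) rfl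
@[simp] lemma mask_lamp (S : Fin 3 → Set Q) [∀ i, DecidablePred (· ∈ S i)] (x : Q) (κ : K) :
    mask S (lamp x κ) = lamp x κ :=
  ext' (fun _ _ _ _ => by simp [mask_w]) (fun _ => rfl) rfl

end Big

/-- The alphabet of the finitely generated groups. -/
abbrev Gen (K : Type) := Fin 2 ⊕ K ⊕ Fin 3

variable {K : Type} [Group K]

/-- The unmasked value of a generator. -/
noncomputable def genVal : Gen K → Big K
  | .inl c => Big.lift (FreeGroup.of c)
  | .inr (.inl κ) => Big.lamp 1 κ
  | .inr (.inr i) => Big.label i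

open Classical in
/-- The evaluation of a word in the masked group. -/
noncomputable def Ev (K : Type) [Group K] (S : Fin 3 → Set Q) : FreeGroup (Gen K) →* Big K :=
  (Big.mask S).comp (FreeGroup.lift genVal)

/-- The finitely generated group coding the triple of sets `S`. -/
noncomputable abbrev Grp (K : Type) [Group K] (S : Fin 3 → Set Q) : Subgroup (Big K) := (Ev K S).range

variable {S : Fin 3 → Set Q}

lemma lift_mem (x : Q) : (Big.lift x : Big K) ∈ Grp K S := by
  have : Big.liftHom = (Ev K S).comp (FreeGroup.map (Sum.inl : Fin 2 → Gen K)) := by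
    refine FreeGroup.ext_hom _ _ fun c => ?_
    simp [Ev, genVal]
    rfl
  exact ⟨_, (DFunLike.congr_fun this x).symm⟩

lemma lamp_mem (x : Q) (κ : K) : Big.lamp x κ ∈ Grp K S := by
  have h1 : Big.lamp 1 κ ∈ Grp K S := ⟨FreeGroup.of (.inr (.inl κ)), by simp [Ev, genVal]⟩
  have := (Grp K S).mul_mem ((Grp K S).mul_mem (lift_mem x) h1) ((Grp K S).inv_mem (lift_mem x))
  simpa [Big.lift_conj_lamp] using this

open Classical in
lemma label_mem (i : Fin 3) : Big.mask S (Big.label i : Big K) ∈ Grp K S :=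
  ⟨FreeGroup.of (.inr (.inr i)), by simp [Ev, genVal]⟩

/-- The shape of the elements of `Grp K S`: outside a finite set of positions the lamps are off and
the labels are a masked function of `i` and `q` only. -/
def Shape (S : Fin 3 → Set Q) (x : Big K) : Prop :=
  ∃ D : Set Q, D.Finite ∧ ∃ β : Fin 3 → Q → ZMod 30, (∀ i q, (Big.prm i : ZMod 30) * β i q = 0) ∧
    ∀ s ∉ D, x.k s = 1 ∧ (∀ i q, q⁻¹ * s ∈ S i → ∀ j, x.w i q s j = 0) ∧
      ∀ i q, q⁻¹ * s ∉ S i → x.w i q s 1 = β i q ∧ ∀ j ≠ 1, x.w i q s j = 0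

lemma Shape.mul {x y : Big K} (hx : Shape S x) (hy : Shape S y) : Shape S (x * y) := by
  obtain ⟨D, hD, β, hβ, h⟩ := hx
  obtain ⟨D', hD', β', hβ', h'⟩ := hy
  refine ⟨D ∪ (x.g * ·) '' D', hD.union (hD'.image _), fun i q => β i q + β' i (x.g⁻¹ * q),
    fun i q => by simp [mul_add, hβ, hβ'], fun s hs => ?_⟩
  have h1 : s ∉ D := fun h => hs (Or.inl h)
  have h2 : x.g⁻¹ * s ∉ D' := fun h => hs (Or.inr ⟨_, h, by simp⟩)
  obtain ⟨a1, a2, a3⟩ := h s h1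
  obtain ⟨b1, b2, b3⟩ := h' _ h2
  refine ⟨by simp [Big.mul_k, a1, b1], fun i q hq j => ?_, fun i q hq => ⟨?_, fun j hj => ?_⟩⟩
  · rw [Big.mul_w, a2 i q hq, b2 _ _ (by simpa [mul_assoc] using hq), add_zero]
  · rw [Big.mul_w, (a3 i q hq).1, a1, inv_one, one_mul,
      (b3 i (x.g⁻¹ * q) (by simpa [mul_assoc] using hq)).1]
  · rw [Big.mul_w, (a3 i q hq).2 j hj, a1, inv_one, one_mul,
      (b3 i (x.g⁻¹ * q) (by simpa [mul_assoc] using hq)).2 j hj, add_zero]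

lemma Shape.inv {x : Big K} (hx : Shape S x) : Shape S x⁻¹ := by
  obtain ⟨D, hD, β, hβ, h⟩ := hx
  refine ⟨(x.g⁻¹ * ·) '' D, hD.image _, fun i q => -β i (x.g * q), fun i q => by simp [hβ],
    fun s hs => ?_⟩
  have h1 : x.g * s ∉ D := fun h => hs ⟨_, h, by simp⟩
  obtain ⟨a1, a2, a3⟩ := h _ h1
  refine ⟨by simp [Big.inv_k, a1], fun i q hq j => ?_, fun i q hq => ⟨?_, fun j hj => ?_⟩⟩
  · rw [Big.inv_w, a2 i (x.g * q) (by simpa [mul_assoc] using hq), neg_zero]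
  · rw [Big.inv_w, a1, one_mul, (a3 i (x.g * q) (by simpa [mul_assoc] using hq)).1]
  · rw [Big.inv_w, a1, one_mul, (a3 i (x.g * q) (by simpa [mul_assoc] using hq)).2 j hj, neg_zero]

lemma shape_of_mem {x : Big K} (hx : x ∈ Grp K S) : Shape S x := by
  classical
  obtain ⟨L, rfl⟩ := hx
  induction L using FreeGroup.induction_on with
  | C1 => exact ⟨∅, Set.finite_empty, 0, by simp, by simp⟩
  | of a =>
    rcases a with c | κ | i
    · exact ⟨∅, Set.finite_empty, 0, by simp, by simp [Ev, genVal]⟩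
    · exact ⟨{1}, Set.finite_singleton _, 0, by simp, by simp +contextual [Ev, genVal, Big.lamp_k]⟩
    · refine ⟨∅, Set.finite_empty, fun i' q => if i' = i ∧ q = 1 then Big.elt i else 0, ?_, ?_⟩
      · intro i' q
        beta_reduce
        split_ifs with h
        · rw [h.1]; exact Big.prm_elt i
        · simp
      · simp +contextual [Ev, genVal, Big.label_w, Big.mask_w]
  | inv_of a h => rw [map_inv]; exact h.inv
  | mul a b ha hb => rw [map_mul]; exact ha.mul hb

section Simple

variable {K : Type} [Group K]

/-- In a simple group with trivial centre, no two nontrivial elements commute up to all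
conjugations. -/
def PrimeProp (K : Type) [Group K] : Prop :=
  ∀ x y : K, x ≠ 1 → y ≠ 1 → ∃ κ : K, ¬ Commute x (κ * y * κ⁻¹)

/-- Any subgroup containing all conjugates of a nontrivial element is everything. -/
def NormalGen (K : Type) [Group K] : Prop :=
  ∀ x : K, x ≠ 1 → ∀ H : Subgroup K, (∀ κ, κ * x * κ⁻¹ ∈ H) → H = ⊤

lemma normalGen_of_simple [IsSimpleGroup K] : NormalGen K := by
  intro x hx H hH
  have h1 : Subgroup.normalClosure {x} = ⊤ :=
    (Subgroup.normalClosure_normal.eq_bot_or_eq_top).resolve_left fun h =>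
      hx (by simpa [h] using Subgroup.subset_normalClosure (Set.mem_singleton x))
  rw [eq_top_iff, ← h1, Subgroup.normalClosure, Subgroup.closure_le]
  intro y hy
  obtain ⟨z, hz, h⟩ := Group.mem_conjugatesOfSet_iff.1 hy
  obtain rfl := hz
  obtain ⟨c, rfl⟩ := isConj_iff.1 h
  exact hH c

lemma primeProp_of_simple [IsSimpleGroup K] (hK : ∃ a b : K, ¬ Commute a b) : PrimeProp K := by
  intro x y hx hy
  by_contra! h
  have h1 : Subgroup.centralizer {x} = ⊤ := normalGen_of_simple y hy _ fun κ =>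
    Subgroup.mem_centralizer_iff.2 (by simpa using (h κ).eq)
  have h2 : Subgroup.center K = ⊤ :=
    ((inferInstance : (Subgroup.center K).Normal).eq_bot_or_eq_top).resolve_left fun hb =>
      hx (by
        have : x ∈ Subgroup.center K := Subgroup.mem_center_iff.2 fun g => by
          have : g ∈ Subgroup.centralizer {x} := h1 ▸ Subgroup.mem_top g
          exact (Subgroup.mem_centralizer_iff.1 this x rfl).symm
        simpa [hb] using this)
  obtain ⟨a, b, hab⟩ := hK
  have : b ∈ Subgroup.center K := h2 ▸ Subgroup.mem_top b
  exact hab (Subgroup.mem_center_iff.1 this a)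

end Simple

section Invariants

variable {G H : Type} [Group G] [Group H]

/-- Torsion elements all of whose torsion conjugates commute with them. -/
def Mild (x : G) : Prop := IsOfFinOrder x ∧ ∀ y, IsOfFinOrder y → Commute x (y * x * y⁻¹)

/-- Torsion conjugates commute up to mild elements. -/
def Perp (x y : G) : Prop := ∀ z, IsOfFinOrder z → Mild (x * (z * y * z⁻¹) * x⁻¹ * (z * y * z⁻¹)⁻¹)

/-- Non-mild torsion elements which are minimal with respect to `Perp`. -/
def IsAtomic (x : G) : Prop := IsOfFinOrder x ∧ ¬ Mild x ∧
  ∀ u v, IsOfFinOrder u → IsOfFinOrder v → ¬ Perp x u → ¬ Perp x v → ¬ Perp u v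

/-- All torsion conjugates of `x` commute with `y`. -/
def Fixes (x y : G) : Prop := ∀ z, IsOfFinOrder z → Commute (z * x * z⁻¹) y

variable (e : G ≃* H)

lemma finOrder_equiv {x : G} : IsOfFinOrder (e x) ↔ IsOfFinOrder x :=
  Function.Injective.isOfFinOrder_iff (f := e.toMonoidHom) e.injective

lemma forall_equiv {p : H → Prop} : (∀ y, p y) ↔ ∀ x, p (e x) := e.surjective.forall

lemma commute_equiv {x y : G} : Commute (e x) (e y) ↔ Commute x y := by
  simp only [commute_iff_eq, ← map_mul, e.injective.eq_iff]

lemma mild_equiv {x : G} : Mild (e x) ↔ Mild x := by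
  simp only [Mild, forall_equiv e, finOrder_equiv, ← map_mul, ← map_inv, commute_equiv]

lemma perp_equiv {x y : G} : Perp (e x) (e y) ↔ Perp x y := by
  simp only [Perp, forall_equiv e, finOrder_equiv, ← map_mul, ← map_inv, mild_equiv]

lemma atomic_equiv {x : G} : IsAtomic (e x) ↔ IsAtomic x := by
  simp only [IsAtomic, forall_equiv e, finOrder_equiv, mild_equiv, perp_equiv]

lemma fixes_equiv {x y : G} : Fixes (e x) (e y) ↔ Fixes x y := by
  simp only [Fixes, forall_equiv e, finOrder_equiv, ← map_mul, ← map_inv, commute_equiv]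

end Invariants

section Compute

variable {K : Type} [Group K] [Finite K] {S : Fin 3 → Set Q}

/-- `lift` as an element of the group. -/
def liftE (x : Q) : Grp K S := ⟨Big.lift x, lift_mem x⟩
/-- `lamp` as an element of the group. -/
noncomputable def lampE (x : Q) (κ : K) : Grp K S := ⟨Big.lamp x κ, lamp_mem x κ⟩
open Classical in
/-- The masked label as an element of the group. -/
noncomputable def labelE (i : Fin 3) : Grp K S := ⟨_, label_mem i⟩

lemma finOrder_iff (x : Grp K S) : IsOfFinOrder x ↔ x.1.g = 1 := by
  have : IsOfFinOrder x ↔ IsOfFinOrder x.1 :=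
    (Function.Injective.isOfFinOrder_iff (f := (Grp K S).subtype) Subtype.val_injective).symm
  rw [this]
  constructor
  · intro h
    have h2 : IsOfFinOrder x.1.g := Big.gHom.isOfFinOrder h
    by_contra hne
    exact (not_isOfFinOrder_of_isMulTorsionFree hne) h2
  · intro h
    have hp := Nat.card_pos (α := K)
    rw [isOfFinOrder_iff_pow_eq_one]
    refine ⟨Nat.card K * 30, by positivity, ?_⟩
    rw [pow_mul]
    have hk : ∀ s, (x.1 ^ Nat.card K).k s = 1 := fun s => by
      rw [Big.pow_k h, pow_card_eq_one']
    have hg : (x.1 ^ Nat.card K).g = 1 := by simp [h]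
    refine Big.ext' (fun i q s j => ?_) (fun s => ?_) ?_
    · rw [Big.pow_w hg hk]
      have : ((30 : ℕ) : ZMod 30) = 0 := by decide
      rw [this]; simp
    · rw [Big.pow_k hg, hk]; simp
    · simp [hg]

lemma commute_val (x y : Grp K S) : Commute x y ↔ Commute x.1 y.1 := by
  simp only [commute_iff_eq, Subtype.ext_iff]; rfl

lemma mild_iff (hP : PrimeProp K) (x : Grp K S) :
    Mild x ↔ x.1.g = 1 ∧ ∀ s, x.1.k s = 1 := by
  rw [Mild, finOrder_iff]
  refine and_congr_right fun hg => ⟨fun h s => ?_, fun h y hy => ?_⟩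
  · by_contra hne
    obtain ⟨κ, hκ⟩ := hP _ _ hne hne
    have := h (lampE s κ) ((finOrder_iff _).2 rfl)
    rw [commute_val] at this
    have h2 := congrArg (fun z => Big.k z s) this.eq
    simp [lampE, Big.mul_k, Big.inv_k, hg] at h2
    exact hκ (by simpa [commute_iff_eq, mul_assoc] using h2)
  · rw [finOrder_iff] at hy
    rw [commute_val, commute_iff_eq]
    refine Big.ext' (fun i q s j => ?_) (fun s => ?_) ?_
    · simp [Big.mul_w, Big.mul_k, Big.inv_k, Big.inv_w, hg, hy, h]; ring
    · simp [Big.mul_k, Big.inv_k, hg, hy, h]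
    · simp [hg, hy]

lemma perp_iff (hP : PrimeProp K) {x y : Grp K S} (hx : x.1.g = 1) (hy : y.1.g = 1) :
    Perp x y ↔ ∀ s, x.1.k s = 1 ∨ y.1.k s = 1 := by
  simp only [Perp, mild_iff hP, finOrder_iff]
  constructor
  · intro h s
    by_contra! hne
    obtain ⟨κ, hκ⟩ := hP _ _ hne.1 hne.2
    have h2 := (h (lampE s κ) rfl).2 s
    simp [lampE, Big.mul_k, Big.inv_k, hx, hy] at h2
    apply hκ
    rw [commute_iff_eq, ← mul_inv_eq_one]
    simpa [mul_assoc] using h2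
  · intro h z hz
    refine ⟨by simp [hx, hy, hz], fun s => ?_⟩
    rcases h s with h | h <;> simp [Big.mul_k, Big.inv_k, hx, hy, hz, h]

lemma atomic_iff (hP : PrimeProp K) (hK : ∃ κ : K, κ ≠ 1) (x : Grp K S) :
    IsAtomic x ↔ x.1.g = 1 ∧ ∃ s, x.1.k s ≠ 1 ∧ ∀ t ≠ s, x.1.k t = 1 := by
  rw [IsAtomic, finOrder_iff, mild_iff hP]
  refine and_congr_right fun hg => ?_
  simp only [hg, true_and, not_forall, finOrder_iff]
  constructor
  · rintro ⟨⟨s, hs⟩, h⟩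
    refine ⟨s, hs, fun t ht => ?_⟩
    by_contra hne
    obtain ⟨κ, hκ⟩ := hK
    refine h (lampE s κ) (lampE t κ) rfl rfl ?_ ?_ ?_
    · rw [perp_iff hP hg rfl]
      exact fun h => (h s).elim hs (by simpa [lampE] using hκ)
    · rw [perp_iff hP hg rfl]
      exact fun h => (h t).elim hne (by simpa [lampE] using hκ)
    · rw [perp_iff hP rfl rfl]
      intro r
      by_cases hr : r = s
      · right; exact Big.lamp_k_of_ne (by rw [hr]; exact ht.symm) κ
      · left; exact Big.lamp_k_of_ne hr κ
  · rintro ⟨s, hs, h⟩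
    refine ⟨⟨s, hs⟩, fun u v hu hv hxu hxv => ?_⟩
    rw [perp_iff hP hg hu] at hxu
    rw [perp_iff hP hg hv] at hxv
    rw [perp_iff hP hu hv]
    push Not at hxu hxv ⊢
    obtain ⟨a, ha, ha'⟩ := hxu
    obtain ⟨b, hb, hb'⟩ := hxv
    obtain rfl : a = s := by by_contra hne; exact ha (h a hne)
    obtain rfl : b = a := by by_contra hne; exact hb (h b hne)
    exact ⟨b, ha', hb'⟩

lemma fixes_iff (hN : NormalGen K) {x y : Grp K S} (hx : x.1.g = 1) {s : Q}
    (hs : x.1.k s ≠ 1) (hs' : ∀ t ≠ s, x.1.k t = 1) (hy : y.1.g = 1) (hyk : ∀ t, y.1.k t = 1) :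
    Fixes x y ↔ ∀ κ i q j, y.1.w i q s (κ * j) = y.1.w i q s j := by
  simp only [Fixes, finOrder_iff]
  constructor
  · intro h
    let H : Subgroup K :=
      { carrier := {κ | ∀ i q j, y.1.w i q s (κ * j) = y.1.w i q s j}
        one_mem' := by simp
        mul_mem' := fun {a b} ha hb i q j => by rw [mul_assoc, ha, hb]
        inv_mem' := fun {a} ha i q j => by rw [← ha i q (a⁻¹ * j)]; simp }
    have hH : H = ⊤ := by
      refine hN _ (inv_ne_one.2 hs) H fun κ => ?_
      intro i q j
      have := h (lampE s κ) rfl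
      rw [commute_val] at this
      have h2 := congrArg (fun z => Big.w z i q s j) this.eq
      rw [Big.mul_w, Big.mul_w] at h2
      simp [lampE, Big.mul_k, Big.inv_k, hx, hy, hyk] at h2
      rw [add_comm] at h2
      simpa [mul_assoc] using h2
    intro κ
    have : κ ∈ H := hH ▸ Subgroup.mem_top κ
    exact this
  · intro h z hz
    rw [commute_val, commute_iff_eq]
    refine Big.ext' (fun i q t j => ?_) (fun s => ?_) ?_
    · rw [Big.mul_w, Big.mul_w]
      have e1 : (y.1.w i ((↑(z * x * z⁻¹) : Big K).g⁻¹ * q) ((↑(z * x * z⁻¹) : Big K).g⁻¹ * t)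
          (((↑(z * x * z⁻¹) : Big K).k t)⁻¹ * j)) = y.1.w i q t j := by
        have e2 : (↑(z * x * z⁻¹) : Big K).g = 1 := by simp [hx]
        rw [e2]
        by_cases ht : t = s
        · subst ht; simp [h]
        · have : (↑(z * x * z⁻¹) : Big K).k t = 1 := by
            simp [Big.mul_k, Big.inv_k, hx, hz, hs' t ht]
          rw [this]; simp
      rw [e1, hy, hyk]
      simp [add_comm]
    · rw [Big.mul_k, Big.mul_k]; simp [hx, hy, hyk]
    · simp [hx, hy]

end Compute

section Rigidity

variable {K : Type} [Group K] [Finite K] {S S' : Fin 3 → Set Q}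

/-- Nonnegative powers of the generator `c`. -/
def powers (c : Fin 2) : Set Q := {x | ∃ n : ℕ, x = FreeGroup.of c ^ n}

/-- The combinatorial shadow of an isomorphism `Grp K S ≃* Grp K S'`. -/
lemma exists_shadow (hP : PrimeProp K) (hN : NormalGen K) (hK : ∃ κ : K, κ ≠ 1)
    (hS : ∀ i, (S i)ᶜ.Infinite) (hS' : ∀ i, (S' i)ᶜ.Infinite) (e : Grp K S ≃* Grp K S') :
    ∃ (τ : Q → Q) (θ : Q →* Q), Function.Injective τ ∧ Function.Surjective θ ∧
      (∀ g x, τ (g * x) = θ g * τ x) ∧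
      ∀ i, ∃ q : Q, {x | x ∈ S i ∧ q⁻¹ * τ x ∉ S' i}.Finite := by
  classical
  obtain ⟨κ, hκ⟩ := hK
  have hlamp : ∀ x, IsAtomic (lampE x κ : Grp K S) := fun x =>
    (atomic_iff hP ⟨κ, hκ⟩ _).2 ⟨rfl, x, by simpa [lampE] using hκ, fun t ht =>
      Big.lamp_k_of_ne ht κ⟩
  have himg := fun x => (atomic_iff hP ⟨κ, hκ⟩ _).1 ((atomic_equiv e).2 (hlamp x))
  choose hg1 τ hτ hτ' using himg
  have hg : ∀ x : Grp K S, x.1.g = 1 → (e x).1.g = 1 := fun x hx => by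
    rw [← finOrder_iff, finOrder_equiv, finOrder_iff, hx]
  let θ : Q →* Q := (Big.gHom.comp (Grp K S').subtype).comp (e.toMonoidHom.comp
    (Big.liftHom.codRestrict (Grp K S) lift_mem))
  have hθ : ∀ x, θ x = (e (liftE x)).1.g := fun x => rfl
  have hinj : Function.Injective τ := by
    intro x y hxy
    by_contra hne
    have h1 : Perp (lampE x κ : Grp K S) (lampE y κ) := by
      rw [perp_iff hP rfl rfl]
      intro s
      by_cases hs : s = x
      · right; exact Big.lamp_k_of_ne (by rw [hs]; exact hne) κ
      · left; exact Big.lamp_k_of_ne hs κ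
    rw [← perp_equiv e, perp_iff hP (hg1 _) (hg1 _)] at h1
    rcases h1 (τ x) with h | h
    · exact hτ x h
    · rw [hxy] at h; exact hτ y h
  refine ⟨τ, θ, hinj, ?_, ?_, ?_⟩
  · intro y
    obtain ⟨x, hx⟩ := e.surjective (liftE y)
    refine ⟨x.1.g, ?_⟩
    have : (e (x * (liftE x.1.g)⁻¹)).1.g = 1 := hg _ (by simp [liftE])
    rw [map_mul, hx, map_inv] at this
    rw [hθ]
    simp only [Subgroup.coe_mul, Subgroup.coe_inv, Big.mul_g, Big.inv_g] at this
    exact (mul_inv_eq_one.1 this).symm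
  · intro g x
    have h1 : (lampE (g * x) κ : Grp K S) = liftE g * lampE x κ * (liftE g)⁻¹ :=
      Subtype.ext (Big.lift_conj_lamp g x κ).symm
    have h2 : (e (lampE (g * x) κ)).1 = (e (liftE g)).1 * (e (lampE x κ)).1 * (e (liftE g)).1⁻¹ := by
      rw [h1]; simp
    have h3 := hτ (g * x)
    rw [h2, Big.conj_k _ (hg1 x)] at h3
    by_contra hne
    apply h3
    rw [hτ' x, mul_one, mul_inv_cancel]
    rw [← hθ]
    intro h
    exact hne (by rw [← h]; simp)
  · intro i
    set ξ : Grp K S := labelE i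
    have hξ : Mild ξ := (mild_iff hP _).2 ⟨rfl, fun _ => rfl⟩
    have hξ' := (mild_iff hP _).1 ((mild_equiv e).2 hξ)
    have hfix : ∀ x, Fixes (lampE x κ) ξ ↔ x ∈ S i := by
      intro x
      rw [fixes_iff hN rfl (by simpa [lampE] using hκ) (fun t ht => Big.lamp_k_of_ne ht κ) rfl
        (fun _ => rfl)]
      simp only [ξ, labelE, Big.mask_w, Big.label_w]
      constructor
      · intro h
        by_contra hx
        have := h κ i 1 1
        simp [hx, hκ] at this
        exact Big.elt_ne i this.symm
      · intro hx κ i' q j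
        by_cases h : i' = i ∧ q = 1
        · obtain ⟨rfl, rfl⟩ := h
          simp [hx]
        · have : ∀ r : Prop, ¬ (i' = i ∧ q = 1 ∧ r) := fun r hr => h ⟨hr.1, hr.2.1⟩
          simp [this]
    obtain ⟨D, hD, β, hβ, hsh⟩ := shape_of_mem (e ξ).2
    have hfix' : ∀ x, τ x ∉ D → (x ∈ S i ↔ ∀ j q, q⁻¹ * τ x ∉ S' j → β j q = 0) := by
      intro x hx
      obtain ⟨-, a2, a3⟩ := hsh _ hx
      rw [← hfix, ← fixes_equiv e, fixes_iff hN (hg1 x) (hτ x) (hτ' x) hξ'.1 hξ'.2]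
      constructor
      · intro h j q hq
        have := h κ j q 1
        rwa [(a3 j q hq).1, mul_one, (a3 j q hq).2 _ hκ, eq_comm] at this
      · intro h κ' j q l
        by_cases hq : q⁻¹ * τ x ∈ S' j
        · rw [a2 _ _ hq, a2 _ _ hq]
        · have h0 : ∀ l, (e ξ).1.w j q (τ x) l = 0 := fun l => by
            by_cases hl : l = 1
            · rw [hl, (a3 j q hq).1, h j q hq]
            · exact (a3 j q hq).2 l hl
          rw [h0, h0]
    have hpow : ξ ^ Big.prm i = 1 := by
      refine Subtype.ext (Big.ext' (fun i' q s j => ?_) (fun s => ?_) ?_)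
      · rw [Subgroup.coe_pow, Big.pow_w rfl (fun _ => rfl)]
        simp only [ξ, labelE, Big.mask_w, Big.label_w]
        split_ifs <;> simp [Big.prm_elt]
      · rw [Subgroup.coe_pow, Big.pow_k rfl]; simp [ξ, labelE]
      · simp [ξ, labelE]
    have hpow' : ∀ j q s l, (Big.prm i : ZMod 30) * (e ξ).1.w j q s l = 0 := fun j q s l => by
      rw [← Big.pow_w hξ'.1 hξ'.2, ← Subgroup.coe_pow, ← map_pow, hpow, map_one]; rfl
    have hβ0 : ∀ j, j ≠ i → ∀ q, β j q = 0 := by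
      intro j hj q
      have hinf : ((q * ·) '' (S' j)ᶜ).Infinite := (hS' j).image (mul_right_injective q).injOn
      obtain ⟨s, hs, hsD⟩ := (hinf.sdiff hD).nonempty
      obtain ⟨t, ht, rfl⟩ := hs
      have := ((hsh _ hsD).2.2 j q (by simpa using ht)).1
      exact Big.prm_coprime j i hj _ (hβ j q) (by rw [← this]; exact hpow' _ _ _ _)
    have hfinD : {x | τ x ∈ D}.Finite := hD.preimage hinj.injOn
    obtain ⟨q, hq⟩ : ∃ q, β i q ≠ 0 := by
      by_contra! h0
      refine hS i (hfinD.subset fun x hx => ?_)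
      by_contra hxD
      refine hx ((hfix' x hxD).2 fun j q _ => ?_)
      by_cases hj : j = i
      · rw [hj, h0]
      · exact hβ0 j hj q
    refine ⟨q, hfinD.subset fun x hx => ?_⟩
    by_contra hxD
    exact hq ((hfix' x hxD).1 hx.1 i q hx.2)

/-- The exponent sum of the generator `c`. -/
def expSum (c : Fin 2) : Q →* Multiplicative ℤ :=
  FreeGroup.lift fun d => Multiplicative.ofAdd (if d = c then 1 else 0)

lemma expSum_of_self (c : Fin 2) : expSum c (FreeGroup.of c) = Multiplicative.ofAdd 1 := by
  simp [expSum]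

lemma of_pow_injective (c : Fin 2) : Function.Injective fun n : ℕ => (FreeGroup.of c : Q) ^ n := by
  intro m n h
  have := congrArg (fun x => Multiplicative.toAdd (expSum c x)) h
  simpa [expSum_of_self] using this

lemma exists_conj_zpow {τ : Q → Q} {θ : Q →* Q} (hτ : ∀ g x, τ (g * x) = θ g * τ x) (c : Fin 2)
    {q : Q} (hq : {x | x ∈ powers c ∧ q⁻¹ * τ x ∉ powers c}.Finite) :
    ∃ d : ℤ, 0 ≤ d ∧ θ (FreeGroup.of c) = τ 1 * FreeGroup.of c ^ d * (τ 1)⁻¹ := by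
  set a : Q := FreeGroup.of c
  have hfin : {n : ℕ | q⁻¹ * τ (a ^ n) ∉ powers c}.Finite := by
    refine (hq.preimage (of_pow_injective c).injOn).subset fun n hn => ?_
    exact ⟨⟨n, rfl⟩, hn⟩
  obtain ⟨N, hN⟩ := hfin.bddAbove
  have hk : ∀ n, ∃ j : ℕ, N < n → θ a ^ n * τ 1 = q * a ^ j := by
    intro n
    by_cases h : N < n
    · have : q⁻¹ * τ (a ^ n) ∈ powers c := by
        by_contra h'
        exact absurd (hN h') (by omega)
      obtain ⟨j, hj⟩ := this
      refine ⟨j, fun _ => ?_⟩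
      rw [← map_pow, ← hτ, mul_one]
      rw [← hj]; simp
    · exact ⟨0, fun h' => absurd h' h⟩
  choose j hj using hk
  have h1 := hj (N + 1) (by omega)
  have h2 := hj (N + 2) (by omega)
  obtain ⟨d, hd⟩ : ∃ d : ℤ, d = j (N + 2) - j (N + 1) := ⟨_, rfl⟩
  have hθ : θ a = q * a ^ d * q⁻¹ := by
    have : θ a * (q * a ^ j (N + 1)) = q * a ^ j (N + 2) := by
      rw [← h1, ← h2, ← mul_assoc, ← pow_succ']
    rw [eq_mul_inv_of_mul_eq this, hd, zpow_sub]
    simp [mul_assoc]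
  have hpow : ∀ n : ℕ, θ a ^ n = q * a ^ (d * n) * q⁻¹ := fun n => by
    rw [hθ, conj_pow, zpow_mul, zpow_natCast]
  have hc : τ 1 = q * a ^ (j (N + 1) - d * (N + 1 : ℕ)) := by
    have h3 := eq_inv_mul_of_mul_eq h1
    rw [hpow] at h3
    rw [h3, zpow_sub]
    simp only [mul_inv_rev, inv_inv, mul_assoc, inv_mul_cancel_left, zpow_natCast]
    congr 1
    rw [← zpow_natCast a (j _), ← zpow_neg, ← zpow_add, ← zpow_add, add_comm]
  set l : ℤ := j (N + 1) - d * (N + 1 : ℕ)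
  refine ⟨d, ?_, ?_⟩
  · by_contra hneg
    have key : ∀ n, N < n → d * n + l = j n := by
      intro n hn
      have := hj n hn
      rw [hpow, hc] at this
      have := congrArg (fun x => Multiplicative.toAdd (expSum c x)) this
      simp [a, expSum_of_self] at this
      linarith
    have h3 := key (N + 1 + l.natAbs) (by omega)
    have h4 : (0 : ℤ) ≤ j (N + 1 + l.natAbs) := by positivity
    push_cast at h3
    have : d * (N + 1 + |l|) ≤ -1 * (N + 1 + |l|) :=
      mul_le_mul_of_nonneg_right (by omega) (by positivity)
    have := le_abs_self l
    linarith
  · rw [hc, hθ]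
    have : Commute (a ^ d) (a ^ l) := (Commute.refl a).zpow_zpow d l
    simp only [mul_inv_rev, mul_assoc]
    congr 1
    rw [← mul_assoc (a ^ d), this.inv_right.eq, ← mul_assoc, ← mul_assoc, mul_inv_cancel, one_mul]

/-- Isomorphic coding groups have translation-comparable coding sets. -/
theorem rigidity (hP : PrimeProp K) (hN : NormalGen K) (hK : ∃ κ : K, κ ≠ 1)
    (hS : ∀ i, (S i)ᶜ.Infinite) (hS' : ∀ i, (S' i)ᶜ.Infinite)
    (h1 : S 1 = powers 0) (h2 : S 2 = powers 1) (h1' : S' 1 = powers 0) (h2' : S' 2 = powers 1)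
    (e : Grp K S ≃* Grp K S') : ∃ g : Q, {x | x ∈ S 0 ∧ g * x ∉ S' 0}.Finite := by
  obtain ⟨τ, θ, hinj, hsurj, hτ, hm⟩ := exists_shadow hP hN hK hS hS' e
  obtain ⟨q1, hq1⟩ := hm 1
  obtain ⟨q2, hq2⟩ := hm 2
  rw [h1, h1'] at hq1
  rw [h2, h2'] at hq2
  have hd : ∀ c, ∃ d : ℤ, 0 ≤ d ∧ θ (FreeGroup.of c) = τ 1 * FreeGroup.of c ^ d * (τ 1)⁻¹ := by
    intro c
    fin_cases c
    · exact exists_conj_zpow hτ 0 hq1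
    · exact exists_conj_zpow hτ 1 hq2
  choose d hd0 hd using hd
  have hd1 : ∀ c, d c = 1 := by
    intro c
    obtain ⟨x, hx⟩ := hsurj (FreeGroup.of c)
    have key : (expSum c).comp θ = (zpowGroupHom (d c)).comp (expSum c) := by
      refine FreeGroup.ext_hom _ _ fun c' => ?_
      simp only [MonoidHom.comp_apply, hd, map_mul, map_inv, map_zpow, zpowGroupHom_apply]
      rw [mul_comm, inv_mul_cancel_left]
      by_cases hc : c' = c
      · rw [hc]
      · simp [expSum, hc]
    have h3 := DFunLike.congr_fun key x
    rw [MonoidHom.comp_apply, hx, expSum_of_self] at h3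
    have h4 := congrArg Multiplicative.toAdd h3
    simp only [MonoidHom.comp_apply, zpowGroupHom_apply, toAdd_zpow, toAdd_ofAdd, smul_eq_mul] at h4
    exact Int.eq_one_of_mul_eq_one_right (hd0 c) h4.symm
  have hθ : θ = (MulAut.conj (τ 1)).toMonoidHom := by
    refine FreeGroup.ext_hom _ _ fun c' => ?_
    simp [hd, hd1]
  obtain ⟨q, hq⟩ := hm 0
  refine ⟨q⁻¹ * τ 1, hq.subset fun x hx => ⟨hx.1, ?_⟩⟩
  have : τ x = τ 1 * x := by
    have := hτ x 1
    rw [mul_one, hθ] at this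
    simpa using this
  rw [this, ← mul_assoc]
  exact hx.2

end Rigidity

section Converse

variable {K : Type} [Group K] {S S' : Fin 3 → Set Q}

/-- Right translation of the label coordinate of colour `0`. -/
def Big.shift (h : Q) : Big K →* Big K where
  toFun x := ⟨fun i q s j => if i = 0 then x.w i (q * h) s j else x.w i q s j, x.k, x.g⟩
  map_one' := Big.ext' (fun _ _ _ _ => by simp) (fun _ => rfl) rfl
  map_mul' x y := Big.ext'
    (fun i q s j => by simp only [Big.mul_w]; split_ifs <;> simp [mul_assoc])
    (fun _ => rfl) rfl

lemma Big.shift_injective (h : Q) : Function.Injective (Big.shift h : Big K → Big K) := by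
  intro x y hxy
  refine Big.ext' (fun i q s j => ?_) 
    (fun s => (congrArg (fun z => Big.k z s) hxy :)) (congrArg Big.g hxy :)
  by_cases hi : i = 0
  · have := congrArg (fun z => Big.w z i (q * h⁻¹) s j) hxy
    simpa [Big.shift, hi] using this
  · have := congrArg (fun z => Big.w z i q s j) hxy
    simpa [Big.shift, hi] using this

open Classical in
lemma Big.shift_label_zero (h : Q) (h0 : ∀ x, x ∈ S 0 ↔ h * x ∈ S' 0) :
    Big.shift h (Big.mask S (Big.label 0 : Big K)) =
      Big.lift h⁻¹ * Big.mask S' (Big.label 0) * (Big.lift h⁻¹)⁻¹ := by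
  refine Big.ext' (fun i q s j => ?_) (fun s => ?_) ?_
  · simp only [Big.shift, MonoidHom.coe_mk, OneHom.coe_mk, Big.mask_w, Big.label_w, Big.mul_w,
      Big.mul_k, Big.inv_w, Big.lift_w, Big.lift_g, Big.lift_k, Big.mask_k, Big.label_k]
    by_cases hi : i = 0
    · subst hi
      by_cases hq : q * h = 1
      · have : q = h⁻¹ := eq_inv_of_mul_eq_one_left hq
        subst this
        simp [h0]
      · have : h * q ≠ 1 := fun h' => hq (by rw [eq_inv_of_mul_eq_one_right h']; simp)
        simp [hq, this]
    · simp [hi]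
  · simp [Big.shift, Big.mul_k, Big.inv_k]
  · simp [Big.shift]

lemma Grp.shift_le (h : Q) (h0 : ∀ x, x ∈ S 0 ↔ h * x ∈ S' 0) (h1 : S 1 = S' 1) (h2 : S 2 = S' 2) :
    (Grp K S).map (Big.shift h) ≤ Grp K S' := by
  classical
  rw [← MonoidHom.range_comp]
  rintro _ ⟨L, rfl⟩
  induction L using FreeGroup.induction_on with
  | C1 => rw [map_one]; exact one_mem _
  | of a =>
    rcases a with c | κ | i
    · have : Big.shift h (Big.lift (FreeGroup.of c) : Big K) = Big.lift (FreeGroup.of c) :=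
        Big.ext' (fun i q s j => by simp [Big.shift]) (fun _ => rfl) rfl
      simpa [Ev, genVal, this] using lift_mem _
    · have : Big.shift h (Big.lamp 1 κ : Big K) = Big.lamp 1 κ :=
        Big.ext' (fun i q s j => by simp [Big.shift]) (fun _ => rfl) rfl
      simpa [Ev, genVal, this] using lamp_mem _ _
    · by_cases hi : i = 0
      · subst hi
        have : ((Big.shift h).comp (Ev K S)) (FreeGroup.of (.inr (.inr 0))) =
            Big.shift h (Big.mask S (Big.label 0 : Big K)) := by simp [Ev, genVal]
        rw [this, Big.shift_label_zero h h0]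
        exact mul_mem (mul_mem (lift_mem _) (label_mem 0)) (inv_mem (lift_mem _))
      · have hSi : S i = S' i := by fin_cases i <;> simp_all
        have : Big.shift h (Big.mask S (Big.label i : Big K)) = Big.mask S' (Big.label i) := by
          refine Big.ext' (fun i' q s j => ?_) (fun _ => rfl) rfl
          by_cases hi' : i' = i
          · subst hi'; simp [Big.shift, hi, Big.mask_w, hSi]
          · simp [Big.shift, Big.mask_w, Big.label_w, hi']
        simpa [Ev, genVal, this] using label_mem i
  | inv_of a h => rw [map_inv]; exact inv_mem h
  | mul a b ha hb => rw [map_mul]; exact mul_mem ha hb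

theorem iso_of_translate (h : Q) (h0 : ∀ x, x ∈ S 0 ↔ h * x ∈ S' 0) (h1 : S 1 = S' 1)
    (h2 : S 2 = S' 2) : Nonempty (Grp K S ≃* Grp K S') := by
  have hinv : ∀ x : Big K, Big.shift h (Big.shift h⁻¹ x) = x := fun x =>
    Big.ext' (fun i q s j => by by_cases hi : i = 0 <;> simp [Big.shift, hi]) (fun _ => rfl) rfl
  have : (Grp K S).map (Big.shift h) = Grp K S' := by
    refine le_antisymm (Grp.shift_le h h0 h1 h2) fun x hx => ?_
    exact ⟨Big.shift h⁻¹ x, Grp.shift_le h⁻¹ (fun x => by rw [h0]; simp) h1.symm h2.symm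
      ⟨x, hx, rfl⟩, hinv x⟩
  rw [← this]
  exact ⟨(Grp K S).equivMapOfInjective _ (Big.shift_injective h)⟩

end Converse

section CodingSets

/-- The element `a ^ n * b * a ^ (-n)`. -/
def spread (n : ℕ) : Q := FreeGroup.of 0 ^ n * FreeGroup.of 1 * (FreeGroup.of 0 ^ n)⁻¹

/-- The free group on countably many letters inside `Q`. -/
def emb : FreeGroup ℕ →* Q := FreeGroup.lift spread

/-- Point letters. -/
def ptL (i : ℕ) : FreeGroup ℕ := FreeGroup.of (2 * i)
/-- Link letters. -/
def lkL (c : ℕ) : FreeGroup ℕ := FreeGroup.of (2 * c + 1)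

/-- The source of a coded triple. -/
abbrev src (c : ℕ) : ℕ := c.unpair.1
/-- The target of a coded triple. -/
abbrev tgt (c : ℕ) : ℕ := c.unpair.2.unpair.1

/-- The generator with index `c` at level `k`. -/
def lvlGen (k c : ℕ) : FreeGroup ℕ :=
  if Even k then lkL c else ptL (src c) * lkL c * (ptL (tgt c))⁻¹

/-- The base element at level `k`. -/
def lvlBase (n k : ℕ) : FreeGroup ℕ := if Even k then ptL n else 1

/-- The subgroup at level `k`. -/
def lvl (good : ℕ → ℕ → Prop) (k : ℕ) : Subgroup (FreeGroup ℕ) :=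
  Subgroup.closure {x | ∃ c, (Even k → good c k) ∧ x = lvlGen k c}

/-- The coding set of the number `n`. -/
def codeSet (good : ℕ → ℕ → Prop) (n : ℕ) : Set Q :=
  {y | ∃ k, ∃ x ∈ lvl good k, y = emb (lvlBase n k * x) * FreeGroup.of 0 ^ 2 ^ k}

variable {good : ℕ → ℕ → Prop}

lemma codeSet_translate {n m x : ℕ} (h : ∀ k, good (Nat.pair n (Nat.pair m x)) k) :
    ∃ g : Q, ∀ y, y ∈ codeSet good n ↔ g * y ∈ codeSet good m := by
  set c := Nat.pair n (Nat.pair m x)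
  have hs : src c = n := by simp [c, src]
  have ht : tgt c = m := by simp [c, tgt]
  set t : FreeGroup ℕ := ptL n * lkL c * (ptL m)⁻¹
  have hgen : ∀ k, lvlGen k c ∈ lvl good k := fun k =>
    Subgroup.subset_closure ⟨c, fun _ => h k, rfl⟩
  have h1 : ∀ k, ∀ x ∈ lvl good k, ∃ y ∈ lvl good k, t * (lvlBase m k * x) = lvlBase n k * y := by
    intro k x hx
    have hg := hgen k
    by_cases hk : Even k
    · refine ⟨lvlGen k c * x, mul_mem hg hx, ?_⟩
      simp [t, lvlBase, lvlGen, hk, mul_assoc]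
    · refine ⟨lvlGen k c * x, mul_mem hg hx, ?_⟩
      simp [t, lvlBase, lvlGen, hk, mul_assoc, hs, ht]
  have h2 : ∀ k, ∀ x ∈ lvl good k, ∃ y ∈ lvl good k,
      t⁻¹ * (lvlBase n k * x) = lvlBase m k * y := by
    intro k x hx
    have hg := hgen k
    by_cases hk : Even k
    · refine ⟨(lvlGen k c)⁻¹ * x, mul_mem (inv_mem hg) hx, ?_⟩
      simp [t, lvlBase, lvlGen, hk, mul_assoc]
    · refine ⟨(lvlGen k c)⁻¹ * x, mul_mem (inv_mem hg) hx, ?_⟩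
      simp [t, lvlBase, lvlGen, hk, mul_assoc, hs, ht]
  refine ⟨emb t⁻¹, fun y => ⟨?_, ?_⟩⟩
  · rintro ⟨k, x, hx, rfl⟩
    obtain ⟨y, hy, e⟩ := h2 k x hx
    exact ⟨k, y, hy, by rw [← e, map_mul _ t⁻¹, mul_assoc]⟩
  · rintro ⟨k, x, hx, e'⟩
    obtain ⟨z, hz, e⟩ := h1 k x hx
    refine ⟨k, z, hz, ?_⟩
    rw [← e, map_mul _ t, mul_assoc, ← e', map_inv, mul_inv_cancel_left]

/-- The lamplighter-type group `(ℤ →₀ ℤ) ⋊ ℤ`. -/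
@[ext]
structure Lamp where
  v : ℤ →₀ ℤ
  h : ℤ

namespace Lamp

noncomputable instance : Mul Lamp := ⟨fun x y => ⟨x.v + y.v.mapDomain (x.h + ·), x.h + y.h⟩⟩
instance : One Lamp := ⟨⟨0, 0⟩⟩
noncomputable instance : Inv Lamp := ⟨fun x => ⟨-x.v.mapDomain (-x.h + ·), -x.h⟩⟩

lemma mul_v (x y : Lamp) : (x * y).v = x.v + y.v.mapDomain (x.h + ·) := rfl
@[simp] lemma mul_h (x y : Lamp) : (x * y).h = x.h + y.h := rfl
@[simp] lemma one_v : (1 : Lamp).v = 0 := rfl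
@[simp] lemma one_h : (1 : Lamp).h = 0 := rfl
lemma inv_v (x : Lamp) : (x⁻¹).v = -x.v.mapDomain (-x.h + ·) := rfl
@[simp] lemma inv_h (x : Lamp) : (x⁻¹).h = -x.h := rfl

noncomputable instance : Group Lamp := Group.ofLeftAxioms
  (fun x y z => Lamp.ext (by
    simp [mul_v, Finsupp.mapDomain_add, ← Finsupp.mapDomain_comp, Function.comp_def, add_assoc])
    (by simp [add_assoc]))
  (fun x => Lamp.ext (by simp [mul_v]; exact Finsupp.mapDomain_id) (by simp))
  (fun x => Lamp.ext (by simp [mul_v, inv_v]) (by simp))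

/-- Elements with position zero. -/
noncomputable def base : Multiplicative (ℤ →₀ ℤ) →* Lamp where
  toFun v := ⟨Multiplicative.toAdd v, 0⟩
  map_one' := rfl
  map_mul' x y := Lamp.ext (by simp [mul_v]; exact Finsupp.mapDomain_id.symm) rfl

end Lamp

/-- The quotient map of `Q` onto the lamplighter-type group. -/
noncomputable def toLamp : Q →* Lamp := FreeGroup.lift ![⟨0, 1⟩, ⟨Finsupp.single 0 1, 0⟩]

/-- Abelianization of the free group on countably many letters. -/
noncomputable def abel : FreeGroup ℕ →* Multiplicative (ℤ →₀ ℤ) :=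
  FreeGroup.lift fun n => Multiplicative.ofAdd (Finsupp.single (n : ℤ) 1)

lemma toLamp_pow (n : ℕ) : toLamp (FreeGroup.of 0 ^ n) = ⟨0, n⟩ := by
  induction n with
  | zero => simp; rfl
  | succ n ih =>
    rw [pow_succ, map_mul, ih]
    exact Lamp.ext (by simp [Lamp.mul_v, toLamp]) (by simp [toLamp])

lemma toLamp_emb (x : FreeGroup ℕ) : toLamp (emb x) = Lamp.base (abel x) := by
  have : toLamp.comp emb = Lamp.base.comp abel := by
    refine FreeGroup.ext_hom _ _ fun n => ?_
    simp only [MonoidHom.comp_apply, emb, FreeGroup.lift_apply_of, spread, map_mul, map_inv,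
      toLamp_pow, abel]
    refine Lamp.ext ?_ ?_
    · simp [Lamp.mul_v, Lamp.inv_v, toLamp, Lamp.base]
    · simp [toLamp, Lamp.base]
  exact DFunLike.congr_fun this x

lemma exists_level {n : ℕ} {y : Q} (hy : y ∈ codeSet good n) : ∃ k : ℕ, (toLamp y).h = 2 ^ k ∧
    ∃ x ∈ lvl good k, (toLamp y).v = Multiplicative.toAdd (abel (lvlBase n k)) +
      Multiplicative.toAdd (abel x) := by
  obtain ⟨k, x, hx, rfl⟩ := hy
  refine ⟨k, ?_, x, hx, ?_⟩
  · rw [map_mul, toLamp_emb, toLamp_pow]; simp [Lamp.base]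
  · rw [map_mul, toLamp_emb, toLamp_pow]; simp [Lamp.base, Lamp.mul_v]

lemma codeSet_compl_infinite (n : ℕ) : (codeSet good n)ᶜ.Infinite := by
  refine Set.infinite_of_injective_forall_mem (f := fun k : ℕ => ((FreeGroup.of 0 : Q) ^ k)⁻¹)
    (inv_injective.comp (of_pow_injective 0)) fun k hk => ?_
  obtain ⟨l, hl, -⟩ := exists_level hk
  rw [map_inv, toLamp_pow] at hl
  simp only [Lamp.inv_h] at hl
  have : (0 : ℤ) < 2 ^ l := by positivity
  omega

lemma powers_compl_infinite (c : Fin 2) : (powers c)ᶜ.Infinite := by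
  refine Set.infinite_of_injective_forall_mem
    (f := fun k : ℕ => ((FreeGroup.of c : Q) ^ (k + 1))⁻¹)
    (inv_injective.comp ((of_pow_injective c).comp (add_left_injective 1))) fun k hk => ?_
  obtain ⟨n, hn⟩ := hk
  have := congrArg (fun x => Multiplicative.toAdd (expSum c x)) hn
  simp [expSum_of_self] at this
  omega

lemma abel_pt (i : ℕ) : Multiplicative.toAdd (abel (ptL i)) = Finsupp.single (2 * i : ℤ) 1 := by
  simp [abel, ptL]
lemma abel_lk (c : ℕ) : Multiplicative.toAdd (abel (lkL c)) = Finsupp.single (2 * c + 1 : ℤ) 1 := by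
  simp [abel, lkL]

lemma codeSet_separate {E : ℕ → ℕ → Prop} (hE : Equivalence E)
    (hgood : ∀ c, (∀ k, good c k) → E (src c) (tgt c))
    (hanti : ∀ c k l, k ≤ l → good c l → good c k) {n m : ℕ} {g : Q}
    (hfin : {y | y ∈ codeSet good n ∧ g * y ∉ codeSet good m}.Finite) : E n m := by
  classical
  set v := (toLamp g).v with hv
  set h := (toLamp g).h with hh
  let y : ℕ → Q := fun k => emb (lvlBase n k) * FreeGroup.of 0 ^ 2 ^ k
  have hy : ∀ k, toLamp (y k) = ⟨Multiplicative.toAdd (abel (lvlBase n k)), 2 ^ k⟩ := fun k => by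
    simp only [y]
    rw [map_mul, toLamp_emb, toLamp_pow]
    exact Lamp.ext (by simp [Lamp.mul_v, Lamp.base]) (by simp [Lamp.base])
  have hyinj : Function.Injective y := by
    intro k l hkl
    have := congrArg (fun z => (toLamp z).h) hkl
    simp only [hy] at this
    exact Nat.pow_right_injective le_rfl (by exact_mod_cast this)
  have hymem : ∀ k, y k ∈ codeSet good n := fun k => ⟨k, 1, one_mem _, by simp [y]⟩
  have hfin' : {k | g * y k ∉ codeSet good m}.Finite :=
    (hfin.preimage hyinj.injOn).subset fun k hk => ⟨hymem k, hk⟩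
  obtain ⟨N, hN⟩ := hfin'.bddAbove
  have hmem : ∀ k, N < k → g * y k ∈ codeSet good m := fun k hk => by
    by_contra h'
    exact absurd (hN h') (by omega)
  have hh0 : h = 0 := by
    obtain ⟨j, hj⟩ : ∃ j : ℕ, N ≤ j ∧ h.natAbs < 2 ^ j :=
      ⟨N + h.natAbs, by omega, lt_of_lt_of_le Nat.lt_two_pow_self
        (Nat.pow_le_pow_right (by omega) (by omega))⟩
    obtain ⟨k', hk', -⟩ := exists_level (hmem (j + 1) (by omega))
    rw [map_mul, hy] at hk'
    simp only [Lamp.mul_h, ← hh] at hk'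
    have h3 : (h.natAbs : ℤ) < 2 ^ j := by exact_mod_cast hj.2
    have a1 : (2 : ℕ) ^ j < 2 ^ k' := by
      have : (2 : ℤ) ^ j < 2 ^ k' := by rw [← hk', pow_succ]; omega
      exact_mod_cast this
    have a2 : (2 : ℕ) ^ k' < 2 ^ (j + 2) := by
      have : (2 : ℤ) ^ k' < 2 ^ (j + 2) := by rw [← hk', pow_succ, pow_succ, pow_succ]; omega
      exact_mod_cast this
    have b1 := (Nat.pow_lt_pow_iff_right (by omega)).1 a1
    have b2 := (Nat.pow_lt_pow_iff_right (by omega)).1 a2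
    obtain rfl : k' = j + 1 := by omega
    omega
  have hlev : ∀ k, N < k → ∃ x ∈ lvl good k, v + Multiplicative.toAdd (abel (lvlBase n k)) =
      Multiplicative.toAdd (abel (lvlBase m k)) + Multiplicative.toAdd (abel x) := by
    intro k hk
    obtain ⟨k', hk', x, hx, hvx⟩ := exists_level (hmem k hk)
    rw [map_mul, hy] at hk' hvx
    simp only [Lamp.mul_h, ← hh, hh0, zero_add] at hk'
    obtain rfl : k = k' := Nat.pow_right_injective le_rfl (by exact_mod_cast hk')
    refine ⟨x, hx, ?_⟩
    rw [← hvx, Lamp.mul_v, ← hh, hh0]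
    simp only [zero_add, hv]
    congr 1
    exact Finsupp.mapDomain_id.symm
  let ε : ℕ → ℤ := fun i => if E i m then 1 else 0
  let w : ℤ → ℤ := fun z => if z % 2 = 0 then ε (z / 2).toNat else
    ε (tgt (z / 2).toNat) - ε (src (z / 2).toNat)
  have w0 : ∀ i : ℕ, w (2 * i : ℤ) = ε i := fun i => by simp [w]
  have w1 : ∀ c : ℕ, w (2 * c + 1 : ℤ) = ε (tgt c) - ε (src c) := fun c => by
    have e1 : (2 * (c : ℤ) + 1) % 2 = 1 := by omega
    have e2 : ((2 * (c : ℤ) + 1) / 2).toNat = c := by omega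
    simp only [w, e1, e2]; simp
  let χ : (ℤ →₀ ℤ) →+ ℤ := Finsupp.liftAddHom fun z => AddMonoidHom.mulRight (w z)
  have χs : ∀ z, χ (Finsupp.single z 1) = w z := fun z => by simp [χ]
  have hχv : χ v = 0 := by
    obtain ⟨x, hx, hvx⟩ := hlev (2 * N + 1) (by omega)
    have hodd : ¬ Even (2 * N + 1) := by simp
    simp only [lvlBase, hodd, if_false, map_one, toAdd_one, add_zero, zero_add] at hvx
    rw [hvx]
    clear hvx
    induction hx using Subgroup.closure_induction with
    | mem x hx =>
      obtain ⟨c, -, rfl⟩ := hx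
      simp only [lvlGen, hodd, if_false, map_mul, map_inv, toAdd_mul, toAdd_inv, abel_pt, abel_lk,
        map_add, map_neg, χs, w0, w1]
      ring
    | one => simp
    | mul x y _ _ hx hy => rw [map_mul, toAdd_mul, map_add, hx, hy, add_zero]
    | inv x _ hx => rw [map_inv, toAdd_inv, map_neg, hx, neg_zero]
  set u := v + Finsupp.single (2 * n : ℤ) 1 - Finsupp.single (2 * m : ℤ) 1 with hu
  have hsupp : ∀ k, ∀ z, u z ≠ 0 → ∃ c : ℕ, z = 2 * c + 1 ∧ good c k := by
    intro k z hz
    set k' := 2 * (N + k + 1)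
    have heven : Even k' := ⟨N + k + 1, by omega⟩
    obtain ⟨x, hx, hvx⟩ := hlev k' (by omega)
    simp only [lvlBase, heven, if_true, abel_pt] at hvx
    have hux : u = Multiplicative.toAdd (abel x) := by rw [hu, hvx]; simp
    rw [hux] at hz
    suffices h : ∀ z, Multiplicative.toAdd (abel x) z ≠ 0 → ∃ c : ℕ, z = 2 * c + 1 ∧ good c k' by
      obtain ⟨c, hc, hc'⟩ := h z hz
      exact ⟨c, hc, hanti c k k' (by omega) hc'⟩
    clear hvx hux hz
    induction hx using Subgroup.closure_induction with
    | mem x hx =>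
      obtain ⟨c, hc, rfl⟩ := hx
      intro z hz
      simp only [lvlGen, heven, if_true, abel_lk, Finsupp.single_apply] at hz
      exact ⟨c, by by_contra h; exact hz (if_neg (Ne.symm h)), hc heven⟩
    | one => simp
    | mul x y _ _ hx hy =>
      intro z hz
      rw [map_mul, toAdd_mul, Finsupp.add_apply] at hz
      by_cases h : Multiplicative.toAdd (abel x) z = 0
      · exact hy z (by simpa [h] using hz)
      · exact hx z h
    | inv x _ hx =>
      intro z hz
      rw [map_inv, toAdd_inv, Finsupp.neg_apply] at hz
      exact hx z (by simpa using hz)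
  have hχu : χ u = 0 := by
    simp only [χ, Finsupp.liftAddHom_apply, Finsupp.sum]
    refine Finset.sum_eq_zero fun z hz => ?_
    obtain ⟨c, hc, -⟩ := hsupp 0 z (Finsupp.mem_support_iff.1 hz)
    have hall : ∀ k, good c k := fun k => by
      obtain ⟨c', hc', h'⟩ := hsupp k z (Finsupp.mem_support_iff.1 hz)
      obtain rfl : c = c' := by omega
      exact h'
    have hcE := hgood c hall
    have : ε (tgt c) = ε (src c) := by
      have : E (tgt c) m ↔ E (src c) m :=
        ⟨fun h => hE.trans hcE h, fun h => hE.trans (hE.symm hcE) h⟩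
      simp only [ε, this]
    simp [hc, w1, this]
  rw [hu, map_sub, map_add, hχv, χs, χs, w0, w0] at hχu
  by_contra hnm
  simp [ε, hnm, hE.refl m] at hχu

end CodingSets

section PrimrecGroups

open Primrec

variable {α β γ σ : Type} [Primcodable α] [Primcodable β] [Primcodable γ] [Primcodable σ]

/-- Add a letter on the left of a reduced word. -/
def consReduce [DecidableEq α] (a : α × Bool) (L : List (α × Bool)) : List (α × Bool) :=
  List.casesOn L [a] fun b l => if a.1 = b.1 ∧ a.2 = not b.2 then l else a :: b :: l

lemma reduce_eq_foldr [DecidableEq α] (L : List (α × Bool)) :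
    FreeGroup.reduce L = L.foldr consReduce [] := by
  induction L with
  | nil => rfl
  | cons a L ih => rw [List.foldr_cons, ← ih]; rfl

lemma primrec_consReduce [DecidableEq α] : Primrec₂ (consReduce (α := α)) := by
  refine (Primrec.list_casesOn (f := fun p : (α × Bool) × List (α × Bool) => p.2)
    (g := fun p => [p.1]) (h := fun p q => if p.1.1 = q.1.1 ∧ p.1.2 = not q.1.2 then q.2 else
      p.1 :: q.1 :: q.2) snd (list_cons.comp fst (const [])) ?_).of_eq fun _ => rfl
  have h1 : Primrec fun p : ((α × Bool) × List (α × Bool)) × ((α × Bool) × List (α × Bool)) =>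
    p.1.1 := fst.comp fst
  have h2 : Primrec fun p : ((α × Bool) × List (α × Bool)) × ((α × Bool) × List (α × Bool)) =>
    p.2.1 := fst.comp snd
  have h3 : Primrec fun p : ((α × Bool) × List (α × Bool)) × ((α × Bool) × List (α × Bool)) =>
    p.2.2 := snd.comp snd
  exact Primrec.ite ((Primrec.eq.comp (fst.comp h1) (fst.comp h2)).and
    (Primrec.eq.comp (snd.comp h1) (Primrec.not.comp (snd.comp h2)))) h3
    (list_cons.comp h1 (list_cons.comp h2 h3))

lemma primrec_reduce [DecidableEq α] :
    Primrec (FreeGroup.reduce : List (α × Bool) → List (α × Bool)) :=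
  (Primrec.list_foldr .id (const []) (primrec_consReduce.comp (fst.comp snd) (snd.comp snd)).to₂).of_eq
    fun L => (reduce_eq_foldr L).symm

/-- Reduced words form a copy of the free group. -/
def reducedEquiv (α : Type) [DecidableEq α] :
    FreeGroup α ≃ {L : List (α × Bool) // FreeGroup.reduce L = L} where
  toFun x := ⟨x.toWord, FreeGroup.reduce_toWord x⟩
  invFun L := FreeGroup.mk L.1
  left_inv _ := FreeGroup.mk_toWord
  right_inv L := Subtype.ext (FreeGroup.toWord_mk.trans L.2)

lemma primrecPred_reduced [DecidableEq α] :
    PrimrecPred fun L : List (α × Bool) => FreeGroup.reduce L = L :=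
  Primrec.eq.comp primrec_reduce .id

instance [DecidableEq α] : Primcodable {L : List (α × Bool) // FreeGroup.reduce L = L} :=
  Primcodable.subtype primrecPred_reduced

instance [DecidableEq α] : Primcodable (FreeGroup α) := Primcodable.ofEquiv _ (reducedEquiv α)

variable [DecidableEq α] [DecidableEq β]

lemma primrec_toWord : Primrec (FreeGroup.toWord : FreeGroup α → List (α × Bool)) :=
  (subtype_val (hp := primrecPred_reduced)).comp (of_equiv (e := reducedEquiv α))

lemma primrec_mk : Primrec (FreeGroup.mk : List (α × Bool) → FreeGroup α) := by
  refine (Primrec.of_equiv_iff (reducedEquiv α)).1 ?_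
  refine (Primrec.subtype_val_iff (hp := primrecPred_reduced)).1 ?_
  exact primrec_reduce.of_eq fun L => FreeGroup.toWord_mk.symm

lemma primrec_mul : Primrec₂ (fun x y : FreeGroup α => x * y) :=
  (primrec_mk.comp (list_append.comp (primrec_toWord.comp fst) (primrec_toWord.comp snd))).of_eq
    fun p => by rw [← FreeGroup.mul_mk, FreeGroup.mk_toWord, FreeGroup.mk_toWord]

lemma primrec_inv : Primrec (fun x : FreeGroup α => x⁻¹) := by
  have : Primrec fun L : List (α × Bool) => FreeGroup.invRev L :=
    (list_reverse.comp (list_map .id (pair (fst.comp snd) (Primrec.not.comp (snd.comp snd))).to₂)).of_eq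
      fun _ => rfl
  exact (primrec_mk.comp (this.comp primrec_toWord)).of_eq fun x => by
    rw [← FreeGroup.inv_mk, FreeGroup.mk_toWord]

lemma primrec_of : Primrec (FreeGroup.of : α → FreeGroup α) :=
  primrec_mk.comp (list_cons.comp (pair .id (const true)) (const []))

lemma primrec_pow : Primrec₂ (fun (x : FreeGroup α) (n : ℕ) => x ^ n) :=
  (nat_rec (f := fun _ : FreeGroup α => 1) (g := fun x p => p.2 * x) (const 1)
    (primrec_mul.comp (snd.comp snd) fst)).of_eq fun x n => by
      induction n with
      | zero => simp
      | succ n ih => simp [pow_succ, ih]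

/-- A signed group element. -/
def signed {G : Type} [Group G] (x : G) (b : Bool) : G := bif b then x else x⁻¹

lemma primrec_signed : Primrec₂ (fun (x : FreeGroup α) (b : Bool) => signed x b) :=
  Primrec.cond snd fst (primrec_inv.comp fst)

lemma primrec_list_prod : Primrec (fun L : List (FreeGroup α) => L.prod) :=
  (list_foldr .id (const 1) (primrec_mul.comp (fst.comp snd) (snd.comp snd)).to₂).of_eq
    fun _ => rfl

lemma primrec_lift {f : γ → α → FreeGroup β} (hf : Primrec₂ f) :
    Primrec₂ fun c (x : FreeGroup α) => FreeGroup.lift (f c) x := by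
  have : Primrec₂ fun c (L : List (α × Bool)) => (L.map fun a => signed (f c a.1) a.2).prod :=
    primrec_list_prod.comp (list_map snd (primrec_signed.comp
      (hf.comp (fst.comp fst) (fst.comp snd)) (snd.comp snd)).to₂)
  refine (this.comp fst (primrec_toWord.comp snd)).of_eq fun p => ?_
  change _ = FreeGroup.lift (f p.1) p.2
  conv_rhs => rw [← FreeGroup.mk_toWord (x := p.2), FreeGroup.lift_mk]
  rfl

end PrimrecGroups

section CE

variable {α β : Type} [Primcodable α] [Primcodable β]

/-- Computably enumerable predicates, in normal form. -/
def CE (p : α → Prop) : Prop := ∃ q : α → ℕ → Bool, Primrec₂ q ∧ ∀ a, p a ↔ ∃ n, q a n = true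

lemma CE.of_eq {p q : α → Prop} (hp : CE p) (h : ∀ a, p a ↔ q a) : CE q := by
  obtain ⟨r, hr, hr'⟩ := hp
  exact ⟨r, hr, fun a => (h a).symm.trans (hr' a)⟩

lemma CE.of_primrecPred {p : α → Prop} (hp : PrimrecPred p) : CE p := by
  obtain ⟨_, hp⟩ := hp
  exact ⟨fun a _ => decide (p a), hp.comp Primrec.fst, fun a => by simp⟩

lemma CE.comp {p : β → Prop} (hp : CE p) {f : α → β} (hf : Primrec f) : CE fun a => p (f a) := by
  obtain ⟨r, hr, hr'⟩ := hp
  exact ⟨fun a n => r (f a) n, hr.comp (hf.comp Primrec.fst) Primrec.snd, fun a => hr' _⟩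

lemma CE.and {p q : α → Prop} (hp : CE p) (hq : CE q) : CE fun a => p a ∧ q a := by
  obtain ⟨r, hr, hr'⟩ := hp
  obtain ⟨s, hs, hs'⟩ := hq
  refine ⟨fun a n => r a n.unpair.1 && s a n.unpair.2, ?_, fun a => ?_⟩
  · exact Primrec.and.comp
      (hr.comp Primrec.fst (Primrec.fst.comp (Primrec.unpair.comp Primrec.snd)))
      (hs.comp Primrec.fst (Primrec.snd.comp (Primrec.unpair.comp Primrec.snd)))
  · simp only [hr', hs']
    constructor
    · rintro ⟨⟨m, hm⟩, n, hn⟩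
      exact ⟨Nat.pair m n, by simp [hm, hn]⟩
    · rintro ⟨n, hn⟩
      rw [Bool.and_eq_true] at hn
      exact ⟨⟨_, hn.1⟩, _, hn.2⟩

lemma CE.or {p q : α → Prop} (hp : CE p) (hq : CE q) : CE fun a => p a ∨ q a := by
  obtain ⟨r, hr, hr'⟩ := hp
  obtain ⟨s, hs, hs'⟩ := hq
  refine ⟨fun a n => r a n || s a n, Primrec.or.comp hr hs, fun a => ?_⟩
  simp only [hr', hs']
  simp [exists_or]

lemma CE.imp {p q : α → Prop} (hp : PrimrecPred p) (hq : CE q) : CE fun a => p a → q a :=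
  ((CE.of_primrecPred hp.not).or hq).of_eq fun a => by tauto

lemma CE.exists {p : α → β → Prop} (hp : CE fun x : α × β => p x.1 x.2) : CE fun a => ∃ b, p a b := by
  obtain ⟨r, hr, hr'⟩ := hp
  refine ⟨fun a n => Option.casesOn (Encodable.decode (α := β) n.unpair.1) false
    fun b => r (a, b) n.unpair.2, ?_, fun a => ?_⟩
  · refine Primrec.option_casesOn (Primrec.decode.comp
      (Primrec.fst.comp (Primrec.unpair.comp Primrec.snd))) (Primrec.const false) ?_
    exact hr.comp (Primrec.pair (Primrec.fst.comp Primrec.fst) Primrec.snd)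
      (Primrec.snd.comp (Primrec.unpair.comp (Primrec.snd.comp Primrec.fst)))
  · constructor
    · rintro ⟨b, hb⟩
      obtain ⟨n, hn⟩ := (hr' (a, b)).1 hb
      exact ⟨Nat.pair (Encodable.encode b) n, by simp [hn]⟩
    · rintro ⟨n, hn⟩
      cases h : (Encodable.decode (α := β) n.unpair.1) with
      | none => simp [h] at hn
      | some b =>
        simp only [h] at hn
        exact ⟨b, (hr' (a, b)).2 ⟨_, hn⟩⟩

lemma CE.forall_mem {p : α → β → Prop} (hp : CE fun x : α × β => p x.1 x.2) {f : α → List β}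
    (hf : Primrec f) : CE fun a => ∀ b ∈ f a, p a b := by
  obtain ⟨r, hr, hr'⟩ := hp
  have h1 : PrimrecRel fun (n : ℕ) (x : α × β) => r x n = true :=
    Primrec.eq.comp (hr.comp Primrec.snd Primrec.fst) (Primrec.const true)
  have h2 : PrimrecRel fun (b : β) (x : ℕ × α) => ∃ n < x.1, r (x.2, b) n = true :=
    (h1.exists_mem_list.comp (f := fun p : β × (ℕ × α) => List.range p.2.1)
      (g := fun p : β × (ℕ × α) => (p.2.2, p.1)) (Primrec.list_range.comp
        (Primrec.fst.comp Primrec.snd))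
      (Primrec.pair (Primrec.snd.comp Primrec.snd) Primrec.fst)).of_eq fun _ => by simp
  have h3 : PrimrecPred fun x : α × ℕ => ∀ b ∈ f x.1, ∃ n < x.2, r (x.1, b) n = true :=
    h2.forall_mem_list.comp (f := fun x : α × ℕ => f x.1) (g := fun x => (x.2, x.1))
      (hf.comp Primrec.fst) (Primrec.pair Primrec.snd Primrec.fst)
  obtain ⟨_, h4⟩ := h3
  refine ⟨fun a n => decide (∀ b ∈ f a, ∃ m < n, r (a, b) m = true),
    h4.of_eq fun x => by congr, fun a => ?_⟩
  have hr' : ∀ b, p a b ↔ ∃ n, r (a, b) n = true := fun b => hr' (a, b)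
  simp only [decide_eq_true_eq, hr']
  constructor
  · intro h
    choose! g hg using h
    have : ∃ N, ∀ b ∈ f a, g b < N := by
      clear hg
      induction f a with
      | nil => exact ⟨0, by simp⟩
      | cons b l ih =>
        obtain ⟨N, hN⟩ := ih
        refine ⟨max N (g b + 1), fun c hc => ?_⟩
        rcases List.mem_cons.1 hc with rfl | hc
        · omega
        · have := hN c hc; omega
    obtain ⟨N, hN⟩ := this
    exact ⟨N, fun b hb => ⟨g b, hN b hb, hg b hb⟩⟩
  · rintro ⟨n, hn⟩ b hb
    obtain ⟨m, -, hm⟩ := hn b hb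
    exact ⟨m, hm⟩

lemma ce_of_computable {f : α → Bool} (hf : Computable f) : CE fun a => f a = true := by
  have h1 : Partrec fun a => (f a : Part Bool) := hf.partrec
  obtain ⟨c, hc⟩ := Nat.Partrec.Code.exists_code.1 h1
  refine ⟨fun a n => decide (c.evaln n (Encodable.encode a) = some (Encodable.encode true)), ?_, ?_⟩
  · exact (Primrec.eq.comp (Nat.Partrec.Code.primrec_evaln.comp (Primrec.pair (Primrec.pair Primrec.snd
      (Primrec.const c)) (Primrec.encode.comp Primrec.fst))) (Primrec.const _)).decide
  · intro a
    have : c.eval (Encodable.encode a) = Part.some (Encodable.encode (f a)) := by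
      rw [hc]; simp
    constructor
    · intro h
      rw [h] at this
      obtain ⟨n, hn⟩ := Nat.Partrec.Code.evaln_complete.1 (this ▸ Part.mem_some _)
      exact ⟨n, decide_eq_true hn⟩
    · rintro ⟨n, hn⟩
      have h2 := Nat.Partrec.Code.evaln_sound (of_decide_eq_true hn)
      rw [this] at h2
      exact Encodable.encode_injective (Part.mem_some_iff.1 h2).symm

/-- The s-m-n theorem for computably enumerable predicates. -/
lemma exists_index {p : ℕ → ℕ → Prop} (hp : CE fun x : ℕ × ℕ => p x.1 x.2) :
    ∃ e : ℕ → ℕ, Computable e ∧ ∀ n x,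
      ((Denumerable.ofNat Nat.Partrec.Code (e n)).eval x).Dom ↔ p n x := by
  obtain ⟨r, hr, hr'⟩ := hp
  have h0 : Computable₂ fun m n : ℕ => r m.unpair n :=
    (hr.comp (Primrec.unpair.comp Primrec.fst) Primrec.snd).to_comp
  have h1 : Partrec fun m : ℕ => Nat.rfind (fun n => (r m.unpair n : Part Bool)) :=
    Partrec.rfind h0.partrec₂
  obtain ⟨c, hc⟩ := Nat.Partrec.Code.exists_code.1 (Partrec.nat_iff.1 h1)
  refine ⟨fun n => Encodable.encode (c.curry n), ?_, fun n x => ?_⟩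
  · exact (Primrec.encode.comp (Nat.Partrec.Code.primrec₂_curry.comp (Primrec.const c)
      Primrec.id)).to_comp
  · rw [Denumerable.ofNat_encode, Nat.Partrec.Code.eval_curry, hc]
    refine Iff.trans ?_ (hr' (n, x)).symm
    change (Nat.rfind (fun k => (r (Nat.pair n x).unpair k : Part Bool))).Dom ↔ _
    refine Nat.rfind_dom.trans ?_
    rw [Nat.unpair_pair]
    simp

lemma ce_mem_domain : CE fun x : ℕ × ℕ =>
    ((Denumerable.ofNat Nat.Partrec.Code x.1).eval x.2).Dom := by
  refine ⟨fun x n => ((Denumerable.ofNat Nat.Partrec.Code x.1).evaln n x.2).isSome, ?_, fun x => ?_⟩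
  · exact Primrec.option_isSome.comp (Nat.Partrec.Code.primrec_evaln.comp (Primrec.pair (Primrec.pair
      Primrec.snd ((Primrec.ofNat _).comp (Primrec.fst.comp Primrec.fst)))
      (Primrec.snd.comp Primrec.fst)))
  · simp only [Part.dom_iff_mem]
    simp only [Nat.Partrec.Code.evaln_complete, Option.isSome_iff_exists, Option.mem_def]
    exact exists_comm

end CE


section KernelWords

open Primrec

variable {K : Type} [Group K] {N : ℕ} (σ : Fin N → Gen K)

/-- The value of a signed letter. -/
noncomputable def letter (a : Fin N × Bool) : Big K := signed (genVal (σ a.1)) a.2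

/-- The value of a word. -/
noncomputable def value (L : List (Fin N × Bool)) : Big K := (L.map (letter σ)).prod

lemma value_append (L : List (Fin N × Bool)) (a : Fin N × Bool) :
    value σ (L ++ [a]) = value σ L * letter σ a := by simp [value]

lemma lift_mk_eq_value (L : List (Fin N × Bool)) :
    FreeGroup.lift genVal (FreeGroup.map σ (FreeGroup.mk L)) = value σ L := by
  simp [FreeGroup.map.mk, FreeGroup.lift_mk, value, Function.comp_def]
  rfl

lemma letter_k (a : Fin N × Bool) {s : Q} (hs : s ≠ 1) : (letter σ a).k s = 1 := by
  obtain ⟨a, b⟩ := a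
  rcases h : σ a with c | κ | i <;> cases b <;>
    simp [letter, signed, h, genVal, Big.inv_k, Big.lamp_k_of_ne hs]

lemma letter_w (a : Fin N × Bool) (i : Fin 3) {q : Q} (s : Q) {j : K} (h : ¬(q = 1 ∧ j = 1)) :
    (letter σ a).w i q s j = 0 := by
  obtain ⟨a, b⟩ := a
  rcases h' : σ a with c | κ | i <;> cases b <;>
    simp [letter, signed, h', genVal, Big.inv_w, Big.label_w] <;> tauto

lemma letter_w_one (a : Fin N × Bool) (i : Fin 3) (s : Q) :
    (letter σ a).w i 1 s 1 = (letter σ a).w i 1 1 1 := by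
  obtain ⟨a, b⟩ := a
  rcases h' : σ a with c | κ | i <;> cases b <;>
    simp [letter, signed, h', genVal, Big.inv_w, Big.label_w]

/-- The local state: the lamp at a position and the labels at a pair of positions. -/
abbrev LocalState (K : Type) := K × (K → ZMod 30)

open Classical in
/-- The update of the local state. -/
noncomputable def update (p : ((Fin N × Bool) × Fin 3 × Bool × Bool) × LocalState K) :
    LocalState K :=
  (p.2.1 * if p.1.2.2.1 then (letter σ p.1.1).k 1 else 1,
    fun j => p.2.2 j + if p.1.2.2.2 ∧ p.2.1⁻¹ * j = 1 then (letter σ p.1.1).w p.1.2.1 1 1 1 else 0)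

/-- One step of the evaluation of a word near given positions. -/
noncomputable def step (x : Fin 3 × Q × Q) (st : Q × LocalState K) (a : Fin N × Bool) :
    Q × LocalState K :=
  (st.1 * (letter σ a).g,
    update σ ((a, x.1, decide (st.1 = x.2.2), decide (st.1 = x.2.1)), st.2))

lemma foldl_step (x : Fin 3 × Q × Q) (L : List (Fin N × Bool)) :
    L.foldl (step σ x) (1, 1, 0) =
      ((value σ L).g, (value σ L).k x.2.2, (value σ L).w x.1 x.2.1 x.2.2) := by
  obtain ⟨i, q, s⟩ := x
  induction L using List.reverseRecOn with
  | nil => rfl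
  | append_singleton L a ih =>
    rw [List.foldl_append, List.foldl_cons, List.foldl_nil, ih, value_append]
    refine Prod.ext rfl (Prod.ext ?_ ?_)
    · simp only [step, update, Big.mul_k, decide_eq_true_eq]
      split_ifs with h
      · simp [← h]
      · rw [letter_k]
        rw [Ne, inv_mul_eq_one]; exact h
    · funext j
      simp only [step, update, Big.mul_w, decide_eq_true_eq]
      split_ifs with h
      · rw [h.2, inv_mul_eq_one.2 (of_decide_eq_true h.1), letter_w_one σ a i (_ * s)]
      · rw [letter_w]
        rw [inv_mul_eq_one]; simpa using h

/-- One step of the list of visited positions, carried along with the current position. -/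
noncomputable def visit (st : Q × List Q) (a : Fin N × Bool) : Q × List Q :=
  (st.1 * (letter σ a).g, st.1 :: st.2)

/-- The positions visited by a word. -/
noncomputable def visited (L : List (Fin N × Bool)) : List Q := (L.foldl (visit σ) (1, [])).2

lemma foldl_visit (L : List (Fin N × Bool)) :
    L.foldl (visit σ) (1, []) = ((value σ L).g, visited σ L) := by
  induction L using List.reverseRecOn with
  | nil => rfl
  | append_singleton L a ih =>
    refine Prod.ext ?_ rfl
    rw [List.foldl_append, List.foldl_cons, List.foldl_nil, ih, value_append]
    rfl

lemma visited_append (L : List (Fin N × Bool)) (a : Fin N × Bool) :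
    visited σ (L ++ [a]) = (value σ L).g :: visited σ L := by
  rw [visited, List.foldl_append, foldl_visit]
  rfl

lemma value_k_of_notMem {L : List (Fin N × Bool)} {s : Q} (hs : s ∉ visited σ L) :
    (value σ L).k s = 1 := by
  induction L using List.reverseRecOn with
  | nil => rfl
  | append_singleton L a ih =>
    rw [visited_append, List.mem_cons, not_or] at hs
    rw [value_append, Big.mul_k, ih hs.2, letter_k, one_mul]
    rw [Ne, inv_mul_eq_one]
    exact Ne.symm hs.1

lemma value_w_of_notMem {L : List (Fin N × Bool)} {q : Q} (hq : q ∉ visited σ L) (i : Fin 3)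
    (s : Q) (j : K) : (value σ L).w i q s j = 0 := by
  induction L using List.reverseRecOn with
  | nil => rfl
  | append_singleton L a ih =>
    rw [visited_append, List.mem_cons, not_or] at hq
    rw [value_append, Big.mul_w, ih hq.2, letter_w, zero_add]
    rw [inv_mul_eq_one]
    exact fun h => hq.1 h.1.symm

lemma value_w_congr {L : List (Fin N × Bool)} {s s' : Q} (hs : s ∉ visited σ L)
    (hs' : s' ∉ visited σ L) (i : Fin 3) (q : Q) (j : K) :
    (value σ L).w i q s j = (value σ L).w i q s' j := by
  induction L using List.reverseRecOn generalizing j with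
  | nil => rfl
  | append_singleton L a ih =>
    rw [visited_append, List.mem_cons, not_or] at hs hs'
    rw [value_append, Big.mul_w, Big.mul_w, ih hs.2 hs'.2, value_k_of_notMem σ hs.2,
      value_k_of_notMem σ hs'.2]
    congr 1
    by_cases h : (value σ L).g⁻¹ * q = 1 ∧ (1 : K)⁻¹ * j = 1
    · rw [h.1, h.2, letter_w_one, letter_w_one σ a i (_ * s')]
    · rw [letter_w σ a i _ h, letter_w σ a i _ h]

lemma value_mem_ker_iff {S : Fin 3 → Set Q} (hS : ∀ i, (S i)ᶜ.Infinite)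
    (L : List (Fin N × Bool)) : Ev K S (FreeGroup.map σ (FreeGroup.mk L)) = 1 ↔
      (value σ L).g = 1 ∧ (∀ s ∈ visited σ L, (value σ L).k s = 1) ∧
      ∀ i ∈ List.finRange 3, ∀ q ∈ visited σ L,
        (∃ s, s ∉ visited σ L ∧ (value σ L).w i q s = 0) ∧
        ∀ s ∈ visited σ L, q⁻¹ * s ∈ S i ∨ (value σ L).w i q s = 0 := by
  classical
  have key : Ev K S (FreeGroup.map σ (FreeGroup.mk L)) = Big.mask S (value σ L) := by
    rw [Ev, MonoidHom.comp_apply, lift_mk_eq_value]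
  rw [key]
  constructor
  · intro h
    have hw : ∀ i q s, q⁻¹ * s ∈ S i ∨ (value σ L).w i q s = 0 := fun i q s => by
      by_cases hm : q⁻¹ * s ∈ S i
      · exact Or.inl hm
      · refine Or.inr (funext fun j => ?_)
        have := congrArg (fun x => x.w i q s j) h
        simpa [Big.mask_w, hm] using this
    refine ⟨congrArg Big.g h, fun s _ => congrArg (fun x => x.k s) h, fun i _ q _ =>
      ⟨?_, fun s _ => hw i q s⟩⟩
    have hinf : {s : Q | q⁻¹ * s ∈ (S i)ᶜ}.Infinite :=
      (hS i).preimage (f := fun s => q⁻¹ * s) fun y _ => ⟨q * y, by simp⟩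
    obtain ⟨s, hs, hs'⟩ := hinf.exists_notMem_finset (visited σ L).toFinset
    exact ⟨s, by simpa using hs', (hw i q s).resolve_left hs⟩
  · rintro ⟨hg, hk, h⟩
    refine Big.ext' (fun i q s j => ?_) (fun s => ?_) hg
    · rw [Big.mask_w, Big.one_w]
      split_ifs with hm
      · rfl
      by_cases hq : q ∈ visited σ L
      · obtain ⟨⟨s', hs', hw⟩, h2⟩ := h i (List.mem_finRange i) q hq
        by_cases hs : s ∈ visited σ L
        · exact congrFun ((h2 s hs).resolve_left hm) j
        · rw [value_w_congr σ hs hs', hw]; rfl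
      · exact value_w_of_notMem σ hq i s j
    · by_cases hs : s ∈ visited σ L
      · exact hk s hs
      · exact value_k_of_notMem σ hs

/-- A finite type is primitive recursively coded by an arbitrary enumeration. -/
@[reducible] noncomputable def finitePrimcodable (T : Type) [Finite T] : Primcodable T :=
  Primcodable.ofEquiv (Fin (Nat.card T)) (Finite.equivFin T)

lemma primrec_visit : Primrec₂ (visit σ) := by
  have h : Primrec fun a : Fin N × Bool => (letter σ a).g := dom_finite _
  exact Primrec.pair (primrec_mul.comp (fst.comp fst) (h.comp snd))
    (list_cons.comp (fst.comp fst) (snd.comp fst))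

lemma primrec_visited : Primrec (visited σ) :=
  snd.comp (list_foldl .id (const (1, [])) ((primrec_visit σ).comp (fst.comp snd) (snd.comp snd)).to₂)

lemma primrec_value_g : Primrec fun L => (value σ L).g :=
  (fst.comp (list_foldl .id (const (1, []))
    ((primrec_visit σ).comp (fst.comp snd) (snd.comp snd)).to₂)).of_eq
    fun L => congrArg Prod.fst (foldl_visit σ L)

lemma primrecPred_state [Finite K] (p : LocalState K → Prop) :
    PrimrecPred fun y : (Fin 3 × Q × Q) × List (Fin N × Bool) =>
      p ((value σ y.2).k y.1.2.2, (value σ y.2).w y.1.1 y.1.2.1 y.1.2.2) := by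
  classical
  let : Primcodable (LocalState K) := finitePrimcodable _
  have hu : Primrec (update σ) := by
    exact dom_finite _
  have hs : Primrec₂ fun (y : (Fin 3 × Q × Q) × List (Fin N × Bool))
      (z : (Q × LocalState K) × (Fin N × Bool)) => step σ y.1 z.1 z.2 := by
    have h : Primrec fun a : Fin N × Bool => (letter σ a).g := dom_finite _
    have hz1 : Primrec fun w : ((Fin 3 × Q × Q) × List (Fin N × Bool)) ×
      ((Q × LocalState K) × (Fin N × Bool)) => w.2.1.1 := fst.comp (fst.comp snd)
    have ha : Primrec fun w : ((Fin 3 × Q × Q) × List (Fin N × Bool)) ×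
      ((Q × LocalState K) × (Fin N × Bool)) => w.2.2 := snd.comp snd
    have hx : Primrec fun w : ((Fin 3 × Q × Q) × List (Fin N × Bool)) ×
      ((Q × LocalState K) × (Fin N × Bool)) => w.1.1 := fst.comp fst
    refine Primrec.pair (primrec_mul.comp hz1 (h.comp ha)) (hu.comp (Primrec.pair (Primrec.pair ha
      (Primrec.pair (fst.comp hx) (Primrec.pair ?_ ?_))) (snd.comp (fst.comp snd))))
    · exact (Primrec.eq.comp hz1 (snd.comp (snd.comp hx))).decide
    · exact (Primrec.eq.comp hz1 (fst.comp (snd.comp hx))).decide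
  have hf := list_foldl (f := Prod.snd) (g := fun _ => ((1 : Q), ((1 : K), (0 : K → ZMod 30)))) snd
    (const _) hs
  have hp : Primrec fun t : LocalState K => decide (p t) := dom_finite _
  refine ⟨fun _ => Classical.dec _, (hp.comp (snd.comp hf)).of_eq fun y => ?_⟩
  simp only [foldl_step]

lemma ce_ker [Finite K] {S : ℕ → Fin 3 → Set Q} (hS : ∀ n i, (S n i)ᶜ.Infinite)
    (hce : CE fun y : ℕ × Fin 3 × Q => y.2.2 ∈ S y.1 y.2.1) :
    CE fun y : ℕ × List (Fin N × Bool) =>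
      Ev K (S y.1) (FreeGroup.map σ (FreeGroup.mk y.2)) = 1 := by
  refine CE.of_eq ?_ fun y => (value_mem_ker_iff σ (hS y.1) y.2).symm
  have hv : Primrec fun y : ℕ × List (Fin N × Bool) => visited σ y.2 := (primrec_visited σ).comp snd
  refine (CE.of_primrecPred (Primrec.eq.comp ((primrec_value_g σ).comp snd) (const 1))).and
    (.and ?_ ?_)
  · refine CE.forall_mem (β := Q) (p := fun y s => (value σ y.2).k s = 1) ?_ hv
    refine CE.of_primrecPred ?_
    exact (primrecPred_state σ fun t => t.1 = 1).comp
      (f := fun x : (ℕ × List (Fin N × Bool)) × Q => ((0, 1, x.2), x.1.2))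
      (Primrec.pair (Primrec.pair (const 0) (Primrec.pair (const 1) snd)) (snd.comp fst))
  · refine CE.forall_mem (β := Fin 3) (p := fun (y : ℕ × List (Fin N × Bool)) i => ∀ q ∈ visited σ y.2,
        (∃ s, s ∉ visited σ y.2 ∧ (value σ y.2).w i q s = 0) ∧
        ∀ s ∈ visited σ y.2, q⁻¹ * s ∈ S y.1 i ∨ (value σ y.2).w i q s = 0) ?_ (const _)
    refine CE.forall_mem (β := Q) (f := fun y => visited σ y.1.2)
      (p := fun (y : (ℕ × List (Fin N × Bool)) × Fin 3) q =>
        (∃ s, s ∉ visited σ y.1.2 ∧ (value σ y.1.2).w y.2 q s = 0) ∧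
        ∀ s ∈ visited σ y.1.2, q⁻¹ * s ∈ S y.1.1 y.2 ∨ (value σ y.1.2).w y.2 q s = 0) ?_
        (hv.comp fst)
    have hw : PrimrecPred fun y : (((ℕ × List (Fin N × Bool)) × Fin 3) × Q) × Q =>
        (value σ y.1.1.1.2).w y.1.1.2 y.1.2 y.2 = 0 :=
      (primrecPred_state σ fun t => t.2 = 0).comp
        (f := fun y : (((ℕ × List (Fin N × Bool)) × Fin 3) × Q) × Q =>
          ((y.1.1.2, y.1.2, y.2), y.1.1.1.2))
        (Primrec.pair (Primrec.pair (snd.comp (fst.comp fst)) (Primrec.pair (snd.comp fst) snd))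
          (snd.comp (fst.comp (fst.comp fst))))
    have hv' : Primrec fun y : (((ℕ × List (Fin N × Bool)) × Fin 3) × Q) × Q =>
        visited σ y.1.1.1.2 := hv.comp (fst.comp (fst.comp fst))
    refine CE.and (CE.exists (β := Q) (p := fun (y : ((ℕ × List (Fin N × Bool)) × Fin 3) × Q) s =>
      s ∉ visited σ y.1.1.2 ∧ (value σ y.1.1.2).w y.1.2 y.2 s = 0) ?_)
      (CE.forall_mem (β := Q) (f := fun y => visited σ y.1.1.2)
      (p := fun (y : ((ℕ × List (Fin N × Bool)) × Fin 3) × Q) s =>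
      y.2⁻¹ * s ∈ S y.1.1.1 y.1.2 ∨ (value σ y.1.1.2).w y.1.2 y.2 s = 0) ?_
      (hv.comp (fst.comp fst)))
    · refine CE.of_primrecPred (PrimrecPred.and (PrimrecPred.not ?_) hw)
      exact ((Primrec.eq.exists_mem_list.comp hv' snd).of_eq fun y => by simp)
    · refine CE.or ?_ (CE.of_primrecPred hw)
      exact hce.comp (f := fun y : (((ℕ × List (Fin N × Bool)) × Fin 3) × Q) × Q =>
        (y.1.1.1.1, y.1.1.2, y.1.2⁻¹ * y.2))
        (Primrec.pair (fst.comp (fst.comp (fst.comp fst))) (Primrec.pair (snd.comp (fst.comp fst))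
          (primrec_mul.comp (primrec_inv.comp (snd.comp fst)) snd)))

end KernelWords

section CodingSetsCE

open Primrec

lemma primrec_spread : Primrec spread :=
  primrec_mul.comp (primrec_mul.comp (primrec_pow.comp (const _) .id) (const _))
    (primrec_inv.comp (primrec_pow.comp (const _) .id))

lemma primrec_emb : Primrec emb :=
  (primrec_lift (f := fun _ : Unit => spread) (primrec_spread.comp snd)).comp (const ()) .id

lemma primrec_ptL : Primrec ptL := primrec_of.comp (nat_mul.comp (const 2) .id)

lemma primrec_lkL : Primrec lkL :=
  primrec_of.comp (succ.comp (nat_mul.comp (const 2) .id))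

lemma primrecPred_even : PrimrecPred fun n : ℕ => Even n :=
  (Primrec.eq.comp (nat_mod.comp .id (const 2)) (const 0)).of_eq fun _ => Nat.even_iff.symm

lemma primrec_lvlGen : Primrec₂ lvlGen := by
  refine Primrec.ite (primrecPred_even.comp fst) (primrec_lkL.comp snd)
    (primrec_mul.comp (primrec_mul.comp (primrec_ptL.comp ?_) (primrec_lkL.comp snd))
      (primrec_inv.comp (primrec_ptL.comp ?_)))
  · exact fst.comp (unpair.comp snd)
  · exact fst.comp (unpair.comp (snd.comp (unpair.comp snd)))

lemma primrec_lvlBase : Primrec₂ lvlBase :=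
  Primrec.ite (primrecPred_even.comp snd) (primrec_ptL.comp fst) (const 1)

lemma mem_lvl_iff {good : ℕ → ℕ → Prop} {k : ℕ} {x : FreeGroup ℕ} : x ∈ lvl good k ↔
    ∃ l : List (ℕ × Bool), (∀ p ∈ l, Even k → good p.1 k) ∧
      (l.map fun p => signed (lvlGen k p.1) p.2).prod = x := by
  constructor
  · intro hx
    rw [lvl, ← Subgroup.mem_toSubmonoid, Subgroup.closure_toSubmonoid] at hx
    obtain ⟨l, hl, rfl⟩ := Submonoid.exists_list_of_mem_closure hx
    clear hx
    induction l with
    | nil => exact ⟨[], by simp, rfl⟩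
    | cons y l ih =>
      obtain ⟨l', h1, h2⟩ := ih fun z hz => hl z (List.mem_cons_of_mem _ hz)
      have : ∃ c b, (Even k → good c k) ∧ signed (lvlGen k c) b = y := by
        rcases hl y List.mem_cons_self with ⟨c, hc, rfl⟩ | ⟨c, hc, h⟩
        · exact ⟨c, true, hc, rfl⟩
        · exact ⟨c, false, hc, by rw [← inv_inv y, h]; rfl⟩
      obtain ⟨c, b, hc, rfl⟩ := this
      refine ⟨(c, b) :: l', ?_, by simp [h2]⟩
      rintro p hp
      rcases List.mem_cons.1 hp with rfl | hp
      · exact hc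
      · exact h1 p hp
  · rintro ⟨l, hl, rfl⟩
    refine Subgroup.list_prod_mem _ fun y hy => ?_
    obtain ⟨p, hp, rfl⟩ := List.mem_map.1 hy
    have : lvlGen k p.1 ∈ lvl good k := Subgroup.subset_closure ⟨_, hl p hp, rfl⟩
    rcases p with ⟨c, _ | _⟩
    · exact Subgroup.inv_mem _ this
    · exact this

lemma ce_codeSet {good : ℕ → ℕ → Prop} (hg : CE fun x : ℕ × ℕ => good x.1 x.2) :
    CE fun y : ℕ × Q => y.2 ∈ codeSet good y.1 := by
  have h : CE fun y : ℕ × Q => ∃ k, ∃ l : List (ℕ × Bool), (∀ p ∈ l, Even k → good p.1 k) ∧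
      y.2 = emb (lvlBase y.1 k * (l.map fun p => signed (lvlGen k p.1) p.2).prod) *
        FreeGroup.of 0 ^ 2 ^ k := by
    refine CE.exists (p := fun (y : ℕ × Q) k => ∃ l : List (ℕ × Bool),
      (∀ p ∈ l, Even k → good p.1 k) ∧
      y.2 = emb (lvlBase y.1 k * (l.map fun p => signed (lvlGen k p.1) p.2).prod) *
        FreeGroup.of 0 ^ 2 ^ k) ?_
    refine CE.exists (p := fun (y : (ℕ × Q) × ℕ) (l : List (ℕ × Bool)) =>
      (∀ p ∈ l, Even y.2 → good p.1 y.2) ∧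
      y.1.2 = emb (lvlBase y.1.1 y.2 * (l.map fun p => signed (lvlGen y.2 p.1) p.2).prod) *
        FreeGroup.of 0 ^ 2 ^ y.2) (.and ?_ (.of_primrecPred ?_))
    · refine CE.forall_mem (f := fun y : ((ℕ × Q) × ℕ) × List (ℕ × Bool) => y.2)
        (p := fun y p => Even y.1.2 → good p.1 y.1.2) ?_ snd
      refine CE.imp (primrecPred_even.comp (snd.comp (fst.comp fst))) ?_
      exact hg.comp (f := fun x : (((ℕ × Q) × ℕ) × List (ℕ × Bool)) × (ℕ × Bool) =>
        (x.2.1, x.1.1.2)) (Primrec.pair (fst.comp snd) (snd.comp (fst.comp fst)))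
    · have hk : Primrec fun y : ((ℕ × Q) × ℕ) × List (ℕ × Bool) => y.1.2 := snd.comp fst
      have hpow : Primrec fun k : ℕ => 2 ^ k :=
        (nat_rec' .id (const 1) (nat_mul.comp (const 2) (snd.comp snd)).to₂).of_eq fun k => by
          induction k with
          | zero => rfl
          | succ k ih => simpa [pow_succ, mul_comm] using ih
      refine Primrec.eq.comp (snd.comp (fst.comp fst)) (primrec_mul.comp (primrec_emb.comp
        (primrec_mul.comp (primrec_lvlBase.comp (fst.comp (fst.comp fst)) hk) (primrec_list_prod.comp
          (list_map snd ?_)))) (primrec_pow.comp (const _) (hpow.comp hk)))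
      exact primrec_signed.comp (primrec_lvlGen.comp (hk.comp fst) (fst.comp snd)) (snd.comp snd)
  refine h.of_eq fun y => ?_
  simp only [codeSet, Set.mem_ofPred_eq, mem_lvl_iff]
  refine exists_congr fun k => ⟨?_, ?_⟩
  · rintro ⟨l, h1, h2⟩
    exact ⟨_, ⟨l, h1, rfl⟩, h2⟩
  · rintro ⟨_, ⟨l, h1, rfl⟩, h2⟩
    exact ⟨l, h1, h2⟩

/-- The three sets attached to the number `n`. -/
def codeFam (good : ℕ → ℕ → Prop) (n : ℕ) : Fin 3 → Set Q :=
  ![codeSet good n, powers 0, powers 1]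

lemma codeFam_compl_infinite (good : ℕ → ℕ → Prop) (n : ℕ) (i : Fin 3) :
    (codeFam good n i)ᶜ.Infinite := by
  fin_cases i
  · exact codeSet_compl_infinite n
  · exact powers_compl_infinite 0
  · exact powers_compl_infinite 1

lemma ce_codeFam {good : ℕ → ℕ → Prop} (hg : CE fun x : ℕ × ℕ => good x.1 x.2) :
    CE fun y : ℕ × Fin 3 × Q => y.2.2 ∈ codeFam good y.1 y.2.1 := by
  have hp : ∀ c : Fin 2, CE fun y : ℕ × Fin 3 × Q => y.2.2 ∈ powers c := fun c =>
    CE.exists (p := fun (y : ℕ × Fin 3 × Q) n => y.2.2 = FreeGroup.of c ^ n)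
      (.of_primrecPred (Primrec.eq.comp (snd.comp (snd.comp fst)) (primrec_pow.comp (const _) snd)))
  have hi : ∀ i : Fin 3, CE fun y : ℕ × Fin 3 × Q => y.2.1 = i := fun i =>
    .of_primrecPred (Primrec.eq.comp (fst.comp snd) (const i))
  have h0 : CE fun y : ℕ × Fin 3 × Q => y.2.2 ∈ codeSet good y.1 :=
    (ce_codeSet hg).comp (f := fun y : ℕ × Fin 3 × Q => (y.1, y.2.2))
      (Primrec.pair fst (snd.comp snd))
  refine (((hi 0).and h0).or (((hi 1).and (hp 0)).or ((hi 2).and (hp 1)))).of_eq fun y => ?_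
  obtain ⟨n, i, x⟩ := y
  fin_cases i <;> simp [codeFam]

end CodingSetsCE


section Hardness

/-- The simple group of the lamps. -/
abbrev A5 := alternatingGroup (Fin 5)

lemma exists_not_commute : ∃ a b : A5, ¬Commute a b := by
  refine ⟨⟨Equiv.swap 0 1 * Equiv.swap 1 2, ?_⟩, ⟨Equiv.swap 2 3 * Equiv.swap 3 4, ?_⟩, ?_⟩
  · rw [Equiv.Perm.mem_alternatingGroup]; decide
  · rw [Equiv.Perm.mem_alternatingGroup]; decide
  · rw [commute_iff_eq, Subtype.ext_iff]
    decide

/-- The number of generators. -/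
noncomputable def numGen : ℕ := Nat.card (Gen A5)

/-- The enumeration of the generators. -/
noncomputable def genEquiv : Fin numGen ≃ Gen A5 := (Finite.equivFin (Gen A5)).symm

/-- The words which are trivial in `Grp A5 S`. -/
def trivialWords (S : Fin 3 → Set Q) : Set (FreeGroup (Fin numGen)) :=
  {g | Ev A5 S (FreeGroup.map genEquiv g) = 1}

lemma presentedGroup_equiv (S : Fin 3 → Set Q) :
    Nonempty (PresentedGroup (trivialWords S) ≃* Grp A5 S) := by
  set φ : FreeGroup (Fin numGen) →* Big A5 := (Ev A5 S).comp (FreeGroup.map genEquiv) with hφ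
  have h1 : Subgroup.normalClosure (trivialWords S) = φ.ker := Subgroup.normalClosure_eq_self φ.ker
  have h2 : φ.range = Grp A5 S := by
    rw [hφ, MonoidHom.range_comp, MonoidHom.range_eq_top.2, ← MonoidHom.range_eq_map]
    exact FreeGroup.map_surjective genEquiv.surjective
  exact ⟨(QuotientGroup.quotientMulEquivOfEq h1).trans
    ((QuotientGroup.quotientKerEquivRange φ).trans (MulEquiv.subgroupCongr h2))⟩

lemma iso_codeFam_iff {E : ℕ → ℕ → Prop} (hE : Equivalence E) {good : ℕ → ℕ → Prop}
    (hgood : ∀ c, (∀ k, good c k) → E (src c) (tgt c))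
    (hanti : ∀ c k l, k ≤ l → good c l → good c k)
    (hex : ∀ n m, E n m → ∃ x, ∀ k, good (Nat.pair n (Nat.pair m x)) k) (n m : ℕ) :
    E n m ↔ Nonempty (PresentedGroup (trivialWords (codeFam good n)) ≃*
      PresentedGroup (trivialWords (codeFam good m))) := by
  obtain ⟨e1⟩ := presentedGroup_equiv (codeFam good n)
  obtain ⟨e2⟩ := presentedGroup_equiv (codeFam good m)
  have : IsSimpleGroup A5 := alternatingGroup.isSimpleGroup (by simp)
  constructor
  · intro h
    obtain ⟨x, hx⟩ := hex n m h
    obtain ⟨g, hg⟩ := codeSet_translate hx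
    obtain ⟨e⟩ : Nonempty (Grp A5 (codeFam good n) ≃* Grp A5 (codeFam good m)) :=
      iso_of_translate g hg rfl rfl
    exact ⟨e1.trans (e.trans e2.symm)⟩
  · rintro ⟨e⟩
    obtain ⟨g, hg⟩ := rigidity (primeProp_of_simple exists_not_commute) normalGen_of_simple
      (exists_ne 1) (codeFam_compl_infinite good n) (codeFam_compl_infinite good m) rfl rfl rfl rfl
      (e1.symm.trans (e.trans e2))
    exact codeSet_separate hE hgood hanti hg

theorem hardness {E : ℕ → ℕ → Prop} (hE : Equivalence E) (hS : Sigma03Rel E) :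
    ComputableReduction E GroupIsoFG := by
  obtain ⟨R, hR, hR'⟩ := hS
  set good : ℕ → ℕ → Prop := fun c k => ∀ y ∈ List.range k, ∃ z,
    R (Nat.pair (src c) (tgt c)) c.unpair.2.unpair.2 y z = true with hgood
  have hRE : ∀ a b, E a b ↔ ∃ x, ∀ y, ∃ z, R (Nat.pair a b) x y z = true := fun a b => by
    simpa using hR' (Nat.pair a b)
  have hce : CE fun x : ℕ × ℕ => good x.1 x.2 := by
    have h0 := ce_of_computable hR
    refine CE.forall_mem (f := fun x : ℕ × ℕ => List.range x.2) (p := fun (x : ℕ × ℕ) y => ∃ z,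
      R (Nat.pair (src x.1) (tgt x.1)) x.1.unpair.2.unpair.2 y z = true) ?_
      (Primrec.list_range.comp Primrec.snd)
    refine CE.exists (p := fun (x : (ℕ × ℕ) × ℕ) z =>
      R (Nat.pair (src x.1.1) (tgt x.1.1)) x.1.1.unpair.2.unpair.2 x.2 z = true) ?_
    have hc : Primrec fun x : ((ℕ × ℕ) × ℕ) × ℕ => x.1.1.1.unpair :=
      Primrec.unpair.comp (Primrec.fst.comp (Primrec.fst.comp Primrec.fst))
    have hc2 := Primrec.unpair.comp (Primrec.snd.comp hc)
    exact h0.comp (f := fun x : ((ℕ × ℕ) × ℕ) × ℕ => (Nat.pair (src x.1.1.1) (tgt x.1.1.1),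
      x.1.1.1.unpair.2.unpair.2, x.1.2, x.2)) (Primrec.pair (Primrec₂.natPair.comp
        (Primrec.fst.comp hc) (Primrec.fst.comp hc2)) (Primrec.pair (Primrec.snd.comp hc2)
        (Primrec.pair (Primrec.snd.comp Primrec.fst) Primrec.snd)))
  have hker := ce_ker (K := A5) genEquiv (codeFam_compl_infinite good) (ce_codeFam hce)
  have hp : CE fun x : ℕ × ℕ => ∃ L : List (Fin numGen × Bool),
      Ev A5 (codeFam good x.1) (FreeGroup.map genEquiv (FreeGroup.mk L)) = 1 ∧
      Encodable.encode (FreeGroup.mk L).toWord = x.2 := by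
    refine CE.exists (p := fun (x : ℕ × ℕ) (L : List (Fin numGen × Bool)) =>
      Ev A5 (codeFam good x.1) (FreeGroup.map genEquiv (FreeGroup.mk L)) = 1 ∧
      Encodable.encode (FreeGroup.mk L).toWord = x.2) (.and ?_ (.of_primrecPred ?_))
    · exact hker.comp (f := fun x : (ℕ × ℕ) × List (Fin numGen × Bool) => (x.1.1, x.2))
        (Primrec.pair (Primrec.fst.comp Primrec.fst) Primrec.snd)
    · exact Primrec.eq.comp (Primrec.encode.comp (primrec_toWord.comp (primrec_mk.comp Primrec.snd)))
        (Primrec.snd.comp Primrec.fst)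
  obtain ⟨e, he, he'⟩ := exists_index (p := fun n x => ∃ L : List (Fin numGen × Bool),
    Ev A5 (codeFam good n) (FreeGroup.map genEquiv (FreeGroup.mk L)) = 1 ∧
      Encodable.encode (FreeGroup.mk L).toWord = x) hp
  have hrel : ∀ n, relSet numGen (e n) = trivialWords (codeFam good n) := fun n => by
    ext g
    refine (he' n _).trans ⟨?_, fun h => ⟨g.toWord, ?_, ?_⟩⟩
    · rintro ⟨L, h1, h2⟩
      rw [← FreeGroup.toWord_injective (Encodable.encode_injective h2)]
      exact h1
    · rw [FreeGroup.mk_toWord]; exact h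
    · rw [FreeGroup.mk_toWord]; rfl
  refine ⟨fun n => Nat.pair numGen (e n), (Primrec₂.natPair.to_comp.comp
    (Computable.const _) he), fun n m => ?_⟩
  rw [GroupIsoFG]
  rw [Nat.unpair_pair, Nat.unpair_pair, hrel, hrel]
  refine iso_codeFam_iff (good := good) hE (fun c hc => ?_) (fun c k l hkl h y hy => h y ?_) (fun n m h => ?_) n m
  · exact (hRE _ _).2 ⟨_, fun y => hc (y + 1) y (by simp)⟩
  · rw [List.mem_range] at *; omega
  · obtain ⟨x, hx⟩ := (hRE n m).1 h
    exact ⟨x, fun k y _ => by simpa [src, tgt] using hx y⟩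

end Hardness


section UniversalPresentation

/-- The relators of a presentation transported to countably many generators. -/
def natRel (n : ℕ) : Set (FreeGroup ℕ) :=
  {x | ((∀ p ∈ x.toWord, p.1 < n.unpair.1) ∧ Encodable.encode x.toWord ∈ W n.unpair.2) ∨
    ∃ i, n.unpair.1 ≤ i ∧ x = FreeGroup.of i}

/-- The relations holding in a presented group, over countably many generators. -/
abbrev natKer (n : ℕ) : Subgroup (FreeGroup ℕ) := Subgroup.normalClosure (natRel n)

/-- The group coded by `n`. -/
abbrev PGrp (n : ℕ) : Type := PresentedGroup (relSet n.unpair.1 n.unpair.2)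

lemma toWord_map_val {k : ℕ} (g : FreeGroup (Fin k)) :
    (FreeGroup.map Fin.val g).toWord = g.toWord.map fun p => (p.1.val, p.2) := by
  conv_lhs => rw [← FreeGroup.mk_toWord (x := g), FreeGroup.map.mk, FreeGroup.toWord_mk]
  refine FreeGroup.IsReduced.reduce_eq ?_
  have := FreeGroup.isReduced_toWord (x := g)
  rw [FreeGroup.IsReduced] at this ⊢
  rw [List.isChain_map]
  exact this.imp fun a b h h' => h (Fin.ext h')

lemma encode_map_val {k : ℕ} (L : List (Fin k × Bool)) :
    Encodable.encode (L.map fun p => (p.1.val, p.2)) = Encodable.encode L := by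
  induction L with
  | nil => rfl
  | cons a L ih =>
    rw [List.map_cons, Encodable.encode_list_cons, ih, Encodable.encode_list_cons]
    rfl

/-- The generators of a presented group, extended by `1`. -/
def natGen (n i : ℕ) : PGrp n := if h : i < n.unpair.1 then PresentedGroup.of ⟨i, h⟩ else 1

/-- The projection of the free group on countably many generators onto a presented group. -/
def natProj (n : ℕ) : FreeGroup ℕ →* PGrp n := FreeGroup.lift (natGen n)

lemma natProj_map {n : ℕ} (g : FreeGroup (Fin n.unpair.1)) :
    natProj n (FreeGroup.map Fin.val g) = PresentedGroup.mk _ g := by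
  have : (natProj n).comp (FreeGroup.map Fin.val) = PresentedGroup.mk _ :=
    FreeGroup.ext_hom _ _ fun i => by simp [natProj, natGen]; rfl
  exact DFunLike.congr_fun this g

lemma natProj_surjective (n : ℕ) : Function.Surjective (natProj n) := fun y => by
  obtain ⟨g, rfl⟩ := PresentedGroup.mk_surjective _ y
  exact ⟨_, natProj_map g⟩

lemma exists_map_val {k : ℕ} {x : FreeGroup ℕ} (hx : ∀ p ∈ x.toWord, p.1 < k) :
    ∃ g : FreeGroup (Fin k), FreeGroup.map Fin.val g = x := by
  refine ⟨FreeGroup.mk (x.toWord.pmap (fun p (h : p.1 < k) => (⟨p.1, h⟩, p.2)) hx), ?_⟩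
  rw [FreeGroup.map.mk, List.map_pmap]
  simp [FreeGroup.mk_toWord]

lemma mem_natRel_map {n : ℕ} {g : FreeGroup (Fin n.unpair.1)}
    (hg : g ∈ relSet n.unpair.1 n.unpair.2) : FreeGroup.map Fin.val g ∈ natRel n := by
  refine Or.inl ⟨fun p hp => ?_, ?_⟩
  · rw [toWord_map_val, List.mem_map] at hp
    obtain ⟨q, -, rfl⟩ := hp
    exact q.1.2
  · rw [toWord_map_val, encode_map_val]
    exact hg

lemma natProj_ker (n : ℕ) : (natProj n).ker = natKer n := by
  apply le_antisymm
  · have hrel : ∀ r ∈ relSet n.unpair.1 n.unpair.2,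
        FreeGroup.lift (fun i : Fin n.unpair.1 =>
          QuotientGroup.mk' (natKer n) (FreeGroup.of i.val)) r = 1 := fun r hr => by
      have h1 : FreeGroup.lift (fun i : Fin n.unpair.1 =>
          QuotientGroup.mk' (natKer n) (FreeGroup.of i.val)) =
          (QuotientGroup.mk' (natKer n)).comp (FreeGroup.map Fin.val) :=
        FreeGroup.ext_hom _ _ fun i => by simp
      rw [h1, MonoidHom.comp_apply, QuotientGroup.mk'_apply, QuotientGroup.eq_one_iff]
      exact Subgroup.subset_normalClosure (mem_natRel_map hr)
    have h2 : (PresentedGroup.toGroup hrel).comp (natProj n) = QuotientGroup.mk' (natKer n) := by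
      refine FreeGroup.ext_hom _ _ fun i => ?_
      rw [MonoidHom.comp_apply, natProj, FreeGroup.lift_apply_of, natGen]
      split_ifs with h
      · rw [PresentedGroup.toGroup.of]
      · rw [map_one, QuotientGroup.mk'_apply]
        refine ((QuotientGroup.eq_one_iff (N := natKer n) (FreeGroup.of i)).2 ?_).symm
        exact Subgroup.subset_normalClosure (Or.inr ⟨i, not_lt.1 h, rfl⟩)
    intro x hx
    rw [MonoidHom.mem_ker] at hx
    have h3 := DFunLike.congr_fun h2 x
    rw [MonoidHom.comp_apply, hx, map_one, QuotientGroup.mk'_apply] at h3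
    exact (QuotientGroup.eq_one_iff _).1 h3.symm
  · refine Subgroup.normalClosure_le_normal ?_
    rintro x (⟨h1, h2⟩ | ⟨i, hi, rfl⟩)
    · obtain ⟨g, rfl⟩ := exists_map_val h1
      rw [toWord_map_val, encode_map_val] at h2
      rw [SetLike.mem_coe, MonoidHom.mem_ker, natProj_map]
      exact PresentedGroup.one_of_mem h2
    · simp [natProj, natGen, MonoidHom.mem_ker, not_lt.2 hi]

/-- The endomorphism given by a finite list of images. -/
def listHom (u : List (FreeGroup ℕ)) : FreeGroup ℕ →* FreeGroup ℕ :=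
  FreeGroup.lift fun i => u.getD i 1

lemma exists_listHom {n m : ℕ} (e : PGrp n →* PGrp m) :
    ∃ u, ∀ x, natProj m (listHom u x) = e (natProj n x) := by
  choose f hf using fun i => natProj_surjective m (e (natGen n i))
  refine ⟨(List.range n.unpair.1).map f, fun x => ?_⟩
  have : (natProj m).comp (listHom ((List.range n.unpair.1).map f)) = e.comp (natProj n) := by
    refine FreeGroup.ext_hom _ _ fun i => ?_
    rw [MonoidHom.comp_apply, MonoidHom.comp_apply, listHom, FreeGroup.lift_apply_of]
    by_cases h : i < n.unpair.1
    · rw [List.getD_eq_getElem _ _ (by simpa using h), List.getElem_map, List.getElem_range, hf]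
      simp [natProj]
    · rw [List.getD_eq_default _ _ (by simpa using h)]
      simp [natProj, natGen, h]
  exact DFunLike.congr_fun this x

lemma groupIsoFG_iff {n m : ℕ} : GroupIsoFG n m ↔ ∃ p : List (FreeGroup ℕ) × List (FreeGroup ℕ),
    ∀ x, (x ∈ natKer n → listHom p.1 x ∈ natKer m) ∧ (x ∈ natKer m → listHom p.2 x ∈ natKer n) ∧
      listHom p.2 (listHom p.1 x) * x⁻¹ ∈ natKer n ∧
      listHom p.1 (listHom p.2 x) * x⁻¹ ∈ natKer m := by
  simp only [← natProj_ker, MonoidHom.mem_ker, map_mul, map_inv, mul_inv_eq_one]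
  constructor
  · rintro ⟨e⟩
    obtain ⟨u, hu⟩ := exists_listHom (n := n) (m := m) e.toMonoidHom
    obtain ⟨v, hv⟩ := exists_listHom (n := m) (m := n) e.symm.toMonoidHom
    have hu : ∀ x, natProj m (listHom u x) = e (natProj n x) := hu
    have hv : ∀ x, natProj n (listHom v x) = e.symm (natProj m x) := hv
    exact ⟨(u, v), fun x => ⟨fun h => by simp [hu, h], fun h => by simp [hv, h], by simp [hu, hv],
      by simp [hu, hv]⟩⟩
  · rintro ⟨⟨u, v⟩, h⟩
    have h1 : (natProj n).ker ≤ ((natProj m).comp (listHom u)).ker := fun x hx => (h x).1 hx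
    have h2 : (natProj m).ker ≤ ((natProj n).comp (listHom v)).ker := fun x hx => (h x).2.1 hx
    set α := (natProj n).liftOfSurjective (natProj_surjective n) ⟨_, h1⟩
    set β := (natProj m).liftOfSurjective (natProj_surjective m) ⟨_, h2⟩
    have hα : ∀ x, α (natProj n x) = natProj m (listHom u x) := fun x =>
      MonoidHom.liftOfRightInverse_comp_apply _ _ _ _ x
    have hβ : ∀ x, β (natProj m x) = natProj n (listHom v x) := fun x =>
      MonoidHom.liftOfRightInverse_comp_apply _ _ _ _ x
    refine ⟨MonoidHom.toMulEquiv α β ?_ ?_⟩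
    · refine MonoidHom.ext fun y => ?_
      obtain ⟨x, rfl⟩ := natProj_surjective n y
      simpa [hα, hβ] using (h x).2.2.1
    · refine MonoidHom.ext fun y => ?_
      obtain ⟨x, rfl⟩ := natProj_surjective m y
      simpa [hα, hβ] using (h x).2.2.2

lemma mem_normalClosure_iff {G : Type} [Group G] {s : Set G} {x : G} :
    x ∈ Subgroup.normalClosure s ↔ ∃ l : List (G × G × Bool), (∀ p ∈ l, p.2.1 ∈ s) ∧
      (l.map fun p => p.1 * signed p.2.1 p.2.2 * p.1⁻¹).prod = x := by
  constructor
  · intro hx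
    induction hx using Subgroup.closure_induction with
    | mem x hx =>
      obtain ⟨r, hr, hc⟩ := Group.mem_conjugatesOfSet_iff.1 hx
      obtain ⟨c, rfl⟩ := isConj_iff.1 hc
      exact ⟨[(c, r, true)], by simpa using hr, by simp [signed]⟩
    | one => exact ⟨[], by simp, rfl⟩
    | mul x y _ _ hx hy =>
      obtain ⟨l, h1, rfl⟩ := hx
      obtain ⟨l', h1', rfl⟩ := hy
      refine ⟨l ++ l', fun p hp => ?_, by simp⟩
      exact (List.mem_append.1 hp).elim (h1 p) (h1' p)
    | inv x _ hx =>
      obtain ⟨l, h1, rfl⟩ := hx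
      refine ⟨(l.map fun p => (p.1, p.2.1, !p.2.2)).reverse, fun p hp => ?_, ?_⟩
      · rw [List.mem_reverse, List.mem_map] at hp
        obtain ⟨q, hq, rfl⟩ := hp
        exact h1 q hq
      · rw [List.prod_inv_reverse, List.map_reverse, List.map_map, List.map_map]
        congr 2
        refine List.map_congr_left fun p _ => ?_
        rcases p with ⟨c, r, _ | _⟩ <;> simp [signed, mul_assoc]
  · rintro ⟨l, hl, rfl⟩
    refine Subgroup.list_prod_mem _ fun y hy => ?_
    obtain ⟨⟨c, r, b⟩, hp, rfl⟩ := List.mem_map.1 hy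
    have : r ∈ Subgroup.normalClosure s := Subgroup.subset_normalClosure (hl _ hp)
    refine Subgroup.normalClosure_normal.conj_mem _ ?_ _
    cases b
    · exact Subgroup.inv_mem _ this
    · exact this

end UniversalPresentation

section UpperBound

open Primrec

lemma ce_natRel : CE fun y : ℕ × FreeGroup ℕ => y.2 ∈ natRel y.1 := by
  have hk : Primrec fun y : ℕ × FreeGroup ℕ => y.1.unpair.1 := fst.comp (unpair.comp fst)
  have hw : Primrec fun y : ℕ × FreeGroup ℕ => y.2.toWord := primrec_toWord.comp snd
  refine CE.or (.and ?_ ?_) ?_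
  · refine CE.forall_mem (f := fun y : ℕ × FreeGroup ℕ => y.2.toWord)
      (p := fun y p => p.1 < y.1.unpair.1) (.of_primrecPred ?_) hw
    exact nat_lt.comp (fst.comp snd) (hk.comp fst)
  · exact ce_mem_domain.comp (f := fun y : ℕ × FreeGroup ℕ =>
      (y.1.unpair.2, Encodable.encode y.2.toWord))
      (Primrec.pair (snd.comp (unpair.comp fst)) (Primrec.encode.comp hw))
  · refine CE.exists (p := fun (y : ℕ × FreeGroup ℕ) i => y.1.unpair.1 ≤ i ∧ y.2 = FreeGroup.of i)
      (.of_primrecPred (.and ?_ ?_))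
    · exact nat_le.comp (hk.comp fst) snd
    · exact Primrec.eq.comp (snd.comp fst) (primrec_of.comp snd)

lemma ce_natKer : CE fun y : ℕ × FreeGroup ℕ => y.2 ∈ natKer y.1 := by
  refine CE.of_eq ?_ fun y => mem_normalClosure_iff.symm
  refine CE.exists (p := fun (y : ℕ × FreeGroup ℕ) (l : List (FreeGroup ℕ × FreeGroup ℕ × Bool)) =>
    (∀ p ∈ l, p.2.1 ∈ natRel y.1) ∧
      (l.map fun p => p.1 * signed p.2.1 p.2.2 * p.1⁻¹).prod = y.2) (.and ?_ (.of_primrecPred ?_))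
  · refine CE.forall_mem (f := fun y : (ℕ × FreeGroup ℕ) × List (FreeGroup ℕ × FreeGroup ℕ × Bool) =>
      y.2) (p := fun y p => p.2.1 ∈ natRel y.1.1) ?_ snd
    exact ce_natRel.comp (f := fun x : ((ℕ × FreeGroup ℕ) ×
      List (FreeGroup ℕ × FreeGroup ℕ × Bool)) × (FreeGroup ℕ × FreeGroup ℕ × Bool) =>
      (x.1.1.1, x.2.2.1)) (Primrec.pair (fst.comp (fst.comp fst)) (fst.comp (snd.comp snd)))
  · refine Primrec.eq.comp (primrec_list_prod.comp (list_map snd ?_)) (snd.comp fst)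
    exact primrec_mul.comp (primrec_mul.comp (fst.comp snd) (primrec_signed.comp
      (fst.comp (snd.comp snd)) (snd.comp (snd.comp snd)))) (primrec_inv.comp (fst.comp snd))

lemma primrec_listHom : Primrec₂ fun (u : List (FreeGroup ℕ)) x => listHom u x :=
  primrec_lift (f := fun (u : List (FreeGroup ℕ)) i => u.getD i 1) (list_getD 1)

lemma isSigma03_of_ce {α β : Type} [Primcodable α] [Primcodable β] {p : ℕ → α → β → Prop}
    (hp : CE fun y : (ℕ × α) × β => p y.1.1 y.1.2 y.2) : IsSigma03 {n | ∃ a, ∀ b, p n a b} := by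
  have hl : Primrec fun o : Option β => o.toList :=
    (option_casesOn .id (const []) (list_cons.comp snd (const [])).to₂).of_eq fun o => by
      cases o <;> rfl
  have h : CE fun y : ℕ × ℕ × ℕ => ∃ a, Encodable.decode y.2.1 = some a ∧
      ∀ b ∈ (Encodable.decode (α := β) y.2.2).toList, p y.1 a b := by
    refine CE.exists (p := fun (y : ℕ × ℕ × ℕ) a => Encodable.decode y.2.1 = some a ∧
      ∀ b ∈ (Encodable.decode (α := β) y.2.2).toList, p y.1 a b) (.and (.of_primrecPred ?_) ?_)
    · exact Primrec.eq.comp (Primrec.decode.comp (fst.comp (snd.comp fst))) (option_some.comp snd)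
    · refine CE.forall_mem (f := fun y : (ℕ × ℕ × ℕ) × α =>
        (Encodable.decode (α := β) y.1.2.2).toList) (p := fun y b => p y.1.1 y.2 b) ?_
        (hl.comp (Primrec.decode.comp (snd.comp (snd.comp fst))))
      exact hp.comp (f := fun x : ((ℕ × ℕ × ℕ) × α) × β => ((x.1.1.1, x.1.2), x.2))
        (Primrec.pair (Primrec.pair (fst.comp (fst.comp fst)) (snd.comp fst)) snd)
  obtain ⟨r, hr, hr'⟩ := h
  refine ⟨fun n x y z => r (n, x, y) z, ?_, fun n => ?_⟩
  · exact (hr.comp (Primrec.pair fst (Primrec.pair (fst.comp snd) (fst.comp (snd.comp snd))))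
      (snd.comp (snd.comp snd))).to_comp
  · have hr' : ∀ x y, _ ↔ ∃ z, r (n, x, y) z = true := fun x y => hr' (n, x, y)
    simp only [← hr', Set.mem_ofPred_eq]
    constructor
    · rintro ⟨a, ha⟩
      exact ⟨Encodable.encode a, fun y => ⟨a, Encodable.encodek a, fun b _ => ha b⟩⟩
    · rintro ⟨x, hx⟩
      obtain ⟨a, ha, -⟩ := hx 0
      refine ⟨a, fun b => ?_⟩
      obtain ⟨a', ha', hb⟩ := hx (Encodable.encode b)
      rw [ha, Option.some_inj] at ha'
      subst ha'
      exact hb b (by simp)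

lemma groupIsoFG_iff_exists_forall {q : ℕ × FreeGroup ℕ → ℕ → Bool}
    (hq : ∀ y : ℕ × FreeGroup ℕ, y.2 ∈ natKer y.1 ↔ ∃ t, q y t = true) (n m : ℕ) :
    GroupIsoFG n m ↔ ∃ p : List (FreeGroup ℕ) × List (FreeGroup ℕ),
      ∀ x : FreeGroup ℕ × ℕ, (q (n, x.1) x.2 = true → listHom p.1 x.1 ∈ natKer m) ∧
      (q (m, x.1) x.2 = true → listHom p.2 x.1 ∈ natKer n) ∧
      listHom p.2 (listHom p.1 x.1) * x.1⁻¹ ∈ natKer n ∧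
      listHom p.1 (listHom p.2 x.1) * x.1⁻¹ ∈ natKer m := by
  rw [groupIsoFG_iff]
  refine exists_congr fun p => ⟨fun h x => ?_, fun h x => ?_⟩
  · obtain ⟨h1, h2, h3⟩ := h x.1
    exact ⟨fun hx => h1 ((hq (n, x.1)).2 ⟨_, hx⟩), fun hx => h2 ((hq (m, x.1)).2 ⟨_, hx⟩), h3⟩
  · refine ⟨fun hx => ?_, fun hx => ?_, (h (x, 0)).2.2⟩
    · obtain ⟨t, ht⟩ := (hq (n, x)).1 hx
      exact (h (x, t)).1 ht
    · obtain ⟨t, ht⟩ := (hq (m, x)).1 hx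
      exact (h (x, t)).2.1 ht

lemma CE.mem_natKer {α : Type} [Primcodable α] {f : α → ℕ} {g : α → FreeGroup ℕ}
    (hf : Primrec f) (hg : Primrec g) : CE fun y => g y ∈ natKer (f y) :=
  ce_natKer.comp (f := fun y => (f y, g y)) (Primrec.pair hf hg)

lemma ce_forward {α : Type} [Primcodable α] {q : ℕ × FreeGroup ℕ → ℕ → Bool}
    (hq : Primrec₂ q) {n m : α → ℕ} {u : α → List (FreeGroup ℕ)} {x : α → FreeGroup ℕ}
    {t : α → ℕ} (hn : Primrec n) (hm : Primrec m) (hu : Primrec u) (hx : Primrec x)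
    (ht : Primrec t) :
    CE fun y => q (n y, x y) (t y) = true → listHom (u y) (x y) ∈ natKer (m y) :=
  CE.imp (Primrec.eq.comp (hq.comp (Primrec.pair hn hx) ht) (const true))
    (CE.mem_natKer hm (primrec_listHom.comp hu hx))

lemma ce_inverse {α : Type} [Primcodable α] {n : α → ℕ} {u v : α → List (FreeGroup ℕ)}
    {x : α → FreeGroup ℕ} (hn : Primrec n) (hu : Primrec u) (hv : Primrec v) (hx : Primrec x) :
    CE fun y => listHom (v y) (listHom (u y) (x y)) * (x y)⁻¹ ∈ natKer (n y) :=
  CE.mem_natKer hn (primrec_mul.comp (primrec_listHom.comp hv (primrec_listHom.comp hu hx))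
    (primrec_inv.comp hx))

theorem sigma03Rel_groupIsoFG : Sigma03Rel GroupIsoFG := by
  obtain ⟨q, hq, hq'⟩ := ce_natKer
  have hn : Primrec fun y : (ℕ × List (FreeGroup ℕ) × List (FreeGroup ℕ)) × FreeGroup ℕ × ℕ =>
    y.1.1.unpair.1 := fst.comp (unpair.comp (fst.comp fst))
  have hm : Primrec fun y : (ℕ × List (FreeGroup ℕ) × List (FreeGroup ℕ)) × FreeGroup ℕ × ℕ =>
    y.1.1.unpair.2 := snd.comp (unpair.comp (fst.comp fst))
  have hu : Primrec fun y : (ℕ × List (FreeGroup ℕ) × List (FreeGroup ℕ)) × FreeGroup ℕ × ℕ =>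
    y.1.2.1 := fst.comp (snd.comp fst)
  have hv : Primrec fun y : (ℕ × List (FreeGroup ℕ) × List (FreeGroup ℕ)) × FreeGroup ℕ × ℕ =>
    y.1.2.2 := snd.comp (snd.comp fst)
  have hx : Primrec fun y : (ℕ × List (FreeGroup ℕ) × List (FreeGroup ℕ)) × FreeGroup ℕ × ℕ =>
    y.2.1 := fst.comp snd
  have ht : Primrec fun y : (ℕ × List (FreeGroup ℕ) × List (FreeGroup ℕ)) × FreeGroup ℕ × ℕ =>
    y.2.2 := snd.comp snd
  have h := (ce_forward hq hn hm hu hx ht).and ((ce_forward hq hm hn hv hx ht).and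
    ((ce_inverse hn hu hv hx).and (ce_inverse hm hv hu hx)))
  have h := isSigma03_of_ce (p := fun a (p : List (FreeGroup ℕ) × List (FreeGroup ℕ))
    (x : FreeGroup ℕ × ℕ) =>
      (q (a.unpair.1, x.1) x.2 = true → listHom p.1 x.1 ∈ natKer a.unpair.2) ∧
      (q (a.unpair.2, x.1) x.2 = true → listHom p.2 x.1 ∈ natKer a.unpair.1) ∧
      listHom p.2 (listHom p.1 x.1) * x.1⁻¹ ∈ natKer a.unpair.1 ∧
      listHom p.1 (listHom p.2 x.1) * x.1⁻¹ ∈ natKer a.unpair.2) h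
  unfold Sigma03Rel
  convert h using 2
  ext a
  exact groupIsoFG_iff_exists_forall hq' _ _

end UpperBound

lemma equivalence_groupIsoFG : Equivalence GroupIsoFG :=
  ⟨fun _ => ⟨MulEquiv.refl _⟩, fun ⟨e⟩ => ⟨e.symm⟩, fun ⟨e⟩ ⟨f⟩ => ⟨e.trans f⟩⟩

end FGIso

/-- The isomorphism problem for finitely generated recursively presented groups is a
Σ⁰₃-complete equivalence relation. -/
theorem isomorphismProblem_finitelyGenerated_Sigma03Complete :
    Equivalence GroupIsoFG ∧ Sigma03Rel GroupIsoFG ∧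
      ∀ E : ℕ → ℕ → Prop, Equivalence E → Sigma03Rel E → ComputableReduction E GroupIsoFG :=
  ⟨FGIso.equivalence_groupIsoFG, FGIso.sigma03Rel_groupIsoFG, fun _ hE hS => FGIso.hardness hE hS⟩
end

section
/- The shift equivalence relation U on indices of c.e. subsets of ℤ, defined by i U j iff there is an integer n with V_i = V_j + n, is a Σ⁰₃-complete equivalence relation: U is Σ⁰₃ (as a subset of ℕ² under a computable pairing) and every Σ⁰₃ equivalence relation on ℕ computably reduces to U. -/
/-- The induced uniform enumeration of all c.e. subsets of `ℤ`: `V i` is the image in `ℤ`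
of the `i`-th c.e. subset of `ℕ` under the fixed computable bijection `ℕ ≃ ℤ`. -/
def V (i : ℕ) : Set ℤ := {m : ℤ | Encodable.encode m ∈ W i}

/-- The shift equivalence relation `U` on indices of c.e. subsets of `ℤ`:
`i U j` iff `V i = V j + n` for some integer `n`. -/
def shiftEquiv (i j : ℕ) : Prop := ∃ n : ℤ, V i = (fun m => m + n) '' V j

namespace ShiftEquiv

/-- A node is a pair `(l, a)`, thought of as the binary string of length `l` whose big-endian value
is `a`. The node `σ` is to the left of `τ` if at the first position where they differ `σ` has
digit one. -/
def Left (σ τ : ℕ × ℕ) : Prop := τ.2 / 2 ^ (τ.1 - σ.1) < σ.2 / 2 ^ (σ.1 - τ.1)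

instance : DecidableRel Left := fun σ τ => by unfold Left; infer_instance

theorem not_left_self (σ : ℕ × ℕ) : ¬ Left σ σ := by simp [Left]

theorem not_left_parent (l a : ℕ) : ¬ Left (l + 1, a) (l, a / 2) := by simp [Left]

theorem left_of_left_parent {σ : ℕ × ℕ} {l b : ℕ} (h : Left σ (l, b / 2)) :
    Left σ (l + 1, b) := by
  obtain ⟨k, a⟩ := σ
  simp only [Left] at *
  rcases le_or_gt k l with hk | hk
  · rw [Nat.div_div_eq_div_mul, ← pow_succ'] at h
    rw [show l + 1 - k = l - k + 1 by omega, show k - (l + 1) = k - l by omega]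
    exact h
  · obtain ⟨d, rfl⟩ := Nat.exists_eq_add_of_lt hk
    rw [show l + d + 1 - l = d + 1 by omega, pow_succ, ← Nat.div_div_eq_div_mul,
      show l - (l + d + 1) = 0 by omega, pow_zero, Nat.div_one] at h
    rw [show l + 1 - (l + d + 1) = 0 by omega, show l + d + 1 - (l + 1) = d by omega, pow_zero,
      Nat.div_one]
    omega

theorem left_of_parent_left {τ : ℕ × ℕ} {l a : ℕ} (h : Left (l, a / 2) τ) :
    Left (l + 1, a) τ := by
  obtain ⟨k, b⟩ := τ
  simp only [Left] at *
  rcases le_or_gt k l with hk | hk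
  · rw [Nat.div_div_eq_div_mul, ← pow_succ'] at h
    rw [show l + 1 - k = l - k + 1 by omega, show k - (l + 1) = k - l by omega]
    exact h
  · obtain ⟨d, rfl⟩ := Nat.exists_eq_add_of_lt hk
    rw [show l + d + 1 - l = d + 1 by omega, pow_succ, ← Nat.div_div_eq_div_mul,
      show l - (l + d + 1) = 0 by omega, pow_zero, Nat.div_one] at h
    rw [show l + 1 - (l + d + 1) = 0 by omega, show l + d + 1 - (l + 1) = d by omega, pow_zero,
      Nat.div_one]
    omega

/-- `Below σ τ` says that `σ` is an initial segment of `τ`. -/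
inductive Below (σ : ℕ × ℕ) : ℕ × ℕ → Prop
  | refl : Below σ σ
  | step {l a : ℕ} : Below σ (l, a / 2) → Below σ (l + 1, a)

theorem below_iff {σ τ : ℕ × ℕ} : Below σ τ ↔ σ.1 ≤ τ.1 ∧ τ.2 / 2 ^ (τ.1 - σ.1) = σ.2 := by
  constructor
  · intro h
    induction h with
    | refl => simp
    | @step l a _ ih =>
      simp only [Nat.div_div_eq_div_mul, ← pow_succ'] at ih ⊢
      rw [show l + 1 - σ.1 = l - σ.1 + 1 by omega]
      exact ⟨by omega, ih.2⟩
  · obtain ⟨k, a⟩ := σ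
    obtain ⟨l, b⟩ := τ
    rintro ⟨h1, h2⟩
    obtain ⟨d, rfl⟩ := Nat.exists_eq_add_of_le h1
    simp only [Nat.add_sub_cancel_left] at h2
    subst h2
    clear h1
    induction d generalizing b with
    | zero => simpa using Below.refl
    | succ d ih =>
      have := Below.step (ih (b / 2))
      rwa [Nat.div_div_eq_div_mul, ← pow_succ'] at this

theorem below_or_below {σ τ : ℕ × ℕ} (h1 : ¬ Left σ τ) (h2 : ¬ Left τ σ) :
    Below σ τ ∨ Below τ σ := by
  obtain ⟨k, a⟩ := σ
  obtain ⟨l, b⟩ := τ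
  have h := le_antisymm (not_lt.1 h1) (not_lt.1 h2)
  rcases le_total k l with hk | hk
  · left
    rw [below_iff]
    rw [Nat.sub_eq_zero_of_le hk] at h
    simpa [hk] using h.symm
  · right
    rw [below_iff]
    rw [Nat.sub_eq_zero_of_le hk] at h
    simpa [hk] using h

/-- The representative of the class of `i` after merging, for each digit one of the node `(l, a)`
in position `k`, the classes of the two numbers coded by the first component of `k`. -/
def cls : ℕ → ℕ → ℕ → ℕ
  | 0, _, i => i
  | l + 1, a, i =>
    if a % 2 = 1 ∧ cls l (a / 2) i = cls l (a / 2) l.unpair.1.unpair.1 then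
      cls l (a / 2) l.unpair.1.unpair.2
    else cls l (a / 2) i

theorem cls_spec (l a i : ℕ) : (i < l → cls l a i < l) ∧ (l ≤ i → cls l a i = i) := by
  induction l generalizing a i with
  | zero => simp [cls]
  | succ l ih =>
    have hx : l.unpair.1.unpair.1 ≤ l :=
      (Nat.unpair_left_le _).trans (Nat.unpair_left_le _)
    have hy : l.unpair.1.unpair.2 ≤ l :=
      (Nat.unpair_right_le _).trans (Nat.unpair_left_le _)
    have h : ∀ j ≤ l, cls l (a / 2) j ≤ l := by
      intro j hj
      rcases hj.lt_or_eq with hj | rfl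
      · exact ((ih (a / 2) j).1 hj).le
      · exact ((ih (a / 2) j).2 le_rfl).le
    have h1 := h _ hx
    have h2 := h _ hy
    refine ⟨fun hi => ?_, fun hi => ?_⟩
    · have h3 := h i (by omega)
      rw [cls]
      split_ifs <;> omega
    · have h3 := (ih (a / 2) i).2 (by omega)
      rw [cls, if_neg (by omega), h3]

theorem cls_le {l n i : ℕ} (a : ℕ) (hl : l ≤ n) (hi : i ≤ n) : cls l a i ≤ n := by
  rcases lt_or_ge i l with h | h
  · exact ((cls_spec l a i).1 h).le.trans hl
  · exact ((cls_spec l a i).2 h).trans_le hi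

theorem lt_of_cls_eq {l a i j : ℕ} (h : cls l a i = cls l a j) (hij : i ≠ j) : j < l := by
  by_contra hj
  rw [not_lt] at hj
  rw [(cls_spec l a j).2 hj] at h
  rcases lt_or_ge i l with hi | hi
  · have := (cls_spec l a i).1 hi
    omega
  · rw [(cls_spec l a i).2 hi] at h
    exact hij h

theorem cls_succ_eq {l a i j : ℕ} (h : cls l (a / 2) i = cls l (a / 2) j) :
    cls (l + 1) a i = cls (l + 1) a j := by
  rw [cls, cls, h]

theorem cls_eq_of_below {σ τ : ℕ × ℕ} (h : Below σ τ) {i j : ℕ}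
    (hc : cls σ.1 σ.2 i = cls σ.1 σ.2 j) : cls τ.1 τ.2 i = cls τ.1 τ.2 j := by
  induction h with
  | refl => exact hc
  | step _ ih => exact cls_succ_eq ih

/-- A fast growing function. -/
def big : ℕ → ℕ
  | 0 => 1
  | n + 1 => 100 * (n + 2) * big n

theorem big_succ (n : ℕ) : big (n + 1) = 100 * (n + 2) * big n := rfl

theorem big_pos (n : ℕ) : 0 < big n := by
  induction n with
  | zero => simp [big]
  | succ n ih => rw [big_succ]; positivity

theorem lt_big (n : ℕ) : n < big n := by
  induction n with
  | zero => simp [big]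
  | succ n ih => rw [big_succ]; nlinarith [big_pos n]

theorem big_mono : Monotone big := by
  refine monotone_nat_of_le_succ fun n => ?_
  rw [big_succ]
  nlinarith [big_pos n]

section Construction

variable (v : ℕ → ℕ × ℕ)

/-- The stage at which the current incarnation of the node `σ` was born, as seen before stage `s`;
the value is zero if there is no such incarnation. The sequence `v` lists the visited nodes, and a
visit to a node kills all the nodes to its right. -/
def born (σ : ℕ × ℕ) : ℕ → ℕ
  | 0 => 0
  | s + 1 => if Left (v s) σ then 0 else if born σ s = 0 ∧ v s = σ then s + 1 else born σ s

/-- The shifts used to identify the columns in the same class of the node `(l, a)`. -/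
def pot : ℕ → ℕ → ℕ → ℕ → ℕ
  | 0, _, _, _ => 0
  | l + 1, a, s, i =>
    pot l (a / 2) s i + big (2 * born v (l + 1, a) s) * cls l (a / 2) i

/-- The relation saying that before stage `s` the integer `m` has been put into column `i`. -/
def Mem : ℕ → ℕ → ℤ → Prop
  | 0, _, _ => False
  | s + 1, i, m => ∃ i' m', (Mem s i' m' ∨ i' = (v s).1.unpair.1 ∧ m' = big (2 * s + 3)) ∧
      cls (v s).1 (v s).2 i' = cls (v s).1 (v s).2 i ∧
      m = m' - pot v (v s).1 (v s).2 (s + 1) i' + pot v (v s).1 (v s).2 (s + 1) i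

/-- Each node is visited immediately after itself or its parent. -/
def Admissible : Prop :=
  ∀ s l a, v s = (l + 1, a) → ∃ r, s = r + 1 ∧ (v r = (l + 1, a) ∨ v r = (l, a / 2))

variable {v}

theorem born_le (σ : ℕ × ℕ) (s : ℕ) : born v σ s ≤ s := by
  induction s with
  | zero => simp [born]
  | succ s ih => rw [born]; split_ifs <;> omega

theorem born_succ_pos_iff {σ : ℕ × ℕ} {s : ℕ} :
    0 < born v σ (s + 1) ↔ ¬ Left (v s) σ ∧ (0 < born v σ s ∨ v s = σ) := by
  rw [born]
  split_ifs with h1 h2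
  · simp [h1]
  · simp [h2, not_left_self]
  · have : v s = σ → 0 < born v σ s := fun h => by
      by_contra h0; exact h2 ⟨by omega, h⟩
    simp only [h1]
    tauto

theorem born_visited (s : ℕ) : 0 < born v (v s) (s + 1) :=
  born_succ_pos_iff.2 ⟨not_left_self _, Or.inr rfl⟩

theorem born_succ_eq {σ : ℕ × ℕ} {s : ℕ} (h : 0 < born v σ s) (h' : ¬ Left (v s) σ) :
    born v σ (s + 1) = born v σ s := by
  rw [born, if_neg h', if_neg (by omega)]

theorem born_succ_cases {σ : ℕ × ℕ} {s : ℕ} (h : 0 < born v σ (s + 1)) :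
    (0 < born v σ s ∧ born v σ (s + 1) = born v σ s) ∨
      (born v σ s = 0 ∧ v s = σ ∧ born v σ (s + 1) = s + 1) := by
  have h1 := (born_succ_pos_iff.1 h).1
  rw [born, if_neg h1] at *
  split_ifs at * with h2
  · exact Or.inr ⟨h2.1, h2.2, rfl⟩
  · exact Or.inl ⟨h, rfl⟩

theorem born_const {σ : ℕ × ℕ} {s t : ℕ} (h : 0 < born v σ s) (h1 : born v σ s ≤ t) (h2 : t ≤ s) :
    born v σ t = born v σ s := by
  induction s with
  | zero => simp [born] at h
  | succ s ih =>
    rcases h2.lt_or_eq with h2 | rfl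
    · rcases born_succ_cases h with ⟨h3, h4⟩ | ⟨_, _, h4⟩
      · rw [h4] at h1 ⊢
        exact ih h3 h1 (by omega)
      · omega
    · rfl

theorem exists_eq_visited {σ : ℕ × ℕ} {s : ℕ} (h : 0 < born v σ s) :
    ∃ r, born v σ s = r + 1 ∧ v r = σ := by
  induction s with
  | zero => simp [born] at h
  | succ s ih =>
    rcases born_succ_cases h with ⟨h3, h4⟩ | ⟨_, h5, h4⟩
    · rw [h4]; exact ih h3
    · exact ⟨s, h4, h5⟩

theorem Admissible.level_le (hv : Admissible v) (s : ℕ) : (v s).1 ≤ s := by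
  induction s with
  | zero =>
    rcases h : v 0 with ⟨_ | l, a⟩
    · exact le_rfl
    · obtain ⟨r, hr, -⟩ := hv 0 l a h
      omega
  | succ s ih =>
    rcases h : v (s + 1) with ⟨_ | l, a⟩
    · exact Nat.zero_le _
    · obtain ⟨r, hr, h1⟩ := hv (s + 1) l a h
      obtain rfl : s = r := by omega
      rcases h1 with h1 | h1 <;> rw [h1] at ih <;> simp only at * <;> omega

theorem Admissible.level_lt_born (hv : Admissible v) {σ : ℕ × ℕ} {s : ℕ} (h : 0 < born v σ s) :
    σ.1 < born v σ s := by
  obtain ⟨r, h1, rfl⟩ := exists_eq_visited h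
  have := hv.level_le r
  omega

theorem Admissible.born_parent (hv : Admissible v) {l a s : ℕ} (h : 0 < born v (l + 1, a) s) :
    0 < born v (l, a / 2) s ∧ born v (l, a / 2) s < born v (l + 1, a) s := by
  induction s with
  | zero => simp [born] at h
  | succ s ih =>
    have h0 : ¬ Left (v s) (l, a / 2) := fun h' =>
      (born_succ_pos_iff.1 h).1 (left_of_left_parent h')
    rcases born_succ_cases h with ⟨h1, h2⟩ | ⟨h1, h2, h3⟩
    · rw [h2, born_succ_eq (ih h1).1 h0]
      exact ih h1
    · obtain ⟨r, rfl, h4⟩ := hv s l a h2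
      have h5 := born_visited (v := v) r
      rcases h4 with h4 | h4
      · rw [h4] at h5; omega
      · rw [h4] at h5
        rw [born_succ_eq h5 h0, h3]
        exact ⟨h5, Nat.lt_succ_of_le (born_le _ _)⟩

theorem Admissible.born_below (hv : Admissible v) {σ τ : ℕ × ℕ} {s : ℕ} (h : Below σ τ)
    (hτ : 0 < born v τ s) : 0 < born v σ s ∧ (σ = τ ∨ born v σ s < born v τ s) := by
  induction h with
  | refl => exact ⟨hτ, Or.inl rfl⟩
  | step _ ih =>
    have h1 := hv.born_parent hτ
    have h2 := ih h1.1
    refine ⟨h2.1, Or.inr ?_⟩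
    rcases h2.2 with rfl | h2
    · exact h1.2
    · exact h2.trans h1.2

/-- Of two living nodes the older one is not to the right of the younger one. -/
theorem not_left_of_born_le {σ τ : ℕ × ℕ} {s : ℕ} (hσ : 0 < born v σ s) (hτ : 0 < born v τ s)
    (h : born v σ s ≤ born v τ s) : ¬ Left τ σ := by
  obtain ⟨r, h1, rfl⟩ := exists_eq_visited hτ
  intro hl
  have h2 := born_const hσ h (born_le _ _)
  rw [h1, born, if_pos hl] at h2
  omega

theorem Admissible.pot_succ (hv : Admissible v) {l a s : ℕ} (h : 0 < born v (l, a) s)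
    (h' : ¬ Left (v s) (l, a)) (i : ℕ) : pot v l a (s + 1) i = pot v l a s i := by
  induction l generalizing a with
  | zero => rfl
  | succ l ih =>
    rw [pot, pot, born_succ_eq h h',
      ih (hv.born_parent h).1 fun h2 => h' (left_of_left_parent h2)]

theorem Admissible.pot_const (hv : Admissible v) {σ : ℕ × ℕ} {s t : ℕ} (h : 0 < born v σ s)
    (h1 : born v σ s ≤ t) (h2 : t ≤ s) (i : ℕ) : pot v σ.1 σ.2 t i = pot v σ.1 σ.2 s i := by
  induction s with
  | zero => simp [born] at h
  | succ s ih =>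
    rcases h2.lt_or_eq with h2 | rfl
    · rcases born_succ_cases h with ⟨h3, h4⟩ | ⟨_, _, h4⟩
      · rw [hv.pot_succ h3 (born_succ_pos_iff.1 h).1]
        exact ih h3 (by omega) (by omega)
      · omega
    · rfl

theorem pot_below {σ τ : ℕ × ℕ} (h : Below σ τ) {i j s : ℕ}
    (hc : cls σ.1 σ.2 i = cls σ.1 σ.2 j) :
    pot v τ.1 τ.2 s i + pot v σ.1 σ.2 s j = pot v τ.1 τ.2 s j + pot v σ.1 σ.2 s i := by
  induction h with
  | refl => exact add_comm _ _
  | step h ih =>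
    have h1 := cls_eq_of_below h hc
    simp only at h1 ih
    simp only [pot, h1]
    omega

theorem Admissible.pot_le (hv : Admissible v) {l a s n i : ℕ} (h : 0 < born v (l, a) s)
    (hl : l ≤ n) (hi : i ≤ n) : pot v l a s i ≤ 2 * n * big (2 * born v (l, a) s) := by
  induction l generalizing a with
  | zero => simp [pot]
  | succ l ih =>
    have h1 := hv.born_parent h
    have h2 := ih h1.1 (by omega)
    have h3 : big (2 * born v (l, a / 2) s + 1) ≤ big (2 * born v (l + 1, a) s) :=
      big_mono (by omega)
    have h4 := cls_le (a / 2) (show l ≤ n by omega) hi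
    rw [big_succ] at h3
    have h5 : 2 * big (2 * born v (l, a / 2) s) ≤ big (2 * born v (l + 1, a) s) := by nlinarith
    rw [pot]
    have h6 := Nat.mul_le_mul_left (big (2 * born v (l + 1, a) s)) h4
    have h7 := Nat.mul_le_mul_left n h5
    nlinarith

theorem Admissible.pot_le_stage (hv : Admissible v) {σ : ℕ × ℕ} {s i : ℕ} (h : 0 < born v σ s)
    (hi : i ≤ s) : pot v σ.1 σ.2 s i ≤ 2 * s * big (2 * s) := by
  obtain ⟨l, a⟩ := σ
  have h1 := born_le (v := v) (l, a) s
  have h2 : l < born v (l, a) s := hv.level_lt_born h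
  refine (hv.pot_le (n := s) h (by omega) hi).trans ?_
  exact Nat.mul_le_mul_left _ (big_mono (by omega))

theorem Mem.mono {s t i : ℕ} {m : ℤ} (h : Mem v s i m) (hst : s ≤ t) : Mem v t i m := by
  induction t, hst using Nat.le_induction with
  | base => exact h
  | succ t _ ih => exact ⟨i, m, Or.inl ih, rfl, by ring⟩

theorem Mem.visited {s i j : ℕ} {m : ℤ} (h : Mem v (s + 1) i m)
    (hc : cls (v s).1 (v s).2 i = cls (v s).1 (v s).2 j) :
    Mem v (s + 1) j
      (m - pot v (v s).1 (v s).2 (s + 1) i + pot v (v s).1 (v s).2 (s + 1) j) := by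
  obtain ⟨i', m', h1, h2, rfl⟩ := h
  exact ⟨i', m', h1, h2.trans hc, by ring⟩

theorem Mem.born (hv : Admissible v) {σ : ℕ × ℕ} {s i j : ℕ} {m : ℤ} (hσ : 0 < born v σ s)
    (h : Mem v (born v σ s) i m) (hc : cls σ.1 σ.2 i = cls σ.1 σ.2 j) :
    Mem v (ShiftEquiv.born v σ s) j (m - pot v σ.1 σ.2 s i + pot v σ.1 σ.2 s j) := by
  rw [← hv.pot_const hσ le_rfl (born_le _ _), ← hv.pot_const hσ le_rfl (born_le _ _)]
  obtain ⟨r, h1, rfl⟩ := exists_eq_visited hσ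
  rw [h1] at h ⊢
  exact h.visited hc

theorem Admissible.mem_bound (hv : Admissible v) {s i : ℕ} {m : ℤ} (h : Mem v s i m) :
    i < s ∧ |m| ≤ 2 * big (2 * s + 1) := by
  induction s generalizing i m with
  | zero => exact h.elim
  | succ s ih =>
    obtain ⟨i', m', h1, h2, h3⟩ := h
    have hl := hv.level_le s
    have hi' : i' ≤ s ∧ |m'| ≤ big (2 * s + 3) := by
      rcases h1 with h1 | ⟨rfl, rfl⟩
      · refine ⟨(ih h1).1.le, (ih h1).2.trans ?_⟩
        have h4 : big (2 * s + 1 + 1) ≤ big (2 * s + 3) := big_mono (by omega)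
        rw [big_succ] at h4
        have : 2 * big (2 * s + 1) ≤ big (2 * s + 3) := by nlinarith
        exact_mod_cast this
      · refine ⟨(Nat.unpair_left_le _).trans hl, ?_⟩
        simp
    have hi : i ≤ s := by
      rcases eq_or_ne i' i with rfl | hne
      · exact hi'.1
      · exact (lt_of_cls_eq h2 hne).le.trans hl
    refine ⟨by omega, ?_⟩
    have h5 := hv.pot_le_stage (born_visited (v := v) s) (show i ≤ s + 1 by omega)
    have h6 := hv.pot_le_stage (born_visited (v := v) s) (show i' ≤ s + 1 by omega)
    have h7 : 2 * (s + 1) * big (2 * (s + 1)) ≤ big (2 * (s + 1) + 1) := by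
      rw [big_succ]; nlinarith [big_pos (2 * (s + 1))]
    have h8 := abs_le.1 hi'.2
    rw [show 2 * s + 3 = 2 * (s + 1) + 1 by ring] at h8
    rw [abs_le]
    zify at h5 h6 h7
    constructor <;> linarith [h8.1, h8.2]

set_option maxHeartbeats 1000000 in
theorem Admissible.mem_old_or_large (hv : Admissible v) {σ : ℕ × ℕ} {s i : ℕ} {m : ℤ}
    (hσ : 0 < born v σ s) (h : Mem v s i m) :
    Mem v (born v σ s) i m ∨ 3 * (big (2 * born v σ s + 1) : ℤ) < |m - pot v σ.1 σ.2 s i| := by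
  induction s generalizing σ i m with
  | zero => exact h.elim
  | succ s ih =>
    rcases born_succ_cases hσ with ⟨hσ', hb⟩ | ⟨_, _, hb⟩
    swap
    · left; rwa [hb]
    have hnl := (born_succ_pos_iff.1 hσ).1
    rw [hb, hv.pot_succ hσ' hnl]
    have ht := born_le (v := v) σ s
    have his := (hv.mem_bound h).1
    have hpi := hv.pot_le_stage hσ' (show i ≤ s by omega)
    obtain ⟨i', m', h1, hc, hm⟩ := h
    have hl := hv.level_le s
    have hπ := born_visited (v := v) s
    have hP := hv.pot_le_stage hπ (show i ≤ s + 1 by omega)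
    rcases h1 with h1 | ⟨rfl, rfl⟩
    swap
    · right
      have hi' : (v s).1.unpair.1 ≤ s + 1 := (Nat.unpair_left_le _).trans (by omega)
      have hP' := hv.pot_le_stage hπ hi'
      have e1 : big (2 * born v σ s + 1) ≤ big (2 * (s + 1)) := big_mono (by omega)
      have e2 : big (2 * s) ≤ big (2 * (s + 1)) := big_mono (by omega)
      have e3 : big (2 * s + 3) = 100 * (2 * (s + 1) + 2) * big (2 * (s + 1)) := big_succ _
      have e4 : 2 * s * big (2 * s) ≤ 2 * (s + 1) * big (2 * (s + 1)) :=
        Nat.mul_le_mul (by omega) e2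
      have e5 := big_pos (2 * (s + 1))
      refine lt_of_lt_of_le ?_ (le_abs_self _)
      rw [hm, e3]
      zify at hP hP' hpi e1 e4 e5
      push_cast
      nlinarith
    rcases eq_or_ne i' i with rfl | hne
    · obtain rfl : m = m' := by rw [hm]; ring
      exact ih hσ' h1
    have hi := lt_of_cls_eq hc hne
    have hi' := lt_of_cls_eq hc.symm hne.symm
    rcases born_succ_cases hπ with ⟨hπ', -⟩ | ⟨hπ0, -, hπb⟩
    · rw [hv.pot_succ hπ' (not_left_self _), hv.pot_succ hπ' (not_left_self _)] at hm
      rcases ih hπ' h1 with h2 | h2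
      · have h3 := h2.born hv hπ' hc
        rw [← hm] at h3
        exact ih hσ' (h3.mono (born_le _ _))
      rcases le_or_gt (born v (v s) s) (born v σ s) with hut | htu
      · have hbelow : Below (v s) σ := by
          rcases below_or_below hnl (not_left_of_born_le hπ' hσ' hut) with h3 | h3
          · exact h3
          · rcases (hv.born_below h3 hπ').2 with h4 | h4
            · rw [h4]; exact Below.refl
            · omega
        have h3 := pot_below (v := v) (s := s) hbelow hc
        zify at h3
        rcases ih hσ' h1 with h4 | h4
        · left
          convert h4.born hv hσ' (cls_eq_of_below hbelow hc) using 1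
          rw [hm]; linarith
        · right
          convert h4 using 2
          rw [hm]; linarith
      · right
        set u := born v (v s) s
        have hlu := hv.level_lt_born hπ'
        have h3 := hv.pot_le (n := u) hπ' hlu.le (show i ≤ u by omega)
        have h5 := hv.pot_le (n := u) hσ' ((hv.level_lt_born hσ').le.trans htu.le)
          (show i ≤ u by omega)
        have e1 : big (2 * born v σ s) ≤ big (2 * u) := big_mono (by omega)
        have e2 : big (2 * born v σ s + 1) ≤ big (2 * u) := big_mono (by omega)
        have e3 := big_succ (2 * u)
        have e4 := Nat.mul_le_mul_left (2 * u) e1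
        have e5 := big_pos (2 * u)
        change pot v (v s).1 (v s).2 s i ≤ _ at h3
        change pot v σ.1 σ.2 s i ≤ _ at h5
        zify at h3 h5 e1 e2 e3 e4 e5
        have h6 : (3 : ℤ) * big (2 * u + 1) - 4 * u * big (2 * u)
            ≤ |m - pot v σ.1 σ.2 s i| := by
          have h7 : m' - pot v (v s).1 (v s).2 s i' =
            (m - pot v σ.1 σ.2 s i) + (pot v σ.1 σ.2 s i - pot v (v s).1 (v s).2 s i) := by
              rw [hm]; ring
          have h8 : |(pot v σ.1 σ.2 s i - pot v (v s).1 (v s).2 s i : ℤ)|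
              ≤ 4 * u * big (2 * u) := by
            rw [abs_le]; constructor <;> nlinarith
          rw [h7] at h2
          have := abs_add_le (m - pot v σ.1 σ.2 s i)
            (pot v σ.1 σ.2 s i - pot v (v s).1 (v s).2 s i : ℤ)
          linarith
        refine lt_of_lt_of_le ?_ h6
        rw [e3]
        nlinarith
    · rcases hvs : v s with ⟨_ | l, a⟩
      · rw [hvs] at hi; exact absurd hi (Nat.not_lt_zero _)
      rw [hvs] at hc hm hπ0 hπb hi hi' hl
      simp only at hi hi' hl hc hm
      obtain ⟨r, rfl, h2⟩ := hv s l a hvs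
      have h3 := born_visited (v := v) r
      rcases h2 with h2 | h2
      · rw [h2] at h3; omega
      have hpar : 0 < born v (l, a / 2) (r + 1) := by rwa [h2] at h3
      have hps := hv.pot_succ hpar (by rw [hvs]; exact not_left_parent l a)
      rw [pot, pot, hps, hps, hπb] at hm
      by_cases hc' : cls l (a / 2) i' = cls l (a / 2) i
      · have h4 := h1.visited (j := i) (by rw [h2]; exact hc')
        rw [h2] at h4
        apply ih hσ'
        convert h4 using 1
        rw [hm, hc']; push_cast; ring
      · right
        have h5 := hv.pot_le_stage hpar (show i ≤ r + 1 by omega)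
        have h6 := hv.pot_le_stage hpar (show i' ≤ r + 1 by omega)
        have h7 := abs_le.1 (hv.mem_bound h1).2
        set s := r + 1
        have e1 : big (2 * born v σ s + 1) ≤ big (2 * s + 1) := big_mono (by omega)
        have e2 : big (2 * (s + 1)) = 100 * (2 * s + 3) * big (2 * s + 1) := big_succ _
        have e3 : 2 * s * big (2 * s) ≤ big (2 * s + 1) := by
          rw [big_succ]; nlinarith [big_pos (2 * s)]
        have e4 := big_pos (2 * s + 1)
        have e5 := big_pos (2 * (s + 1))
        simp only at h5 h6
        zify at h5 h6 e1 e2 e3 e4 e5 hpi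
        have e6 : 20 * (big (2 * s + 1) : ℤ) ≤ big (2 * (s + 1)) := by
          rw [e2]; nlinarith
        push_cast at hm
        rcases Nat.lt_or_gt_of_ne hc' with h8 | h8
        · have h9 : (cls l (a / 2) i' : ℤ) + 1 ≤ cls l (a / 2) i := by exact_mod_cast h8
          refine lt_of_lt_of_le ?_ (le_abs_self _)
          have h10 := mul_le_mul_of_nonneg_left h9 e5.le
          linarith [h7.1, h7.2]
        · have h9 : (cls l (a / 2) i : ℤ) + 1 ≤ cls l (a / 2) i' := by exact_mod_cast h8
          refine lt_of_lt_of_le ?_ (neg_le_abs _)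
          have h10 := mul_le_mul_of_nonneg_left h9 e5.le
          linarith [h7.1, h7.2]

theorem Admissible.mem_shift (hv : Admissible v) {σ : ℕ × ℕ} {t : ℕ} (ht : 0 < t)
    (hσ : ∀ s ≥ t, born v σ s = t) (hvis : ∀ s, ∃ r ≥ s, v r = σ) {s i j : ℕ} {m : ℤ}
    (hc : cls σ.1 σ.2 i = cls σ.1 σ.2 j) (h : Mem v s i m) :
    ∃ s', Mem v s' j (m - pot v σ.1 σ.2 t i + pot v σ.1 σ.2 t j) := by
  obtain ⟨r, hr, rfl⟩ := hvis (max s t)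
  refine ⟨r + 1, ?_⟩
  have h1 := hσ (r + 1) (by omega)
  rw [hv.pot_const (s := r + 1) (t := t) (by omega) (by omega) (by omega),
    hv.pot_const (s := r + 1) (t := t) (by omega) (by omega) (by omega)]
  exact (h.mono (by omega)).visited hc

theorem Admissible.exists_not_mem (hv : Admissible v) {σ : ℕ × ℕ} {t : ℕ} (ht : 0 < t)
    (hσ : ∀ s ≥ t, born v σ s = t) {i j : ℕ} {n : ℤ} (hi : σ.1.unpair.1 = i)
    (hn : |n| ≤ σ.1) (hj : j ≤ σ.1) (hc : cls σ.1 σ.2 i ≠ cls σ.1 σ.2 j) :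
    ∃ m, (∃ s, Mem v s i m) ∧ ¬ ∃ s, Mem v s j (m - n) := by
  have hbt := hσ t le_rfl
  obtain ⟨r, h1, hr⟩ := exists_eq_visited (v := v) (σ := σ) (s := t) (by omega)
  obtain rfl : t = r + 1 := by omega
  have hl : σ.1 ≤ r := by rw [← hr]; exact hv.level_le r
  refine ⟨big (2 * r + 3), ⟨r + 1, i, big (2 * r + 3), Or.inr ⟨by rw [hr, hi], rfl⟩, rfl,
    by ring⟩, ?_⟩
  rintro ⟨s, hs⟩
  replace hs := hs.mono (le_max_left s (r + 1))
  have hb := hσ _ (le_max_right s (r + 1))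
  set s' := max s (r + 1)
  have hp := hv.pot_le (l := σ.1) (a := σ.2) (s := s') (n := r + 1) (i := j)
    (show 0 < born v σ s' by omega) (by omega) (by omega)
  rw [show born v (σ.1, σ.2) s' = r + 1 from hb] at hp
  have e0 : r + 1 < big (2 * (r + 1)) := lt_of_le_of_lt (by omega) (lt_big _)
  have e1 : big (2 * r + 3) = 100 * (2 * (r + 1) + 2) * big (2 * (r + 1)) := big_succ _
  have e2 : 2 * big (2 * r + 1) ≤ big (2 * (r + 1)) := by
    have e3 : big (2 * (r + 1)) = 100 * (2 * r + 1 + 2) * big (2 * r + 1) := big_succ _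
    nlinarith [big_pos (2 * r + 1)]
  have e3 := big_pos (2 * (r + 1))
  have hn' := abs_le.1 hn
  rcases hv.mem_old_or_large (σ := σ) (by omega) hs with h2 | h2
  · rw [hb] at h2
    obtain ⟨i', m', h3, h4, h5⟩ := h2
    rw [hr] at h3 h4 h5
    rcases h3 with h3 | ⟨rfl, rfl⟩
    swap
    · rw [hi] at h4
      exact hc h4
    have h6 := hv.mem_bound h3
    have h7 := hv.pot_le_stage (σ := σ) (s := r + 1) (i := j) (by omega) (by omega)
    have h8 := abs_le.1 h6.2
    zify at hl e0 e1 e2 e3 h7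
    have h9 : (0 : ℤ) ≤ pot v σ.1 σ.2 (r + 1) i' := by positivity
    nlinarith [h8.2, hn'.2]
  · rw [hb] at h2
    refine absurd h2 (not_lt.2 ?_)
    zify at hl e0 e1 e2 e3 hp
    have h9 : (0 : ℤ) ≤ pot v σ.1 σ.2 s' j := by positivity
    rw [show 2 * (r + 1) + 1 = 2 * r + 3 by ring, e1, abs_le]
    constructor <;> nlinarith [hn'.1, hn'.2]

theorem exists_stable {σ : ℕ × ℕ}
    (hvis : ∀ s, ∃ r ≥ s, v r = σ) (hleft : ∃ s₀, ∀ s ≥ s₀, ¬ Left (v s) σ) :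
    ∃ t, 0 < t ∧ ∀ s ≥ t, born v σ s = t := by
  obtain ⟨s₀, hs₀⟩ := hleft
  obtain ⟨r, hr, hvr⟩ := hvis s₀
  have hpos := born_visited (v := v) r
  rw [hvr] at hpos
  refine ⟨born v σ (r + 1), hpos, fun s hs => ?_⟩
  rcases le_total s (r + 1) with h | h
  · exact born_const hpos hs h
  · induction s, h using Nat.le_induction with
    | base => rfl
    | succ s h ih =>
      have h1 := ih ((born_le _ _).trans h)
      rw [born_succ_eq (by omega) (hs₀ s (by omega)), h1]

end Construction

section TruePath

variable (P : ℕ → ℕ → ℕ → Bool)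

/-- The digits one of the node `(l, a)` look correct up to `y` when witnesses below `z` are
allowed. -/
def Verified (l a y z : ℕ) : Prop :=
  ∀ k < l, a / 2 ^ (l - 1 - k) % 2 = 1 → ∀ y' < y, ∃ z' < z, P k y' z' = true

/-- The number `z` is the least one for which the node `(l, a)` is verified up to `y`. -/
def Fresh (l a y z : ℕ) : Prop :=
  l ≤ y ∧ a < 2 ^ l ∧ Verified P l a y z ∧ (z = 0 ∨ ¬ Verified P l a y (z - 1))

open Classical in
/-- The node whose initial segments are visited in the `r`-th block of stages. -/
noncomputable def base (r : ℕ) : ℕ × ℕ :=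
  if Fresh P r.unpair.1 r.unpair.2.unpair.1 r.unpair.2.unpair.2.unpair.1
      r.unpair.2.unpair.2.unpair.2 then
    (r.unpair.1, r.unpair.2.unpair.1)
  else (0, 0)

/-- The node visited at stage `q`. -/
noncomputable def visit (q : ℕ) : ℕ × ℕ :=
  (min (q - q.sqrt * q.sqrt) (base P q.sqrt).1,
    (base P q.sqrt).2 / 2 ^ ((base P q.sqrt).1 - min (q - q.sqrt * q.sqrt) (base P q.sqrt).1))

open Classical in
/-- The true path. -/
noncomputable def truePath : ℕ → ℕ
  | 0 => 0
  | l + 1 => 2 * truePath l + if ∀ y, ∃ z, P l y z = true then 1 else 0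

variable {P}

theorem sqrt_mul_add {s k : ℕ} (h : k ≤ 2 * s) : (s * s + k).sqrt = s := by
  rw [Nat.sqrt_add_eq _ (by omega)]

theorem visit_admissible : Admissible (visit P) := by
  intro q l a h
  simp only [visit, Prod.mk.injEq] at h
  obtain ⟨h1, h2⟩ := h
  have h3 := Nat.sqrt_le q
  have h4 := Nat.sqrt_le_add q
  set s := q.sqrt
  obtain ⟨k, hk⟩ : ∃ k, q = s * s + (k + 1) := ⟨q - s * s - 1, by omega⟩
  refine ⟨s * s + k, by omega, ?_⟩
  have h5 : (s * s + k).sqrt = s := sqrt_mul_add (by omega)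
  rw [show q - s * s = k + 1 by omega] at h1 h2
  simp only [visit, h5, Nat.add_sub_cancel_left, Prod.mk.injEq]
  rw [h1] at h2
  rcases le_or_gt (base P s).1 k with h6 | h6
  · left
    rw [show min k (base P s).1 = l + 1 by omega]
    exact ⟨rfl, h2⟩
  · right
    rw [show min k (base P s).1 = l by omega]
    refine ⟨rfl, ?_⟩
    rw [← h2, Nat.div_div_eq_div_mul, ← pow_succ]
    congr 2
    omega

theorem truePath_succ_div (l : ℕ) : truePath P (l + 1) / 2 = truePath P l := by
  rw [truePath]; split_ifs <;> omega

theorem truePath_succ_mod (l : ℕ) :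
    truePath P (l + 1) % 2 = 1 ↔ ∀ y, ∃ z, P l y z = true := by
  rw [truePath]; split_ifs with h
  · exact ⟨fun _ => h, fun _ => by omega⟩
  · exact ⟨fun h' => by omega, fun h' => absurd h' h⟩

theorem truePath_lt (l : ℕ) : truePath P l < 2 ^ l := by
  induction l with
  | zero => simp [truePath]
  | succ l ih => rw [truePath, pow_succ]; split_ifs <;> omega

theorem truePath_add_div (k d : ℕ) : truePath P (k + d) / 2 ^ d = truePath P k := by
  induction d with
  | zero => simp
  | succ d ih =>
    rw [pow_succ', ← Nat.div_div_eq_div_mul, ← add_assoc, truePath_succ_div, ih]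

theorem Verified.mono {l a y z z' : ℕ} (h : Verified P l a y z) (hz : z ≤ z') :
    Verified P l a y z' := by
  intro k hk hd y' hy'
  obtain ⟨w, hw, h1⟩ := h k hk hd y' hy'
  exact ⟨w, hw.trans_le hz, h1⟩

theorem exists_verified_truePath (l y : ℕ) : ∃ z, Verified P l (truePath P l) y z := by
  have h : ∀ k y', ∃ z, (k < l ∧ truePath P l / 2 ^ (l - 1 - k) % 2 = 1) → P k y' z = true := by
    intro k y'
    by_cases hk : k < l ∧ truePath P l / 2 ^ (l - 1 - k) % 2 = 1
    · have h1 : l = k + 1 + (l - 1 - k) := by omega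
      have h2 := hk.2
      nth_rw 1 [h1] at h2
      rw [truePath_add_div, truePath_succ_mod] at h2
      obtain ⟨z, hz⟩ := h2 y'
      exact ⟨z, fun _ => hz⟩
    · exact ⟨0, fun h => absurd h hk⟩
  choose f hf using h
  refine ⟨(∑ k ∈ Finset.range l, ∑ y' ∈ Finset.range y, f k y') + 1, fun k hk hd y' hy' =>
    ⟨f k y', Nat.lt_succ_of_le ?_, hf k y' ⟨hk, hd⟩⟩⟩
  exact (Finset.single_le_sum (f := fun y' => f k y') (fun _ _ => Nat.zero_le _)
    (Finset.mem_range.2 hy')).trans (Finset.single_le_sum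
      (f := fun k => ∑ y' ∈ Finset.range y, f k y') (fun _ _ => Nat.zero_le _)
      (Finset.mem_range.2 hk))

theorem truePath_visited (l s : ℕ) : ∃ r ≥ s, visit P r = (l, truePath P l) := by
  classical
  have hz := exists_verified_truePath (P := P) l (max l s)
  set z := Nat.find hz
  have hfresh : Fresh P l (truePath P l) (max l s) z := by
    refine ⟨le_max_left _ _, truePath_lt l, Nat.find_spec hz, ?_⟩
    rcases Nat.eq_zero_or_pos z with h | h
    · exact Or.inl h
    · exact Or.inr (Nat.find_min hz (by omega))
  set r := Nat.pair l (Nat.pair (truePath P l) (Nat.pair (max l s) z)) with hr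
  have hb : base P r = (l, truePath P l) := by
    simp [base, hr, hfresh]
  have hy : max l s ≤ r :=
    (Nat.left_le_pair _ _).trans ((Nat.right_le_pair _ _).trans (Nat.right_le_pair _ _))
  have hq : (r * r + l).sqrt = r := sqrt_mul_add (by omega)
  refine ⟨r * r + l, ?_, ?_⟩
  · have := Nat.le_mul_self r
    omega
  · simp [visit, hq, hb]

theorem exists_digit_of_truePath_lt {n L a : ℕ} (hn : n ≤ L) (ha : a < 2 ^ L)
    (h : truePath P n < a / 2 ^ (L - n)) :
    ∃ k < n, a / 2 ^ (L - 1 - k) % 2 = 1 ∧ ¬ ∀ y, ∃ z, P k y z = true := by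
  induction n with
  | zero =>
    rw [Nat.sub_zero, Nat.div_eq_of_lt ha] at h
    omega
  | succ n ih =>
    have h1 : a / 2 ^ (L - n) = a / 2 ^ (L - 1 - n) / 2 := by
      rw [Nat.div_div_eq_div_mul, ← pow_succ]
      congr 2
      omega
    rw [show L - (n + 1) = L - 1 - n by omega] at h
    by_cases h2 : truePath P n < a / 2 ^ (L - n)
    · obtain ⟨k, hk, h3⟩ := ih (by omega) h2
      exact ⟨k, by omega, h3⟩
    · have h3 := truePath_succ_mod (P := P) n
      have h4 := truePath_succ_div (P := P) n
      refine ⟨n, by omega, by omega, fun h5 => ?_⟩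
      have := h3.2 h5
      omega

theorem left_of_below_left {σ σ' τ : ℕ × ℕ} (h : Below σ σ') (hl : Left σ τ) : Left σ' τ := by
  induction h with
  | refl => exact hl
  | step _ ih => exact left_of_parent_left ih

theorem below_visit (q : ℕ) : Below (visit P q) (base P q.sqrt) := by
  rw [below_iff]
  exact ⟨min_le_right _ _, rfl⟩

theorem Fresh.unique {l a y z z' : ℕ} (h : Fresh P l a y z) (h' : Fresh P l a y z') :
    z = z' := by
  rcases lt_trichotomy z z' with h1 | h1 | h1
  · rcases h'.2.2.2 with h2 | h2
    · omega
    · exact absurd (h.2.2.1.mono (by omega)) h2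
  · exact h1
  · rcases h.2.2.2 with h2 | h2
    · omega
    · exact absurd (h'.2.2.1.mono (by omega)) h2

theorem finite_fresh (n : ℕ) : {r : ℕ | Fresh P r.unpair.1 r.unpair.2.unpair.1
    r.unpair.2.unpair.2.unpair.1 r.unpair.2.unpair.2.unpair.2 ∧
      r.unpair.2.unpair.2.unpair.1 ≤ n}.Finite := by
  refine Set.Finite.of_finite_image (f := fun r => (r.unpair.1, r.unpair.2.unpair.1,
    r.unpair.2.unpair.2.unpair.1)) ?_ ?_
  · refine ((Set.finite_Iic n).prod ((Set.finite_Iic (2 ^ n)).prod (Set.finite_Iic n))).subset ?_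
    rintro _ ⟨r, ⟨⟨h1, h2, -⟩, h3⟩, rfl⟩
    have h4 := h1.trans h3
    exact ⟨h4, (h2.trans_le (Nat.pow_le_pow_right (by norm_num) h4)).le, h3⟩
  · rintro r ⟨h1, -⟩ r' ⟨h1', -⟩ h
    simp only [Prod.mk.injEq] at h
    obtain ⟨e1, e2, e3⟩ := h
    rw [e1, e2, e3] at h1
    have e4 := h1.unique h1'
    rw [← Nat.pair_unpair r, ← Nat.pair_unpair r', ← Nat.pair_unpair r.unpair.2,
      ← Nat.pair_unpair r'.unpair.2, ← Nat.pair_unpair r.unpair.2.unpair.2,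
      ← Nat.pair_unpair r'.unpair.2.unpair.2, e1, e2, e3, e4]

theorem truePath_not_left (l : ℕ) : ∃ s₀, ∀ s ≥ s₀, ¬ Left (visit P s) (l, truePath P l) := by
  have h : ∀ k, ∃ y, (¬ ∀ y, ∃ z, P k y z = true) → ∀ z, ¬ P k y z = true := by
    intro k
    by_cases hk : ∀ y, ∃ z, P k y z = true
    · exact ⟨0, fun h => absurd hk h⟩
    · push Not at hk
      obtain ⟨y, hy⟩ := hk
      exact ⟨y, fun _ => hy⟩
  choose f hf using h
  obtain ⟨b, hb⟩ := (finite_fresh (P := P) (∑ k ∈ Finset.range l, f k)).bddAbove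
  refine ⟨(b + 1) * (b + 1), fun s hs hl => ?_⟩
  have h1 := left_of_below_left (below_visit s) hl
  have h2 : b + 1 ≤ s.sqrt := Nat.le_sqrt.2 hs
  rw [base] at h1
  split_ifs at h1 with h3
  swap
  · simp [Left] at h1
  have h5 : ∃ k < l, k < s.sqrt.unpair.1 ∧
      s.sqrt.unpair.2.unpair.1 / 2 ^ (s.sqrt.unpair.1 - 1 - k) % 2 = 1 ∧
      ¬ ∀ y, ∃ z, P k y z = true := by
    simp only [Left] at h1
    rcases le_total s.sqrt.unpair.1 l with h6 | h6
    · obtain ⟨d, hd⟩ := Nat.exists_eq_add_of_le h6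
      rw [hd, Nat.add_sub_cancel_left, truePath_add_div] at h1
      obtain ⟨k, hk, h7⟩ := exists_digit_of_truePath_lt le_rfl h3.2.1 (by simpa using h1)
      exact ⟨k, by omega, hk, h7⟩
    · rw [Nat.sub_eq_zero_of_le h6, pow_zero, Nat.div_one] at h1
      obtain ⟨k, hk, h7⟩ := exists_digit_of_truePath_lt h6 h3.2.1 h1
      exact ⟨k, hk, by omega, h7⟩
  obtain ⟨k, hk, hk', hd, hT⟩ := h5
  have h6 : s.sqrt.unpair.2.unpair.2.unpair.1 ≤ f k := by
    by_contra h7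
    obtain ⟨z', -, h8⟩ := h3.2.2.1 k hk' hd (f k) (by omega)
    exact hf k hT z' h8
  have h7 := hb ⟨h3, h6.trans (Finset.single_le_sum (f := f) (fun _ _ => Nat.zero_le _)
    (Finset.mem_range.2 hk))⟩
  omega

theorem truePath_stable (l : ℕ) :
    ∃ t, 0 < t ∧ ∀ s ≥ t, born (visit P) (l, truePath P l) s = t :=
  exists_stable (truePath_visited l) (truePath_not_left l)

variable {E : ℕ → ℕ → Prop}

theorem rel_cls_truePath (hE : Equivalence E)
    (hP : ∀ i j, E i j ↔ ∃ x, ∀ y, ∃ z, P (Nat.pair (Nat.pair i j) x) y z = true) (l i : ℕ) :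
    E i (cls l (truePath P l) i) := by
  induction l generalizing i with
  | zero => exact hE.refl i
  | succ l ih =>
    simp only [cls, truePath_succ_div]
    split_ifs with h
    all_goals simp only [truePath_succ_mod] at h
    · have h1 : E l.unpair.1.unpair.1 l.unpair.1.unpair.2 :=
        (hP _ _).2 ⟨l.unpair.2, by simpa using h.1⟩
      have h2 := ih i
      rw [h.2] at h2
      exact hE.trans (hE.trans h2 (hE.symm (ih _))) (hE.trans h1 (ih _))
    · exact ih i

theorem rel_iff_exists_cls_eq (hE : Equivalence E)
    (hP : ∀ i j, E i j ↔ ∃ x, ∀ y, ∃ z, P (Nat.pair (Nat.pair i j) x) y z = true) {i j : ℕ} :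
    E i j ↔ ∃ l, cls l (truePath P l) i = cls l (truePath P l) j := by
  constructor
  · intro h
    obtain ⟨x, hx⟩ := (hP i j).1 h
    refine ⟨Nat.pair (Nat.pair i j) x + 1, ?_⟩
    simp only [cls, truePath_succ_div, Nat.unpair_pair]
    rw [if_pos ⟨(truePath_succ_mod _).2 hx, trivial⟩]
    split_ifs <;> rfl
  · rintro ⟨l, hl⟩
    have h1 := rel_cls_truePath hE hP l i
    rw [hl] at h1
    exact hE.trans h1 (hE.symm (rel_cls_truePath hE hP l j))

theorem rel_iff_exists_shift (hE : Equivalence E)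
    (hP : ∀ i j, E i j ↔ ∃ x, ∀ y, ∃ z, P (Nat.pair (Nat.pair i j) x) y z = true) (i j : ℕ) :
    E i j ↔ ∃ n : ℤ, ∀ m,
      (∃ s, Mem (visit P) s i m) ↔ ∃ s, Mem (visit P) s j (m - n) := by
  constructor
  · intro h
    obtain ⟨l, hl⟩ := (rel_iff_exists_cls_eq hE hP).1 h
    obtain ⟨t, ht, hσ⟩ := truePath_stable (P := P) l
    have hvis := truePath_visited (P := P) l
    refine ⟨pot (visit P) l (truePath P l) t i - pot (visit P) l (truePath P l) t j,
      fun m => ⟨?_, ?_⟩⟩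
    · rintro ⟨s, hs⟩
      obtain ⟨s', hs'⟩ := visit_admissible.mem_shift ht hσ hvis hl hs
      exact ⟨s', by convert hs' using 1; ring⟩
    · rintro ⟨s, hs⟩
      obtain ⟨s', hs'⟩ := visit_admissible.mem_shift ht hσ hvis hl.symm hs
      exact ⟨s', by convert hs' using 1; ring⟩
  · rintro ⟨n, hn⟩
    by_contra h
    obtain ⟨t, ht, hσ⟩ := truePath_stable (P := P) (Nat.pair i (j + n.natAbs))
    have hl := Nat.right_le_pair i (j + n.natAbs)
    obtain ⟨m, h1, h2⟩ := visit_admissible.exists_not_mem (i := i) (j := j) (n := n) ht hσ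
      (by simp) (by rw [Int.abs_eq_natAbs]; simp only; omega) (by simp only; omega)
      fun hc => h ((rel_iff_exists_cls_eq hE hP).2 ⟨_, hc⟩)
    exact h2 ((hn m).1 h1)

end TruePath

section Effective

open Primrec

theorem primrec_pow : Primrec₂ ((· ^ ·) : ℕ → ℕ → ℕ) :=
  Primrec₂.unpaired'.1 Nat.Primrec.pow

variable {α : Type*} [Primcodable α]

theorem primrecPred_forall_lt {n : α → ℕ} (hn : Primrec n) {R : α → ℕ → Prop}
    (hR : PrimrecPred fun p : α × ℕ => R p.1 p.2) : PrimrecPred fun b => ∀ x < n b, R b x :=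
  ((PrimrecRel.forall_mem_list (R := fun x b => R b x)
    (hR.comp (snd.pair fst))).comp (list_range.comp hn) Primrec.id).of_eq (by simp)

theorem primrecPred_exists_lt {n : α → ℕ} (hn : Primrec n) {R : α → ℕ → Prop}
    (hR : PrimrecPred fun p : α × ℕ => R p.1 p.2) : PrimrecPred fun b => ∃ x < n b, R b x :=
  ((PrimrecRel.exists_mem_list (R := fun x b => R b x)
    (hR.comp (snd.pair fst))).comp (list_range.comp hn) Primrec.id).of_eq (by simp)

theorem primrecPred_imp {p q : α → Prop} (hp : PrimrecPred p) (hq : PrimrecPred q) :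
    PrimrecPred fun a => p a → q a :=
  (hp.not.or hq).of_eq fun _ => imp_iff_not_or.symm

theorem primrec_unpair_fst : Primrec fun n : ℕ => n.unpair.1 := fst.comp unpair

theorem primrec_unpair_snd : Primrec fun n : ℕ => n.unpair.2 := snd.comp unpair

theorem primrec_big : Primrec big := by
  have h : Primrec₂ fun n b : ℕ => 100 * (n + 2) * b :=
    nat_mul.comp (nat_mul.comp (const 100) (nat_add.comp fst (const 2))) snd
  refine (nat_rec₁ 1 h).of_eq fun n => ?_
  induction n with
  | zero => rfl
  | succ n ih => rw [big_succ, ← ih]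

theorem primrec_truncate {f g h : α → ℕ} (hf : Primrec f) (hg : Primrec g) (hh : Primrec h) :
    Primrec fun x => f x / 2 ^ (g x - h x) :=
  nat_div.comp hf (primrec_pow.comp (const 2) (nat_sub.comp hg hh))

theorem primrecRel_left : PrimrecRel Left :=
  nat_lt.comp (primrec_truncate (snd.comp snd) (fst.comp snd) (fst.comp fst))
    (primrec_truncate (snd.comp fst) (fst.comp fst) (fst.comp snd))

/-- One step in the computation of the list of values of `cls`. -/
def clsStep (a k : ℕ) (T : List ℕ) : List ℕ :=
  T.map fun c => if a % 2 = 1 ∧ c = T.getD k.unpair.1.unpair.1 0 then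
    T.getD k.unpair.1.unpair.2 0 else c

theorem clsStep_range {n a k : ℕ} (h : k < n) :
    clsStep a k ((List.range n).map (cls k (a / 2))) = (List.range n).map (cls (k + 1) a) := by
  have hx : k.unpair.1.unpair.1 < n :=
    ((Nat.unpair_left_le _).trans (Nat.unpair_left_le _)).trans_lt h
  have hy : k.unpair.1.unpair.2 < n :=
    ((Nat.unpair_right_le _).trans (Nat.unpair_left_le _)).trans_lt h
  simp [clsStep, List.getD, hx, hy, cls, Function.comp_def]

theorem clsStep_rec {n l : ℕ} (a : ℕ) (h : l ≤ n) (k : ℕ) (hk : k ≤ l) :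
    (k.rec (List.range n) fun k T => clsStep (a / 2 ^ (l - (k + 1))) k T : List ℕ) =
      (List.range n).map (cls k (a / 2 ^ (l - k))) := by
  induction k with
  | zero => simp [cls]
  | succ k ih =>
    simp only
    rw [ih (by omega), ← clsStep_range (by omega), Nat.div_div_eq_div_mul, ← pow_succ,
      show l - (k + 1) + 1 = l - k by omega]

theorem primrec_clsStep : Primrec fun p : (ℕ × ℕ) × List ℕ => clsStep p.1.1 p.1.2 p.2 := by
  have h1 : Primrec fun p : ((ℕ × ℕ) × List ℕ) × ℕ => p.1.1.1 := fst.comp (fst.comp fst)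
  have h2 : Primrec fun p : ((ℕ × ℕ) × List ℕ) × ℕ => p.1.1.2.unpair.1 :=
    primrec_unpair_fst.comp (snd.comp (fst.comp fst))
  have h3 : Primrec fun p : ((ℕ × ℕ) × List ℕ) × ℕ => p.1.2 := snd.comp fst
  refine list_map snd (Primrec.ite ?_ ?_ snd)
  · exact (Primrec.eq.comp (nat_mod.comp h1 (const 2)) (const 1)).and
      (Primrec.eq.comp snd ((list_getD 0).comp h3 (primrec_unpair_fst.comp h2)))
  · exact (list_getD 0).comp h3 (primrec_unpair_snd.comp h2)

theorem primrec_cls {f g h : α → ℕ} (hf : Primrec f) (hg : Primrec g) (hh : Primrec h) :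
    Primrec fun x => cls (f x) (g x) (h x) := by
  have h1 : Primrec₂ fun (x : α) (p : ℕ × List ℕ) =>
      clsStep (g x / 2 ^ (f x - (p.1 + 1))) p.1 p.2 :=
    primrec_clsStep.comp (((primrec_truncate (hg.comp fst) (hf.comp fst)
      (succ.comp (fst.comp snd))).pair (fst.comp snd)).pair (snd.comp snd))
  have h2 := nat_rec' hf (list_range.comp (nat_add.comp (nat_add.comp hf hh) (const 1))) h1
  refine ((list_getD 0).comp h2 hh).of_eq fun x => ?_
  simp only
  rw [clsStep_rec (g x) (by omega) (f x) le_rfl]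
  simp [List.getD]

variable {v : ℕ → ℕ × ℕ}

theorem primrec_born (hv : Primrec v) {f : α → ℕ × ℕ} {g : α → ℕ} (hf : Primrec f)
    (hg : Primrec g) : Primrec fun x => born v (f x) (g x) := by
  have h1 : Primrec₂ fun (x : α) (p : ℕ × ℕ) =>
      if Left (v p.1) (f x) then 0 else if p.2 = 0 ∧ v p.1 = f x then p.1 + 1 else p.2 := by
    have hvp : Primrec fun q : α × ℕ × ℕ => v q.2.1 := hv.comp (fst.comp snd)
    have hfp : Primrec fun q : α × ℕ × ℕ => f q.1 := hf.comp fst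
    exact Primrec.ite (primrecRel_left.comp hvp hfp) (const 0)
      (Primrec.ite ((Primrec.eq.comp (snd.comp snd) (const 0)).and (Primrec.eq.comp hvp hfp))
        (succ.comp (fst.comp snd)) (snd.comp snd))
  refine (nat_rec' hg (const 0) h1).of_eq fun x => ?_
  induction g x with
  | zero => rfl
  | succ s ih => simp only [born, ← ih]

theorem primrec_pot (hv : Primrec v) {f g h e : α → ℕ} (hf : Primrec f) (hg : Primrec g)
    (hh : Primrec h) (he : Primrec e) : Primrec fun x => pot v (f x) (g x) (h x) (e x) := by
  have h1 : Primrec₂ fun (x : α) (p : ℕ × ℕ) =>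
      p.2 + big (2 * born v (p.1 + 1, g x / 2 ^ (f x - (p.1 + 1))) (h x)) *
        cls p.1 (g x / 2 ^ (f x - p.1)) (e x) := by
    have hk : Primrec fun q : α × ℕ × ℕ => q.2.1 := fst.comp snd
    have hk' : Primrec fun q : α × ℕ × ℕ => q.2.1 + 1 := succ.comp hk
    exact nat_add.comp (snd.comp snd) (nat_mul.comp
      (primrec_big.comp (nat_mul.comp (const 2) (primrec_born hv
        (hk'.pair (primrec_truncate (hg.comp fst) (hf.comp fst) hk')) (hh.comp fst))))
      (primrec_cls hk (primrec_truncate (hg.comp fst) (hf.comp fst) hk) (he.comp fst)))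
  have h2 : ∀ x k, k ≤ f x → (k.rec 0 fun k p =>
      p + big (2 * born v (k + 1, g x / 2 ^ (f x - (k + 1))) (h x)) *
        cls k (g x / 2 ^ (f x - k)) (e x) : ℕ) = pot v k (g x / 2 ^ (f x - k)) (h x) (e x) := by
    intro x k hk
    induction k with
    | zero => rfl
    | succ k ih =>
      simp only
      rw [ih (by omega), pot, Nat.div_div_eq_div_mul, ← pow_succ,
        show f x - (k + 1) + 1 = f x - k by omega]
  refine (nat_rec' hf (const 0) h1).of_eq fun x => ?_
  exact (h2 x (f x) le_rfl).trans (by simp)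

/-- The finite list of triples `(i, a, b)` such that `a - b` is in column `i` before stage `s`. -/
def stage (v : ℕ → ℕ × ℕ) : ℕ → List (ℕ × ℕ × ℕ)
  | 0 => []
  | s + 1 => (stage v s ++ [((v s).1.unpair.1, big (2 * s + 3), 0)]).flatMap fun e : ℕ × ℕ × ℕ =>
      (List.range (s + 1)).flatMap fun i =>
        if cls (v s).1 (v s).2 e.1 = cls (v s).1 (v s).2 i then
          [(i, e.2.1 + pot v (v s).1 (v s).2 (s + 1) i,
            e.2.2 + pot v (v s).1 (v s).2 (s + 1) e.1)]
        else []

theorem primrec_stage (hv : Primrec v) : Primrec (stage v) := by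
  have h1 : Primrec₂ fun (s : ℕ) (A : List (ℕ × ℕ × ℕ)) =>
      (A ++ [((v s).1.unpair.1, big (2 * s + 3), 0)]).flatMap fun e : ℕ × ℕ × ℕ =>
      (List.range (s + 1)).flatMap fun i =>
        if cls (v s).1 (v s).2 e.1 = cls (v s).1 (v s).2 i then
          [(i, e.2.1 + pot v (v s).1 (v s).2 (s + 1) i,
            e.2.2 + pot v (v s).1 (v s).2 (s + 1) e.1)]
        else [] := by
    refine list_flatMap (list_concat.comp snd ?_) (list_flatMap ?_ (Primrec.ite ?_ ?_ (const [])))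
    · exact (primrec_unpair_fst.comp (fst.comp (hv.comp fst))).pair
        ((primrec_big.comp (nat_add.comp (nat_mul.comp (const 2) fst) (const 3))).pair (const 0))
    · exact list_range.comp (succ.comp (fst.comp fst))
    all_goals
      have hs : Primrec fun p : ((ℕ × List (ℕ × ℕ × ℕ)) × ℕ × ℕ × ℕ) × ℕ => p.1.1.1 :=
        fst.comp (fst.comp fst)
      have he : Primrec fun p : ((ℕ × List (ℕ × ℕ × ℕ)) × ℕ × ℕ × ℕ) × ℕ => p.1.2 := snd.comp fst
      have hl := fst.comp (hv.comp hs)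
      have ha := snd.comp (hv.comp hs)
    · exact Primrec.eq.comp (primrec_cls hl ha (fst.comp he)) (primrec_cls hl ha snd)
    · exact list_cons.comp (snd.pair ((nat_add.comp (fst.comp (snd.comp he))
        (primrec_pot hv hl ha (succ.comp hs) snd)).pair (nat_add.comp (snd.comp (snd.comp he))
        (primrec_pot hv hl ha (succ.comp hs) (fst.comp he))))) (const [])
  refine (nat_rec₁ [] h1).of_eq fun s => ?_
  induction s with
  | zero => rfl
  | succ s ih => simp only [stage, ← ih]

theorem Admissible.mem_iff_stage (hv : Admissible v) {s i : ℕ} {m : ℤ} :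
    Mem v s i m ↔ ∃ e ∈ stage v s, e.1 = i ∧ (e.2.1 : ℤ) - e.2.2 = m := by
  induction s generalizing i m with
  | zero => simp [Mem, stage]
  | succ s ih =>
    constructor
    · intro h
      have hi := (hv.mem_bound h).1
      obtain ⟨i', m', h1, hc, rfl⟩ := h
      have h2 : ∃ e ∈ stage v s ++ [((v s).1.unpair.1, big (2 * s + 3), 0)], e.1 = i' ∧
          (e.2.1 : ℤ) - e.2.2 = m' := by
        rcases h1 with h1 | ⟨rfl, rfl⟩
        · obtain ⟨e, he, h3⟩ := ih.1 h1
          exact ⟨e, List.mem_append_left _ he, h3⟩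
        · exact ⟨_, List.mem_append_right _ (List.mem_singleton_self _), rfl, by simp⟩
      obtain ⟨e, he, rfl, rfl⟩ := h2
      refine ⟨(i, e.2.1 + pot v (v s).1 (v s).2 (s + 1) i,
          e.2.2 + pot v (v s).1 (v s).2 (s + 1) e.1),
        List.mem_flatMap.2 ⟨e, he, List.mem_flatMap.2 ⟨i, List.mem_range.2 hi, ?_⟩⟩, rfl, ?_⟩
      · rw [if_pos hc]
        exact List.mem_singleton_self _
      · push_cast; ring
    · rintro ⟨e, he, rfl, rfl⟩
      obtain ⟨e', he', h1⟩ := List.mem_flatMap.1 he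
      obtain ⟨i, -, h2⟩ := List.mem_flatMap.1 h1
      split_ifs at h2 with hc
      · obtain rfl := List.mem_singleton.1 h2
        refine ⟨e'.1, (e'.2.1 : ℤ) - e'.2.2, ?_, hc, by push_cast; ring⟩
        rcases List.mem_append.1 he' with h3 | h3
        · exact Or.inl (ih.2 ⟨e', h3, rfl, rfl⟩)
        · obtain rfl := List.mem_singleton.1 h3
          exact Or.inr ⟨rfl, by simp⟩
      · simp at h2

/-- The code of the integer `a - b`. -/
def subCode (a b : ℕ) : ℕ := if b ≤ a then 2 * (a - b) else 2 * (b - a - 1) + 1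

theorem encode_sub (a b : ℕ) : Encodable.encode ((a : ℤ) - b) = subCode a b := by
  rw [subCode]
  split_ifs with h
  · rw [← Nat.cast_sub h]
    rfl
  · obtain ⟨d, rfl⟩ := Nat.exists_eq_add_of_lt (not_le.1 h)
    rw [show (a : ℤ) - (a + d + 1 : ℕ) = Int.negSucc d by rw [Int.negSucc_eq]; push_cast; ring,
      show a + d + 1 - a - 1 = d by omega]
    rfl

theorem primrec_subCode {f g : α → ℕ} (hf : Primrec f) (hg : Primrec g) :
    Primrec fun x => subCode (f x) (g x) :=
  Primrec.ite (nat_le.comp hg hf) (nat_mul.comp (const 2) (nat_sub.comp hf hg))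
    (succ.comp (nat_mul.comp (const 2) (nat_sub.comp (nat_sub.comp hg hf) (const 1))))

theorem primrec_base {P : ℕ → ℕ → ℕ → Bool}
    (hP : Primrec fun p : ℕ × ℕ × ℕ => P p.1 p.2.1 p.2.2) : Primrec (base P) := by
  have hver : ∀ {f g h e : ℕ → ℕ}, Primrec f → Primrec g → Primrec h → Primrec e →
      PrimrecPred fun x => Verified P (f x) (g x) (h x) (e x) := by
    intro f g h e hf hg hh he
    refine primrecPred_forall_lt hf (primrecPred_imp ?_ (primrecPred_forall_lt (hh.comp fst)
      (primrecPred_exists_lt (he.comp (fst.comp fst)) ?_)))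
    · exact Primrec.eq.comp (nat_mod.comp (primrec_truncate (hg.comp fst)
        (nat_sub.comp (hf.comp fst) (const 1)) snd) (const 2)) (const 1)
    · exact Primrec.eq.comp (hP.comp ((snd.comp (fst.comp fst)).pair ((snd.comp fst).pair snd)))
        (const true)
  have hl := primrec_unpair_fst
  have ha := primrec_unpair_fst.comp primrec_unpair_snd
  have hy := primrec_unpair_fst.comp (primrec_unpair_snd.comp primrec_unpair_snd)
  have hz := primrec_unpair_snd.comp (primrec_unpair_snd.comp primrec_unpair_snd)
  classical
  refine Primrec.ite ?_ (hl.pair ha) (const (0, 0))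
  exact (nat_le.comp hl hy).and ((nat_lt.comp ha (primrec_pow.comp (const 2) hl)).and
    ((hver hl ha hy hz).and ((Primrec.eq.comp hz (const 0)).or
      (hver hl ha hy (nat_sub.comp hz (const 1))).not)))

theorem primrec_visit {P : ℕ → ℕ → ℕ → Bool}
    (hP : Primrec fun p : ℕ × ℕ × ℕ => P p.1 p.2.1 p.2.2) : Primrec (visit P) := by
  have hb := (primrec_base hP).comp nat_sqrt
  have hk := nat_min.comp (nat_sub.comp Primrec.id (nat_mul.comp nat_sqrt nat_sqrt))
    (fst.comp hb)
  exact hk.pair (primrec_truncate (snd.comp hb) (fst.comp hb) hk)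

end Effective

theorem mem_V_ofNat {i : ℕ} {m : ℤ} :
    m ∈ V i ↔ ((Denumerable.ofNat Nat.Partrec.Code i).eval (Encodable.encode m)).Dom := Iff.rfl

theorem shiftEquiv_iff {i j : ℕ} :
    shiftEquiv i j ↔ ∃ n : ℤ, ∀ m, m ∈ V i ↔ m - n ∈ V j := by
  refine exists_congr fun n => ?_
  rw [Set.ext_iff]
  refine forall_congr' fun m => iff_congr Iff.rfl ?_
  constructor
  · rintro ⟨k, hk, rfl⟩
    simpa using hk
  · intro h
    exact ⟨_, h, by simp⟩

theorem shiftEquiv_equivalence : Equivalence shiftEquiv where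
  refl i := shiftEquiv_iff.2 ⟨0, fun m => by simp⟩
  symm {i j} h := by
    obtain ⟨n, hn⟩ := shiftEquiv_iff.1 h
    refine shiftEquiv_iff.2 ⟨-n, fun m => ?_⟩
    rw [hn]
    simp
  trans {i j k} h h' := by
    obtain ⟨n, hn⟩ := shiftEquiv_iff.1 h
    obtain ⟨n', hn'⟩ := shiftEquiv_iff.1 h'
    refine shiftEquiv_iff.2 ⟨n + n', fun m => ?_⟩
    rw [hn, hn', sub_sub]

open Primrec Nat.Partrec in
theorem exists_reduction_of_primrec {E : ℕ → ℕ → Prop} (hE : Equivalence E)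
    {P : ℕ → ℕ → ℕ → Bool} (hprim : Primrec fun p : ℕ × ℕ × ℕ => P p.1 p.2.1 p.2.2)
    (hP : ∀ i j, E i j ↔ ∃ x, ∀ y, ∃ z, P (Nat.pair (Nat.pair i j) x) y z = true) :
    ComputableReduction E shiftEquiv := by
  classical
  have htest : PrimrecPred fun p : ℕ × ℕ => ∃ e ∈ stage (visit P) p.2,
      e.1 = p.1.unpair.1 ∧ subCode e.2.1 e.2.2 = p.1.unpair.2 := by
    have h1 : PrimrecRel fun (e : ℕ × ℕ × ℕ) (p : ℕ × ℕ) =>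
        e.1 = p.1.unpair.1 ∧ subCode e.2.1 e.2.2 = p.1.unpair.2 :=
      (Primrec.eq.comp (fst.comp fst) (primrec_unpair_fst.comp (fst.comp snd))).and
        (Primrec.eq.comp (primrec_subCode (fst.comp (snd.comp fst)) (snd.comp (snd.comp fst)))
          (primrec_unpair_snd.comp (fst.comp snd)))
    exact h1.exists_mem_list.comp ((primrec_stage (primrec_visit hprim)).comp snd) Primrec.id
  have hf : Primrec₂ fun k s : ℕ => if ∃ e ∈ stage (visit P) s,
      e.1 = k.unpair.1 ∧ subCode e.2.1 e.2.2 = k.unpair.2 then some 0 else none :=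
    Primrec.ite htest (const (some 0)) (const none)
  obtain ⟨c, hc⟩ := Code.exists_code.1 (Partrec.nat_iff.1 (Partrec.rfindOpt hf.to_comp))
  have hmem : ∀ i m, m ∈ V (Encodable.encode (c.curry i)) ↔ ∃ s, Mem (visit P) s i m := by
    intro i m
    rw [mem_V_ofNat, Denumerable.ofNat_encode, Code.eval_curry, hc, Nat.rfindOpt_dom]
    refine exists_congr fun s => ?_
    rw [visit_admissible.mem_iff_stage, Nat.unpair_pair]
    simp only [← encode_sub, Encodable.encode_inj]
    split_ifs with h
    · exact ⟨fun _ => h, fun _ => ⟨0, rfl⟩⟩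
    · exact ⟨fun h' => by simp at h', fun h' => absurd h' h⟩
  refine ⟨fun i => Encodable.encode (c.curry i),
    (Primrec.encode.comp (Code.primrec₂_curry.comp (const c) Primrec.id)).to_comp,
    fun i j => ?_⟩
  rw [shiftEquiv_iff, rel_iff_exists_shift hE hP]
  simp only [hmem]

open Primrec Nat.Partrec in
theorem exists_primrec_of_sigma03Rel {E : ℕ → ℕ → Prop} (h : Sigma03Rel E) :
    ∃ P : ℕ → ℕ → ℕ → Bool, (Primrec fun p : ℕ × ℕ × ℕ => P p.1 p.2.1 p.2.2) ∧
      ∀ i j, E i j ↔ ∃ x, ∀ y, ∃ z, P (Nat.pair (Nat.pair i j) x) y z = true := by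
  obtain ⟨R, hR, hE⟩ := h
  have h1 : Primrec fun q : ℕ => (q.unpair.1.unpair.1, q.unpair.1.unpair.2,
      q.unpair.2.unpair.1, q.unpair.2.unpair.2) :=
    (primrec_unpair_fst.comp primrec_unpair_fst).pair
      ((primrec_unpair_snd.comp primrec_unpair_fst).pair
        ((primrec_unpair_fst.comp primrec_unpair_snd).pair
          (primrec_unpair_snd.comp primrec_unpair_snd)))
  have h2 := Computable.cond (hR.comp h1.to_comp) (Computable.const 1) (Computable.const 0)
  obtain ⟨c, hc⟩ := Code.exists_code.1 (Partrec.nat_iff.1 h2)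
  have h3 : ∀ k x y z, 1 ∈ c.eval (Nat.pair (Nat.pair k x) (Nat.pair y z)) ↔ R k x y z = true := by
    intro k x y z
    rw [hc]
    cases h : R k x y z <;> simp [h]
  refine ⟨fun k y z => decide (Code.evaln z.unpair.2 c (Nat.pair k (Nat.pair y z.unpair.1)) =
    some 1), ?_, fun i j => ?_⟩
  · refine PrimrecPred.decide (Primrec.eq.comp (Code.primrec_evaln.comp
      (((primrec_unpair_snd.comp (snd.comp snd)).pair (const c)).pair
        (Primrec₂.natPair.comp fst (Primrec₂.natPair.comp (fst.comp snd)
          (primrec_unpair_fst.comp (snd.comp snd)))))) (const (some 1)))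
  · have h4 := hE (Nat.pair i j)
    simp only [Set.mem_ofPred_eq, Nat.unpair_pair] at h4
    rw [h4]
    refine exists_congr fun x => forall_congr' fun y => ?_
    simp only [decide_eq_true_eq, ← h3, Code.evaln_complete, Option.mem_def]
    constructor
    · rintro ⟨z, t, h⟩
      exact ⟨Nat.pair z t, by simpa using h⟩
    · rintro ⟨w, h⟩
      exact ⟨_, _, h⟩

open Nat.Partrec in
theorem mem_V_iff {i a b : ℕ} : (a : ℤ) - b ∈ V i ↔
    ∃ t, (Code.evaln t (Denumerable.ofNat Code i) (subCode a b)).isSome := by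
  rw [mem_V_ofNat, encode_sub, Part.dom_iff_mem]
  simp only [Code.evaln_complete, Option.isSome_iff_exists, Option.mem_def]
  exact exists_comm

open Nat.Partrec in
theorem evaln_isSome_mono {c : Code} {n s t : ℕ} (h : (Code.evaln s c n).isSome) (hst : s ≤ t) :
    (Code.evaln t c n).isSome := by
  obtain ⟨x, hx⟩ := Option.isSome_iff_exists.1 h
  exact Option.isSome_iff_exists.2 ⟨x, Code.evaln_mono hst hx⟩

open Primrec Nat.Partrec in
theorem primrecPred_evaln_isSome {α : Type*} [Primcodable α] {f g a b : α → ℕ} (hf : Primrec f)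
    (hg : Primrec g) (ha : Primrec a) (hb : Primrec b) : PrimrecPred fun x =>
      (Code.evaln (f x) (Denumerable.ofNat Code (g x)) (subCode (a x) (b x))).isSome = true :=
  Primrec.eq.comp (option_isSome.comp (Code.primrec_evaln.comp
    ((hf.pair ((Primrec.ofNat Code).comp hg)).pair (primrec_subCode ha hb)))) (const true)

theorem exists_int_iff {p : ℤ → Prop} :
    (∃ n, p n) ↔ ∃ x : ℕ, p ((x.unpair.1 : ℤ) - x.unpair.2) := by
  constructor
  · rintro ⟨n, hn⟩
    refine ⟨Nat.pair n.toNat (-n).toNat, ?_⟩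
    simpa [Int.toNat_sub_toNat_neg] using hn
  · rintro ⟨x, hx⟩
    exact ⟨_, hx⟩

open Primrec Nat.Partrec in
theorem sigma03Rel_shiftEquiv : Sigma03Rel shiftEquiv := by
  let Q : ℕ → ℕ → ℕ → ℕ → Prop := fun i a b t =>
    (Code.evaln t (Denumerable.ofNat Code i) (subCode a b)).isSome = true
  have hQ : ∀ {i a b s t}, Q i a b s → s ≤ t → Q i a b t := fun h hst =>
    evaln_isSome_mono h hst
  let Q' : ℕ → ℕ → ℕ → ℕ → Prop := fun p x y =>
    Q p.unpair.2 (y.unpair.1.unpair.1 + x.unpair.2) (y.unpair.1.unpair.2 + x.unpair.1)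
  let S : ℕ → ℕ → ℕ → ℕ → Prop := fun p x y z =>
    (Q p.unpair.1 y.unpair.1.unpair.1 y.unpair.1.unpair.2 y.unpair.2 → Q' p x y z) ∧
      (Q' p x y y.unpair.2 → Q p.unpair.1 y.unpair.1.unpair.1 y.unpair.1.unpair.2 z)
  have hS : PrimrecPred fun q : ℕ × ℕ × ℕ × ℕ => S q.1 q.2.1 q.2.2.1 q.2.2.2 := by
    have hx : Primrec fun q : ℕ × ℕ × ℕ × ℕ => q.2.1 := fst.comp snd
    have hy : Primrec fun q : ℕ × ℕ × ℕ × ℕ => q.2.2.1 := fst.comp (snd.comp snd)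
    have hz : Primrec fun q : ℕ × ℕ × ℕ × ℕ => q.2.2.2 := snd.comp (snd.comp snd)
    have hi : Primrec fun q : ℕ × ℕ × ℕ × ℕ => q.1.unpair.1 := primrec_unpair_fst.comp fst
    have hj : Primrec fun q : ℕ × ℕ × ℕ × ℕ => q.1.unpair.2 := primrec_unpair_snd.comp fst
    have ht := primrec_unpair_snd.comp hy
    have hc := primrec_unpair_fst.comp (primrec_unpair_fst.comp hy)
    have hd := primrec_unpair_snd.comp (primrec_unpair_fst.comp hy)
    have hc' := nat_add.comp hc (primrec_unpair_snd.comp hx)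
    have hd' := nat_add.comp hd (primrec_unpair_fst.comp hx)
    exact (primrecPred_imp (primrecPred_evaln_isSome ht hi hc hd)
      (primrecPred_evaln_isSome hz hj hc' hd')).and
        (primrecPred_imp (primrecPred_evaln_isSome ht hj hc' hd')
          (primrecPred_evaln_isSome hz hi hc hd))
  classical
  refine ⟨fun p x y z => decide (S p x y z), hS.decide.to_comp, fun p => ?_⟩
  simp only [Set.mem_ofPred_eq, decide_eq_true_eq]
  rw [shiftEquiv_iff, exists_int_iff]
  refine exists_congr fun x => ?_
  have hV : ∀ y, ((y.unpair.1.unpair.1 : ℤ) - y.unpair.1.unpair.2) -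
      ((x.unpair.1 : ℤ) - x.unpair.2) ∈ V p.unpair.2 ↔ ∃ t, Q' p x y t := by
    intro y
    rw [← mem_V_iff]
    push_cast
    ring_nf
  constructor
  · intro h y
    have h1 : (∃ t, Q _ _ _ t) ↔ _ := mem_V_iff.symm.trans
      ((h (y.unpair.1.unpair.1 - y.unpair.1.unpair.2)).trans (hV y))
    obtain ⟨z₁, hz₁⟩ : ∃ z, Q p.unpair.1 y.unpair.1.unpair.1 y.unpair.1.unpair.2 y.unpair.2 →
        Q' p x y z := by
      by_cases hq : Q p.unpair.1 y.unpair.1.unpair.1 y.unpair.1.unpair.2 y.unpair.2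
      · exact (h1.1 ⟨_, hq⟩).imp fun _ h _ => h
      · exact ⟨0, fun h => absurd h hq⟩
    obtain ⟨z₂, hz₂⟩ : ∃ z, Q' p x y y.unpair.2 →
        Q p.unpair.1 y.unpair.1.unpair.1 y.unpair.1.unpair.2 z := by
      by_cases hq : Q' p x y y.unpair.2
      · exact (h1.2 ⟨_, hq⟩).imp fun _ h _ => h
      · exact ⟨0, fun h => absurd h hq⟩
    exact ⟨max z₁ z₂, fun hq => hQ (hz₁ hq) (le_max_left _ _),
      fun hq => hQ (hz₂ hq) (le_max_right _ _)⟩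
  · intro h m
    obtain ⟨w, rfl⟩ := exists_int_iff.1 ⟨m, rfl⟩
    have h1 : ∀ t, ∃ z, (Q p.unpair.1 w.unpair.1 w.unpair.2 t → Q' p x (Nat.pair w 0) z) ∧
        (Q' p x (Nat.pair w 0) t → Q p.unpair.1 w.unpair.1 w.unpair.2 z) := by
      intro t
      obtain ⟨z, hz⟩ := h (Nat.pair w t)
      exact ⟨z, by simpa [S, Q'] using hz⟩
    have h2 := hV (Nat.pair w 0)
    simp only [Nat.unpair_pair] at h2
    rw [h2, mem_V_iff]
    constructor
    · rintro ⟨t, ht⟩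
      exact (h1 t).imp fun z hz => hz.1 ht
    · rintro ⟨t, ht⟩
      exact (h1 t).imp fun z hz => hz.2 ht

end ShiftEquiv

/-- The shift equivalence relation `U` is a Σ⁰₃-complete equivalence relation. -/
theorem shiftEquiv_Sigma03Complete :
    Equivalence shiftEquiv ∧ Sigma03Rel shiftEquiv ∧
      ∀ E : ℕ → ℕ → Prop, Equivalence E → Sigma03Rel E → ComputableReduction E shiftEquiv := by
  refine ⟨ShiftEquiv.shiftEquiv_equivalence, ShiftEquiv.sigma03Rel_shiftEquiv,
    fun E hE h => ?_⟩
  obtain ⟨P, hprim, hP⟩ := ShiftEquiv.exists_primrec_of_sigma03Rel h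
  exact ShiftEquiv.exists_reduction_of_primrec hE hprim hP
end
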